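/- arXiv:math/0602606 — 5 statements merged into one kernel-verified Lean document; each statement's English description precedes it below -/
import Mathlib

section
/- Let A and B be regular local rings and let A → B be a ring homomorphism making B a finite flat A-module. If M is a finitely generated B-module which is flat as an A-module, then M is flat (equivalently, free) as a B-module. -/
/-- A noetherian local ring is *regular* if its maximal ideal can be generated by
`dim R` many elements, where `dim R` is the Krull dimension of `R`. -/
def IsRegularLocal (A : Type) [CommRing A] [IsLocalRing A] : Prop :=
  IsNoetherianRing A ∧ ∃ (n : ℕ) (f : Fin n → A),
    Ideal.span (Set.range f) = IsLocalRing.maximalIdeal A ∧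
    (n : WithBot (WithTop ℕ)) = ringKrullDim A

open IsLocalRing RingTheory.Sequence CategoryTheory
open scoped Pointwise

namespace IsLocalRing

variable {R : Type*} [CommRing R] [IsLocalRing R]

/-- An element outside `𝔪 ^ 2` can replace one of the given generators of `𝔪`. -/
lemma exists_span_insert_succAbove_eq_maximalIdeal {n : ℕ} {f : Fin (n + 1) → R}
    (hf : Ideal.span (Set.range f) = maximalIdeal R) {x : R}
    (hx : x ∈ maximalIdeal R) (hx2 : x ∉ maximalIdeal R ^ 2) :
    ∃ i : Fin (n + 1),
      Ideal.span (insert x (Set.range (f ∘ i.succAbove))) = maximalIdeal R := by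
  have hmem (i) : f i ∈ maximalIdeal R := hf ▸ Ideal.subset_span ⟨i, rfl⟩
  obtain ⟨c, hc⟩ := Ideal.mem_span_range_iff_exists_fun.mp (hf ▸ hx)
  obtain ⟨i, hi⟩ : ∃ i, IsUnit (c i) := by
    by_contra! h
    refine hx2 (hc ▸ Ideal.sum_mem _ fun i _ ↦ ?_)
    rw [pow_two]
    exact Ideal.mul_mem_mul ((mem_maximalIdeal _).mpr (h i)) (hmem i)
  refine ⟨i, le_antisymm ?_ ?_⟩
  · rw [Ideal.span_le, Set.insert_subset_iff]
    refine ⟨hx, ?_⟩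
    rintro _ ⟨j, rfl⟩
    exact hmem _
  · conv_lhs => rw [← hf]
    rw [Ideal.span_le]
    rintro _ ⟨j, rfl⟩
    have hj (j : Fin n) :
        f (i.succAbove j) ∈ Ideal.span (insert x (Set.range (f ∘ i.succAbove))) :=
      Ideal.subset_span (Set.mem_insert_of_mem _ ⟨j, rfl⟩)
    rcases Fin.eq_self_or_eq_succAbove i j with rfl | ⟨j, rfl⟩
    · rw [Fin.sum_univ_succAbove _ j] at hc
      refine (Ideal.unit_mul_mem_iff_mem _ hi).mp ?_
      rw [eq_sub_of_add_eq hc]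
      exact Ideal.sub_mem _ (Ideal.subset_span (Set.mem_insert _ _))
        (Ideal.sum_mem _ fun k _ ↦ Ideal.mul_mem_left _ _ (hj k))
    · exact hj j

/-- In a noetherian local ring of positive dimension, some element of `𝔪` avoids both `𝔪 ^ 2` and
all minimal primes. -/
lemma exists_mem_maximalIdeal_notMem_sq_notMem_minimalPrimes [IsNoetherianRing R]
    (h : maximalIdeal R ∉ minimalPrimes R) :
    ∃ x ∈ maximalIdeal R, x ∉ maximalIdeal R ^ 2 ∧ ∀ p ∈ minimalPrimes R, x ∉ p := by
  classical
  have hfin := minimalPrimes.finite_of_isNoetherianRing R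
  by_contra! H
  have hsub : (maximalIdeal R : Set R) ⊆
      ⋃ i ∈ (↑(insert (maximalIdeal R ^ 2) hfin.toFinset) : Set (Ideal R)), (i : Set R) := by
    intro x hx
    by_cases hx2 : x ∈ maximalIdeal R ^ 2
    · exact Set.mem_biUnion (by simp) hx2
    · obtain ⟨p, hp, hxp⟩ := H x hx hx2
      exact Set.mem_biUnion (by simp [hp]) hxp
  obtain ⟨i, hi, hle⟩ := (Ideal.subset_union_prime (f := id) (maximalIdeal R ^ 2)
    (maximalIdeal R ^ 2) (fun i hi hne _ ↦ by
      obtain rfl | hi := Finset.mem_insert.mp hi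
      · exact absurd rfl hne
      · exact (hfin.mem_toFinset.mp hi).1.1)).mp hsub
  obtain rfl | hi := Finset.mem_insert.mp hi
  · refine h ?_
    have hbot : maximalIdeal R = ⊥ :=
      Submodule.eq_bot_of_le_smul_of_le_jacobson_bot (maximalIdeal R) _
        (IsNoetherian.noetherian _) (by simpa [pow_two] using hle) (maximalIdeal_le_jacobson _)
    exact ⟨⟨inferInstance, bot_le⟩, fun q _ _ ↦ hbot ▸ bot_le⟩
  · have hi := hfin.mem_toFinset.mp hi
    have := hi.1.1
    exact h (le_antisymm hle (le_maximalIdeal this.ne_top) ▸ hi)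

/-- A noetherian local ring with a prime principal ideal generated by an element which lies in no
minimal prime is a domain. -/
lemma isDomain_of_isPrime_span_singleton [IsNoetherianRing R] {x : R}
    (hx : (Ideal.span {x}).IsPrime) (hmin : ∀ p ∈ minimalPrimes R, x ∉ p) : IsDomain R := by
  obtain ⟨q, hq, hqx⟩ := Ideal.exists_minimalPrimes_le (bot_le : ⊥ ≤ Ideal.span {x})
  have hqp := hq.1.1
  have hbot : q = ⊥ := by
    refine Submodule.eq_bot_of_le_smul_of_le_jacobson_bot (Ideal.span {x}) _
      (IsNoetherian.noetherian _) (fun y hy ↦ ?_)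
      ((le_maximalIdeal hx.ne_top).trans (maximalIdeal_le_jacobson _))
    obtain ⟨z, rfl⟩ := Ideal.mem_span_singleton'.mp (hqx hy)
    rw [mul_comm]
    exact Ideal.mul_mem_mul (Ideal.mem_span_singleton_self x)
      ((hqp.mem_or_mem hy).resolve_right (hmin q hq))
  subst hbot
  exact IsDomain.of_bot_isPrime R

end IsLocalRing

/-- A regular local ring is a domain, and its maximal ideal is generated by a regular sequence. -/
lemma isDomain_and_exists_isWeaklyRegular_of_span_eq_maximalIdeal (n : ℕ) (R : Type*) [CommRing R]
    [IsLocalRing R] [IsNoetherianRing R] (f : Fin n → R)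
    (hf : Ideal.span (Set.range f) = maximalIdeal R) (hn : (n : WithBot ℕ∞) ≤ ringKrullDim R) :
    IsDomain R ∧ ∃ rs : List R, IsWeaklyRegular R rs ∧ Ideal.ofList rs = maximalIdeal R ∧
      rs.length = n := by
  induction n generalizing R with
  | zero =>
    have hbot : maximalIdeal R = ⊥ := by simpa using hf.symm
    have : (⊥ : Ideal R).IsPrime := hbot ▸ inferInstance
    exact ⟨IsDomain.of_bot_isPrime R, [], by simp [hbot]⟩
  | succ n ih =>
    have hm : maximalIdeal R ∉ minimalPrimes R := by
      rw [← Ideal.height_eq_zero_iff]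
      intro h
      rw [← maximalIdeal_height_eq_ringKrullDim, h] at hn
      norm_cast at hn
    obtain ⟨x, hx, hx2, hmin⟩ := exists_mem_maximalIdeal_notMem_sq_notMem_minimalPrimes hm
    obtain ⟨i, hi⟩ := exists_span_insert_succAbove_eq_maximalIdeal hf hx hx2
    have hxtop : Ideal.span {x} ≠ ⊤ := by
      rw [Ne, Ideal.span_singleton_eq_top]
      exact (mem_maximalIdeal x).mp hx
    have : Nontrivial (R ⧸ Ideal.span {x}) := Ideal.Quotient.nontrivial_iff.mpr hxtop
    have hsurj := Ideal.Quotient.mk_surjective (I := Ideal.span {x})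
    have : IsLocalRing (R ⧸ Ideal.span {x}) := .of_surjective' _ hsurj
    have : IsLocalHom (Ideal.Quotient.mk (Ideal.span {x})) := .of_surjective _ hsurj
    have hmap : (maximalIdeal R).map (Ideal.Quotient.mk (Ideal.span {x})) =
        maximalIdeal (R ⧸ Ideal.span {x}) := by
      rw [← maximalIdeal_comap (Ideal.Quotient.mk (Ideal.span {x})),
        Ideal.map_comap_of_surjective _ hsurj]
    have hmap' : Ideal.span (Set.range (Ideal.Quotient.mk (Ideal.span {x}) ∘ f ∘ i.succAbove)) =
        maximalIdeal (R ⧸ Ideal.span {x}) := by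
      rw [← hmap, ← hi, Ideal.map_span, Set.image_insert_eq, ← Set.range_comp,
        Ideal.Quotient.eq_zero_iff_mem.mpr (Ideal.mem_span_singleton_self x),
        Ideal.span_insert_zero]
    have hspan : x • (⊤ : Ideal R) = Ideal.span {x} := by
      rw [← Submodule.ideal_span_singleton_smul, smul_eq_mul, Ideal.mul_top]
    have hdim : (n : WithBot ℕ∞) ≤ ringKrullDim (R ⧸ Ideal.span {x}) := by
      have := hn.trans (ringKrullDim_le_ringKrullDim_quotSMulTop_succ hx)
      rw [hspan] at this
      exact_mod_cast (ENat.WithBot.add_le_add_natCast_right_iff (c := 1)).mp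
        (by exact_mod_cast this)
    obtain ⟨hdom, rs, hrs, hrsm, hlen⟩ := ih _ _ hmap' hdim
    have hprime : (Ideal.span {x}).IsPrime := (Ideal.Quotient.isDomain_iff_prime _).mp hdom
    have hR := isDomain_of_isPrime_span_singleton hprime hmin
    have hx0 : x ≠ 0 := fun h ↦ hx2 (h ▸ Ideal.zero_mem _)
    refine ⟨hR, ?_⟩
    obtain ⟨rs, rfl⟩ := List.map_surjective_iff.mpr hsurj rs
    refine ⟨x :: rs, ?_, ?_, by simpa using hlen⟩
    · rw [isWeaklyRegular_cons_iff]
      refine ⟨(IsRegular.of_ne_zero hx0).left, ?_⟩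
      exact ((Submodule.quotEquivOfEq _ _ hspan).isWeaklyRegular_congr rs).mpr
        ((isWeaklyRegular_map_algebraMap_iff (R ⧸ Ideal.span {x}) _ rs).mp hrs)
    · have := congrArg (Ideal.comap (Ideal.Quotient.mk (Ideal.span {x}))) hrsm
      rw [← Ideal.map_ofList, maximalIdeal_comap, Ideal.comap_map_of_surjective _ hsurj,
        ← RingHom.ker_eq_comap_bot, Ideal.mk_ker] at this
      rw [Ideal.ofList_cons, sup_comm, this]

universe u

/-- Over a local ring, the projective dimension of a module of finite length is at most that of
the residue field. -/
lemma hasProjectiveDimensionLE_of_isFiniteLength {R : Type u} [CommRing R] [IsLocalRing R] (n : ℕ)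
    [HasProjectiveDimensionLE (ModuleCat.of R (R ⧸ maximalIdeal R)) n]
    (N : Type u) [AddCommGroup N] [Module R N] (hN : IsFiniteLength R N) :
    HasProjectiveDimensionLE (ModuleCat.of R N) n := by
  induction hN with
  | @of_subsingleton N _ _ _ =>
    have := (ModuleCat.isZero_of_subsingleton (ModuleCat.of R N)).hasProjectiveDimensionLT_zero
    exact hasProjectiveDimensionLT_of_ge _ 0 _ (Nat.zero_le _)
  | @of_simple_quotient N _ _ K _ _ ih =>
    obtain ⟨I, hI, ⟨e⟩⟩ := isSimpleModule_iff_quot_maximal.mp ‹IsSimpleModule R (N ⧸ K)›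
    obtain rfl := eq_maximalIdeal hI
    have hq : HasProjectiveDimensionLE (ModuleCat.of R (N ⧸ K)) n :=
      hasProjectiveDimensionLT_of_iso e.symm.toModuleIso _
    have hk : HasProjectiveDimensionLE (ModuleCat.of R (LinearMap.ker K.mkQ)) n :=
      hasProjectiveDimensionLT_of_iso (LinearEquiv.ofEq _ _ K.ker_mkQ.symm).toModuleIso _
    exact (LinearMap.shortExact_shortComplexKer K.mkQ_surjective).hasProjectiveDimensionLT_X₂ _
      hk hq

/-- The fibre over the closed point of a finite module over a finite algebra has finite length. -/
lemma isFiniteLength_quotient_map_maximalIdeal_smul_top (A : Type*) {B : Type*} [CommRing A]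
    [CommRing B] [IsLocalRing A] [IsNoetherianRing B] [Algebra A B] [Module.Finite A B] (M : Type*) [AddCommGroup M]
    [Module B M] [Module.Finite B M] :
    IsFiniteLength B (M ⧸ ((maximalIdeal A).map (algebraMap A B) • (⊤ : Submodule B M))) := by
  let I := (maximalIdeal A).map (algebraMap A B)
  let := Ideal.Quotient.field (maximalIdeal A)
  have : IsArtinianRing (B ⧸ I) := by
    have : Module.Finite (A ⧸ maximalIdeal A) (B ⧸ I) := .of_restrictScalars_finite A _ _
    exact isArtinian_of_tower (A ⧸ maximalIdeal A) inferInstance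
  have : Module.Finite (B ⧸ I) (M ⧸ (I • (⊤ : Submodule B M))) :=
    .of_restrictScalars_finite B _ _
  have hsurj : Function.Surjective (algebraMap B (B ⧸ I)) := Ideal.Quotient.mk_surjective
  rw [isFiniteLength_iff_isNoetherian_isArtinian]
  exact ⟨inferInstance, isArtinian_of_surjective_algebraMap (R := B ⧸ I) hsurj⟩

lemma ringKrullDim_le_of_isIntegral (A B : Type*) [CommRing A] [CommRing B] [Algebra A B]
    [Algebra.IsIntegral A B] : ringKrullDim B ≤ ringKrullDim A :=
  Order.krullDim_le_of_strictMono (PrimeSpectrum.comap (algebraMap A B)) fun _ _ h ↦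
    Ideal.IsIntegral.comap_lt_comap h

/-- Let `A` and `B` be regular local rings and let `A → B` be a ring
homomorphism making `B` a finite flat `A`-module.  If `M` is a finitely generated `B`-module
which is flat as an `A`-module, then `M` is flat (equivalently, free) as a `B`-module. -/
theorem flat_descent_of_regular_local
    (A B : Type) [CommRing A] [CommRing B] [IsLocalRing A] [IsLocalRing B]
    (hA : IsRegularLocal A) (hB : IsRegularLocal B)
    [Algebra A B] [Module.Finite A B] [Module.Flat A B]
    (M : Type) [AddCommGroup M] [Module B M] [Module A M] [IsScalarTower A B M]
    [Module.Finite B M] (hM : Module.Flat A M) :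
    Module.Flat B M ∧ Module.Free B M := by
  suffices Module.Free B M from ⟨inferInstance, this⟩
  nontriviality M
  obtain ⟨_, m, f, hf, hm⟩ := hA
  obtain ⟨_, n, g, hg, hn⟩ := hB
  obtain ⟨-, rs, hrs, hrsm, hlen⟩ :=
    isDomain_and_exists_isWeaklyRegular_of_span_eq_maximalIdeal m A f hf hm.le
  obtain ⟨-, ss, hss, hssm, hslen⟩ :=
    isDomain_and_exists_isWeaklyRegular_of_span_eq_maximalIdeal n B g hg hn.le
  have hnm : n ≤ m := by
    have := ringKrullDim_le_of_isIntegral A B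
    rw [← hm, ← hn] at this
    change (n : WithBot ℕ∞) ≤ (m : WithBot ℕ∞) at this
    exact_mod_cast this
  have hss' : IsRegular B ss := .of_isWeaklyRegular_of_mem_maximalIdeal _
    (fun _ hr ↦ hssm.le (Ideal.subset_span hr)) hss
  have hk : HasProjectiveDimensionLE (ModuleCat.of B (B ⧸ maximalIdeal B)) n := by
    have := ModuleCat.projectiveDimension_quotient_eq_length.{0} ss hss'
    rw [hssm, hslen] at this
    have := (projectiveDimension_le_iff _ _).mp this.le
    exact hasProjectiveDimensionLT_of_iso (Shrink.linearEquiv B _).toModuleIso _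
  have hrsM : IsWeaklyRegular M (rs.map (algebraMap A B)) := by
    rw [isWeaklyRegular_map_algebraMap_iff]
    exact ((TensorProduct.lid A M).isWeaklyRegular_congr rs).mp hrs.isWeaklyRegular_rTensor
  have hfin := isFiniteLength_quotient_map_maximalIdeal_smul_top A (B := B) M
  rw [← hrsm, Ideal.map_ofList] at hfin
  have hpd := hasProjectiveDimensionLE_of_isFiniteLength n _ hfin
  have hmem : ∀ r ∈ rs.map (algebraMap A B), r ∈ maximalIdeal B := by
    have hcomap : (maximalIdeal B).comap (algebraMap A B) = maximalIdeal A :=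
      eq_maximalIdeal (Ideal.isMaximal_comap_of_isIntegral_of_isMaximal (maximalIdeal B))
    simp only [List.mem_map, forall_exists_index, and_imp, forall_apply_eq_imp_iff₂]
    exact fun r hr ↦ hcomap.ge (hrsm ▸ Ideal.subset_span hr)
  rw [← projectiveDimension_le_iff,
    ModuleCat.projectiveDimension_quotient_eq_add_length_of_isWeaklyRegular
      (ModuleCat.of B M) _ hrsM hmem, List.length_map, hlen] at hpd
  have : HasProjectiveDimensionLE (ModuleCat.of B M) 0 := by
    rw [← projectiveDimension_le_iff]
    refine (ENat.WithBot.add_le_add_natCast_right_iff (c := m)).mp (hpd.trans ?_)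
    simpa using hnm
  have := (projective_iff_hasProjectiveDimensionLE_zero _).mpr this
  have : Module.Projective B M := (IsProjective.iff_projective M).mpr this
  exact Module.free_of_flat_of_isLocalRing
end

section
/- Let ℓ ≥ 3 be a prime, k an algebraically closed field of characteristic ℓ, G a finite group, ρ : G → GL₂(k) a group homomorphism whose associated representation on k² is irreducible, and H a normal subgroup of G whose index [G:H] is a power of ℓ. Then the projective image of ρ restricted to H equals the projective image of ρ, except possibly when: ℓ = 3, the projective image of ρ is isomorphic as a group to PSL₂(𝔽₃) = SL₂(𝔽₃)/{±I} (the alternating group on 4 letters), and the projective image of ρ|_H is isomorphic to ℤ/2 × ℤ/2. -/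
/-- A 2-dimensional representation `ρ : G → GL₂(k)` is irreducible if no nonzero proper
subspace of `k²` is stable under all `ρ(g)`. -/
def MatIrred {k : Type} [Field k] {G : Type} [Group G]
    (ρ : G →* Matrix.GeneralLinearGroup (Fin 2) k) : Prop :=
  ∀ W : Submodule k (Fin 2 → k),
    (∀ g : G, ∀ x ∈ W, (ρ g : Matrix (Fin 2) (Fin 2) k).mulVec x ∈ W) → W = ⊥ ∨ W = ⊤

/-- `PGL₂(k)`: the quotient of `GL₂(k)` by its center (the scalar matrices). -/
abbrev PGL2 (k : Type) [CommRing k] : Type :=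
  Matrix.GeneralLinearGroup (Fin 2) k ⧸ Subgroup.center (Matrix.GeneralLinearGroup (Fin 2) k)

/-- The projective image of a homomorphism `ρ : G → GL₂(k)`: the image of the composite
`G → GL₂(k) → PGL₂(k)`. -/
def projImage {k : Type} [CommRing k] {G : Type} [Group G]
    (ρ : G →* Matrix.GeneralLinearGroup (Fin 2) k) : Subgroup (PGL2 k) :=
  ((QuotientGroup.mk' (Subgroup.center (Matrix.GeneralLinearGroup (Fin 2) k))).comp ρ).range

/-- `PSL₂(𝔽₃) = SL₂(𝔽₃)/{±1}` (the alternating group on four letters). -/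
abbrev PSL2F3 : Type :=
  Matrix.SpecialLinearGroup (Fin 2) (ZMod 3) ⧸
    Subgroup.center (Matrix.SpecialLinearGroup (Fin 2) (ZMod 3))

open MulAction

/-- The action of a group on the set of orbits of a normal subgroup. -/
@[reducible]
def orbitQuotientMulAction {P E : Type*} [Group P] [MulAction P E] (K : Subgroup P) [K.Normal] :
    MulAction P (orbitRel.Quotient K E) where
  smul p := Quotient.map' (p • ·) (by
    rintro x y ⟨k, rfl⟩
    refine ⟨⟨p * k * p⁻¹, Subgroup.Normal.conj_mem ‹_› _ k.2 p⟩, ?_⟩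
    simp [Subgroup.smul_def, mul_smul])
  one_smul := by
    rintro ⟨x⟩
    exact congrArg (Quotient.mk'' (s₁ := orbitRel K E)) (one_smul P x)
  mul_smul := by
    rintro p q ⟨x⟩
    exact congrArg (Quotient.mk'' (s₁ := orbitRel K E)) (mul_smul p q x)

/-- A `p`-element stabilising an orbit of a normal prime-to-`p` subgroup has a fixed point in that orbit. -/
theorem exists_fixed_of_orbit_fixed {P E : Type*} [Group P] [Finite P] [MulAction P E]
    {p : ℕ} [Fact p.Prime] (K : Subgroup P) [K.Normal] (hK : ¬ p ∣ Nat.card K)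
    {S : Subgroup P} (hS : IsPGroup p S) {s : P} (hs : s ∈ S) (x : E)
    (hx : s • x ∈ orbit K x) : ∃ y ∈ orbit K x, s • y = y := by
  have hstab : ∀ y ∈ orbit K x, s • y ∈ orbit K x := by
    rintro _ ⟨k, rfl⟩
    obtain ⟨l, hl⟩ := hx
    refine ⟨⟨s * k * s⁻¹, Subgroup.Normal.conj_mem ‹_› _ k.2 s⟩ * l, ?_⟩
    simp only [mul_smul] at hl ⊢
    rw [hl]
    simp [Subgroup.smul_def, mul_smul]
  have hpow : ∀ g : Subgroup.zpowers s, ∀ y ∈ orbit K x, g • y ∈ orbit K x := by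
    rintro ⟨g, hg⟩ y hy
    obtain ⟨n, rfl⟩ := (mem_powers_iff_mem_zpowers).2 hg
    change s ^ n • y ∈ _
    clear hg
    induction n with
    | zero => simpa using hy
    | succ n ih =>
      rw [pow_succ', mul_smul]
      exact hstab _ ih
  let T : SubMulAction (Subgroup.zpowers s) E := ⟨orbit K x, fun g y hy => hpow g y hy⟩
  have hcard : ¬ p ∣ Nat.card T := by
    intro h
    refine hK (h.trans ?_)
    change Nat.card (orbit K x) ∣ _
    rw [Nat.card_congr (orbitEquivQuotientStabilizer K x)]
    exact Subgroup.card_quotient_dvd_card _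
  have hz : IsPGroup p (Subgroup.zpowers s) := hS.to_le (by simpa using hs)
  have : Finite T := Set.finite_coe_iff.2 (Set.finite_range _)
  obtain ⟨y, hy⟩ := hz.nonempty_fixed_point_of_prime_not_dvd_card T hcard
  exact ⟨y, y.2, congrArg Subtype.val (hy ⟨s, Subgroup.mem_zpowers s⟩)⟩

/-- Orbit count for a finite group whose nontrivial elements have exactly two fixed points. -/
theorem card_add_eq_card_orbits_mul {K E : Type*} [Group K] [Finite K] [Finite E] [MulAction K E]
    (h2 : ∀ k : K, k ≠ 1 → Nat.card (fixedBy E k) = 2) :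
    Nat.card E + 2 * (Nat.card K - 1) = Nat.card (orbitRel.Quotient K E) * Nat.card K := by
  classical
  have := Fintype.ofFinite K
  have := Fintype.ofFinite E
  have := Fintype.ofFinite (orbitRel.Quotient K E)
  simp only [Nat.card_eq_fintype_card] at h2 ⊢
  rw [← sum_card_fixedBy_eq_card_orbits_mul_card_group K E,
    ← Finset.add_sum_erase _ _ (Finset.mem_univ 1),
    Finset.sum_congr rfl (fun k hk => h2 k (Finset.ne_of_mem_erase hk))]
  simp [mul_comm]

theorem card_orbit_mul_card_stabilizer' {K E : Type*} [Group K] [MulAction K E] (x : E) :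
    Nat.card (orbit K x) * Nat.card (stabilizer K x) = Nat.card K := by
  rw [Nat.card_congr (orbitEquivQuotientStabilizer K x)]
  exact (Subgroup.card_eq_card_quotient_mul_card_subgroup _).symm

theorem card_eq_sum_card_orbit {K E : Type*} [Group K] [Finite E] [MulAction K E]
    [Fintype (orbitRel.Quotient K E)] :
    Nat.card E = ∑ ω : orbitRel.Quotient K E, Nat.card (orbit K ω.out) := by
  rw [Nat.card_congr (selfEquivSigmaOrbits K E), Nat.card_sigma]

/-- A normal prime-to-`p` subgroup whose nontrivial elements have two fixed points each, together with a
nontrivial `p`-subgroup whose nontrivial elements have at most one fixed point, must be a Klein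
four-group and a group of order `3`. -/
theorem card_eq_of_fixedBy_card_eq_two {P E : Type*} [Group P] [Finite P] [Finite E] [MulAction P E]
    {p : ℕ} [Fact p.Prime] (hp3 : 3 ≤ p) (K : Subgroup P) [K.Normal] (hK : ¬ p ∣ Nat.card K)
    (hK1 : K ≠ ⊥) {S : Subgroup P} (hS : IsPGroup p S) (hS1 : S ≠ ⊥)
    (h1 : ∀ s ∈ S, s ≠ 1 → ∀ x y : E, s • x = x → s • y = y → x = y)
    (h2 : ∀ k ∈ K, k ≠ 1 → Nat.card (fixedBy E k) = 2)
    (hE : ∀ x : E, ∃ k ∈ K, k ≠ 1 ∧ k • x = x) :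
    p = 3 ∧ Nat.card S = 3 ∧ Nat.card K = 4 ∧ ∀ k ∈ K, k ^ 2 = 1 := by
  classical
  have := Fintype.ofFinite (orbitRel.Quotient K E)
  let _ := orbitQuotientMulAction (E := E) K
  have hsmul : ∀ (g : P) (x : E), g • (Quotient.mk'' x : orbitRel.Quotient K E) =
    Quotient.mk'' (g • x) := fun _ _ => rfl
  set n := Nat.card K with hn
  set r := Nat.card (orbitRel.Quotient K E) with hr
  have hn2 : 2 ≤ n := (Subgroup.one_lt_card_iff_ne_bot K).2 hK1
  have hcount : Nat.card E + 2 * (n - 1) = r * n := by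
    refine card_add_eq_card_orbits_mul fun k hk => ?_
    exact h2 k k.2 (by simpa using hk)
  have hstab2 : ∀ x : E, 2 ≤ Nat.card (stabilizer K x) := by
    intro x
    obtain ⟨k, hk, hk1, hkx⟩ := hE x
    refine (Subgroup.one_lt_card_iff_ne_bot _).2 fun h => hk1 ?_
    have : (⟨k, hk⟩ : K) ∈ stabilizer K x := hkx
    rw [h] at this
    simpa using this
  have horb := fun x : E => card_orbit_mul_card_stabilizer' (K := K) x
  have hle : 2 * Nat.card E ≤ r * n := by
    rw [card_eq_sum_card_orbit (K := K) (E := E), Finset.mul_sum, hr, Nat.card_eq_fintype_card,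
      ← smul_eq_mul, ← Finset.card_univ]
    refine Finset.sum_le_card_nsmul _ _ _ fun ω _ => ?_
    have h1 := horb ω.out
    have h2 := hstab2 ω.out
    rw [hn, ← h1]
    nlinarith
  have hr3 : r ≤ 3 := by
    by_contra h
    have h4 : 4 ≤ r := by omega
    have := Nat.mul_le_mul_right n h4
    omega
  have hpos : 0 < Nat.card E := by
    rw [Nat.card_pos_iff]
    obtain ⟨k, hk1⟩ := Subgroup.ne_bot_iff_exists_ne_one.1 hK1
    refine ⟨?_, inferInstance⟩
    have := h2 k k.2 (by simpa using hk1)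
    obtain ⟨⟨x, _⟩⟩ := (Nat.card_pos_iff.1 (by omega : 0 < Nat.card (fixedBy E (k : P)))).1
    exact ⟨x⟩
  have hr2 : 2 ≤ r := by
    by_contra h
    have : r = 0 ∨ r = 1 := by omega
    rcases this with h | h <;> rw [h] at hcount <;> omega
  have hfix : ∀ s ∈ S, s ≠ 1 → ∀ ω η : orbitRel.Quotient K E, s • ω = ω → s • η = η → ω = η := by
    intro s hs hs1 ω η
    induction ω using Quotient.inductionOn' with | _ x
    induction η using Quotient.inductionOn' with | _ y
    intro hx hy
    rw [hsmul, Quotient.eq''] at hx hy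
    obtain ⟨x', hx', hsx⟩ := exists_fixed_of_orbit_fixed K hK hS hs x hx
    obtain ⟨y', hy', hsy⟩ := exists_fixed_of_orbit_fixed K hK hS hs y hy
    have hxy := h1 s hs hs1 x' y' hsx hsy
    subst hxy
    rw [Quotient.eq'']
    exact orbit_eq_iff.1 ((orbit_eq_iff.2 hx').symm.trans (orbit_eq_iff.2 hy'))
  have hnofix : p = 3 ∧ r = 3 ∧ ∀ s ∈ S, s ≠ 1 → ∀ ω : orbitRel.Quotient K E, s • ω ≠ ω := by
    have key : ∀ s ∈ S, s ≠ 1 → p = 3 ∧ r = 3 ∧ ∀ ω : orbitRel.Quotient K E, s • ω ≠ ω := by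
      intro s hs hs1
      have hz : IsPGroup p (Subgroup.zpowers s) := hS.to_le (by simpa using hs)
      have hmod := hz.card_modEq_card_fixedPoints (orbitRel.Quotient K E)
      rw [← hr] at hmod
      have hsub : Subsingleton (fixedPoints (Subgroup.zpowers s) (orbitRel.Quotient K E)) :=
        ⟨fun a b => Subtype.ext (hfix s hs hs1 _ _ (a.2 ⟨s, Subgroup.mem_zpowers s⟩)
          (b.2 ⟨s, Subgroup.mem_zpowers s⟩))⟩
      have hf1 : Nat.card (fixedPoints (Subgroup.zpowers s) (orbitRel.Quotient K E)) ≤ 1 :=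
        Finite.card_le_one_iff_subsingleton.2 hsub
      have hdvd := (Nat.modEq_iff_dvd' (by omega)).1 hmod.symm
      have hle := Nat.le_of_dvd (by omega) hdvd
      refine ⟨by omega, by omega, fun ω hω => ?_⟩
      have h0 : Nat.card (fixedPoints (Subgroup.zpowers s) (orbitRel.Quotient K E)) = 0 := by omega
      rw [Finite.card_eq_zero_iff] at h0
      refine h0.false ⟨ω, ?_⟩
      rintro ⟨g, hg⟩
      change g • ω = ω
      have : Subgroup.zpowers s ≤ stabilizer P ω := by simpa using hω
      exact this hg
    obtain ⟨s, hs1⟩ := Subgroup.ne_bot_iff_exists_ne_one.1 hS1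
    have := key s s.2 (by simpa using hs1)
    exact ⟨this.1, this.2.1, fun s hs hs1 => (key s hs hs1).2.2⟩
  obtain ⟨hp, hr', hnofix⟩ := hnofix
  have hstabS : ∀ ω : orbitRel.Quotient K E, Nat.card (orbit S ω) = Nat.card S := by
    intro ω
    have hbot : stabilizer S ω = ⊥ := by
      rw [eq_bot_iff]
      intro s hs
      by_contra h
      exact hnofix s s.2 (by simpa using h) ω hs
    have := card_orbit_mul_card_stabilizer' (K := S) ω
    simpa [hbot] using this
  obtain ⟨x₀⟩ := (Nat.card_pos_iff.1 hpos).1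
  have hSle : Nat.card S ≤ 3 := by
    rw [← hr', ← hstabS (Quotient.mk'' x₀)]
    exact Finite.card_subtype_le _
  have hS3 : Nat.card S = 3 := by
    have h1 := (Subgroup.one_lt_card_iff_ne_bot S).2 hS1
    have h2 := hS.card_eq_or_dvd
    rcases h2 with h | h
    · omega
    · have := Nat.le_of_dvd (by omega) h
      omega
  have htrans : ∀ x : E, ∃ s ∈ S, s • x₀ ∈ orbit K x := by
    intro x
    have huniv : orbit S (Quotient.mk'' x₀ : orbitRel.Quotient K E) = Set.univ := by
      refine Set.eq_of_subset_of_ncard_le (Set.subset_univ _) (le_of_eq ?_)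
      rw [Set.ncard_univ, ← Nat.card_coe_set_eq, hstabS, ← hr, hS3, hr']
    obtain ⟨s, hs⟩ := huniv ▸ Set.mem_univ (Quotient.mk'' x : orbitRel.Quotient K E)
    refine ⟨s, s.2, ?_⟩
    change (Quotient.mk'' ((s : P) • x₀) : orbitRel.Quotient K E) = _ at hs
    rw [Quotient.eq''] at hs
    exact hs
  have hcardorb : ∀ x : E, Nat.card (orbit K x) = Nat.card (orbit K x₀) := by
    intro x
    obtain ⟨s, -, hs⟩ := htrans x
    rw [← orbit_eq_iff.2 hs]
    refine (Nat.card_congr ?_).symm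
    refine Equiv.subtypeEquiv (MulAction.toPerm s) fun y => ?_
    constructor
    · rintro ⟨k, rfl⟩
      exact ⟨⟨s * k * s⁻¹, Subgroup.Normal.conj_mem ‹_› _ k.2 s⟩, by
        simp [Subgroup.smul_def, mul_smul]⟩
    · rintro ⟨k, hk⟩
      refine ⟨⟨s⁻¹ * k * s, by simpa using Subgroup.Normal.conj_mem ‹_› _ k.2 s⁻¹⟩, ?_⟩
      simp only [Subgroup.smul_def, mul_smul, toPerm_apply] at hk ⊢
      rw [hk, inv_smul_smul]
  have hcardE : Nat.card E = 3 * Nat.card (orbit K x₀) := by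
    rw [card_eq_sum_card_orbit (K := K) (E := E), Finset.sum_congr rfl (fun ω _ => hcardorb ω.out)]
    rw [Finset.sum_const, Finset.card_univ, ← Nat.card_eq_fintype_card, ← hr, hr', smul_eq_mul]
  have hsolve : Nat.card (orbit K x₀) = 2 ∧ n = 4 := by
    have h1 := horb x₀
    have h2 := hstab2 x₀
    rw [hcardE, hr'] at hcount
    set w := Nat.card (orbit K x₀)
    set e := Nat.card (stabilizer K x₀)
    have he : e = 2 := by
      by_contra h
      have h3 : 3 ≤ e := by omega
      have := Nat.mul_le_mul_left w h3
      omega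
    rw [he] at h1
    omega
  refine ⟨hp, hS3, hsolve.2, fun k hk => ?_⟩
  by_cases hk1 : k = 1
  · simp [hk1]
  have := h2 k hk hk1
  obtain ⟨⟨x, hx⟩⟩ := (Nat.card_pos_iff.1 (by omega : 0 < Nat.card (fixedBy E k))).1
  have hst : Nat.card (stabilizer K x) = 2 := by
    have h1 := horb x
    rw [hcardorb, hsolve.1] at h1
    omega
  have hmem : (⟨k, hk⟩ : K) ∈ stabilizer K x := hx
  have := pow_card_eq_one' (x := (⟨⟨k, hk⟩, hmem⟩ : stabilizer K x))
  rw [hst] at this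
  simpa [Subtype.ext_iff] using this

theorem mem_of_coprime_index {P : Type*} [Group P] (N : Subgroup P) [N.Normal] {g : P} {n : ℕ}
    (hn : n.Coprime N.index) (hg : g ^ n = 1) : g ∈ N := by
  rw [← QuotientGroup.eq_one_iff]
  have h1 : (g : P ⧸ N) ^ n = 1 := by rw [← QuotientGroup.mk_pow, hg, QuotientGroup.mk_one]
  have h2 : (g : P ⧸ N) ^ N.index = 1 := pow_card_eq_one'
  have := pow_gcd_eq_one.2 ⟨h1, h2⟩
  rwa [Nat.Coprime.gcd_eq_one hn, pow_one] at this

/-- Nontrivial `p`-elements have a unique fixed point, nontrivial prime-to-`p` elements have two, and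
`p`-elements with a common fixed point commute: the action of a finite subgroup of `PGL₂` on the
projective line in characteristic `p`. -/
structure IsMoebiusLike (p : ℕ) (P X : Type*) [Group P] [MulAction P X] : Prop where
  existsUnique_fixed : ∀ (g : P) (n : ℕ), g ≠ 1 → g ^ p ^ n = 1 → ∃! x : X, g • x = x
  card_fixedBy : ∀ (g : P) (n : ℕ), g ≠ 1 → n.Coprime p → g ^ n = 1 → Nat.card (fixedBy X g) = 2
  commute : ∀ (g h : P) (m n : ℕ) (x : X), g ^ p ^ m = 1 → h ^ p ^ n = 1 →
    g • x = x → h • x = x → Commute g h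

namespace IsMoebiusLike

variable {P X : Type*} [Group P] [MulAction P X] {p : ℕ} [Fact p.Prime]

/-- A prime-to-`p` element and a `p`-element that commute cannot both be nontrivial. -/
theorem eq_one_of_commute (h : IsMoebiusLike p P X) (hp3 : 3 ≤ p) {c s : P} {n m : ℕ}
    (hc : c ≠ 1) (hn : n.Coprime p) (hcn : c ^ n = 1) (hsm : s ^ p ^ m = 1)
    (hcs : Commute c s) : s = 1 := by
  by_contra hs
  obtain ⟨x, hx, hux⟩ := h.existsUnique_fixed s m hs hsm
  have h2 := h.card_fixedBy c n hc hn hcn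
  have hfin : Finite (fixedBy X c) := Nat.finite_of_card_ne_zero (by omega)
  have hstab : ∀ g ∈ Subgroup.zpowers s, ∀ y ∈ fixedBy X c, g • y ∈ fixedBy X c := by
    rintro _ ⟨i, rfl⟩ y hy
    rw [mem_fixedBy] at hy ⊢
    rw [← mul_smul, (hcs.zpow_right i).eq, mul_smul, hy]
  let T : SubMulAction (Subgroup.zpowers s) X := ⟨fixedBy X c, fun g y hy => hstab g g.2 y hy⟩
  have hcardT : Nat.card T = 2 := h2
  have : Finite T := hfin
  have hz : IsPGroup p (Subgroup.zpowers s) := by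
    rintro ⟨_, i, rfl⟩
    refine ⟨m, Subtype.ext ?_⟩
    change (s ^ i) ^ p ^ m = 1
    rw [← zpow_natCast, zpow_comm, zpow_natCast, hsm, one_zpow]
  have hmod := hz.card_modEq_card_fixedPoints T
  have hsub : Subsingleton (fixedPoints (Subgroup.zpowers s) T) := by
    refine ⟨fun a b => Subtype.ext (Subtype.ext ?_)⟩
    have key : ∀ a : fixedPoints (Subgroup.zpowers s) T, (a.1 : X) = x := fun a =>
      hux _ (congrArg Subtype.val (a.2 ⟨s, Subgroup.mem_zpowers s⟩))
    rw [key a, key b]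
  have hf1 := Finite.card_le_one_iff_subsingleton.2 hsub
  rw [hcardT] at hmod
  have hdvd := (Nat.modEq_iff_dvd' (by omega)).1 hmod.symm
  have hle := Nat.le_of_dvd (by omega) hdvd
  omega

theorem exists_fixed_sylow [Finite P] (h : IsMoebiusLike p P X) (S : Sylow p P)
    (hS : (S : Subgroup P) ≠ ⊥) :
    ∃ x : X, ∀ g ∈ Subgroup.normalizer ((S : Subgroup P) : Set P), g • x = x := by
  have hnt : Nontrivial S := (Subgroup.nontrivial_iff_ne_bot _).2 hS
  have := S.2.center_nontrivial
  obtain ⟨z, hz⟩ := exists_ne (1 : Subgroup.center S)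
  have hz1 : (z : S) ≠ 1 := by simpa using hz
  obtain ⟨n, hn⟩ := S.2 (z : S)
  have hzP : ((z : S) : P) ≠ 1 := by simpa using hz1
  obtain ⟨x, hx, hux⟩ := h.existsUnique_fixed ((z : S) : P) n hzP
    (by simpa [Subtype.ext_iff] using hn)
  have hSx : ∀ s ∈ (S : Subgroup P), s • x = x := by
    intro s hs
    apply hux
    have hcomm := congrArg Subtype.val (Subgroup.mem_center_iff.1 z.2 ⟨s, hs⟩)
    change s * ((z : S) : P) = ((z : S) : P) * s at hcomm
    change ((z : S) : P) • s • x = s • x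
    rw [← mul_smul, ← hcomm, mul_smul, hx]
  refine ⟨x, fun g hg => hux _ ?_⟩
  have := hSx _ (((Subgroup.mem_normalizer_iff.1 (inv_mem hg)) ((z : S) : P)).1 (z : S).2)
  change ((z : S) : P) • g • x = g • x
  rw [inv_inv, mul_smul, mul_smul, inv_smul_eq_iff] at this
  exact this

theorem normalizer_le_centralizer [Finite P] (h : IsMoebiusLike p P X) (hp3 : 3 ≤ p)
    (N : Subgroup P) [N.Normal] {m : ℕ} (hN : N.index = p ^ m) (hN1 : N ≠ ⊤) (S : Sylow p P)
    (hS : (S : Subgroup P) ≠ ⊥) :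
    Subgroup.normalizer ((S : Subgroup P) : Set P) ≤ Subgroup.centralizer (S : Set P) := by
  have hp : p.Prime := Fact.out
  have hm : m ≠ 0 := by
    rintro rfl
    exact hN1 (Subgroup.index_eq_one.1 (by simpa using hN))
  obtain ⟨x, hx⟩ := h.exists_fixed_sylow S hS
  have hSpow : ∀ s ∈ (S : Subgroup P), ∃ k, s ^ p ^ k = 1 := fun s hs => by
    obtain ⟨k, hk⟩ := S.2 ⟨s, hs⟩
    exact ⟨k, by simpa [Subtype.ext_iff] using hk⟩
  have hcop : ∀ c ∈ Subgroup.normalizer ((S : Subgroup P) : Set P), ∀ n : ℕ, n.Coprime p →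
      c ^ n = 1 → c = 1 := by
    intro c hc n hn hcn
    by_contra hc1
    have hcN : c ∈ N := mem_of_coprime_index N (hN ▸ hn.pow_right m) hcn
    let f : S → S := fun s =>
      ⟨c * s * c⁻¹ * (s : P)⁻¹, mul_mem ((Subgroup.mem_normalizer_iff.1 hc s).1 s.2)
        (inv_mem s.2)⟩
    have hf : Function.Injective f := by
      intro s t hst
      have hst' : c * s * c⁻¹ * (s : P)⁻¹ = c * t * c⁻¹ * (t : P)⁻¹ := congrArg Subtype.val hst
      obtain ⟨k, hk⟩ := hSpow ((t : P)⁻¹ * s) (mul_mem (inv_mem t.2) s.2)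
      have hcomm : Commute c ((t : P)⁻¹ * s) := by
        have h1 : (s : P) * c⁻¹ * (s : P)⁻¹ = t * c⁻¹ * (t : P)⁻¹ := by
          simpa [mul_assoc] using hst'
        have h2 : ((t : P)⁻¹ * s) * c⁻¹ = c⁻¹ * ((t : P)⁻¹ * s) := by
          rw [mul_inv_eq_iff_eq_mul] at h1
          rw [mul_assoc, h1]
          group
        exact (Commute.inv_right_iff.1 h2).symm
      have := h.eq_one_of_commute hp3 hc1 hn hcn hk hcomm
      exact Subtype.ext (inv_mul_eq_one.1 this).symm
    have hsurj := Finite.surjective_of_injective hf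
    have hSN : (S : Subgroup P) ≤ N := by
      intro s hs
      obtain ⟨t, ht⟩ := hsurj ⟨s, hs⟩
      have hts : c * t * c⁻¹ * (t : P)⁻¹ = s := congrArg Subtype.val ht
      rw [← hts, mul_assoc, mul_assoc, ← mul_assoc (t : P)]
      exact mul_mem hcN (Subgroup.Normal.conj_mem ‹_› _ (inv_mem hcN) _)
    refine S.not_dvd_index ((dvd_pow_self p hm).trans ?_)
    rw [← hN]
    exact Subgroup.index_dvd_of_le hSN
  intro g hg s hs
  obtain ⟨a, b, hb, hab⟩ := Nat.exists_eq_pow_mul_and_not_dvd (orderOf_pos g).ne' p hp.ne_one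
  have hgp : g ^ p ^ a = 1 := by
    refine hcop _ (pow_mem hg _) b ((Nat.Prime.coprime_iff_not_dvd hp).2 hb).symm ?_
    rw [← pow_mul, ← hab, pow_orderOf_eq_one]
  obtain ⟨k, hk⟩ := hSpow s hs
  exact h.commute s g k a x hk hgp (hx s (Subgroup.le_normalizer hs)) (hx g hg)

/-- A proper normal subgroup of `p`-power index forces `p = 3` and the structure of `A₄`. -/
theorem structure_of_normal_index_pow [Finite P] (h : IsMoebiusLike p P X) (hp3 : 3 ≤ p)
    (hfix : ∀ x : X, ∃ g : P, g • x ≠ x) (N : Subgroup P) [N.Normal] {m : ℕ}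
    (hN : N.index = p ^ m) (hN1 : N ≠ ⊤) :
    p = 3 ∧ Nat.card P = 12 ∧ (∃ S : Subgroup P, Nat.card S = 3 ∧ ¬ S.Normal) ∧
      Nat.card N = 4 ∧ ∀ g ∈ N, g ^ 2 = 1 := by
  have hp : p.Prime := Fact.out
  have hm : m ≠ 0 := by
    rintro rfl
    exact hN1 (Subgroup.index_eq_one.1 (by simpa using hN))
  have hpP : p ∣ Nat.card P := (dvd_pow_self p hm).trans (hN ▸ N.index_dvd_card)
  let S : Sylow p P := default
  have hS : (S : Subgroup P) ≠ ⊥ := by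
    intro hbot
    have := S.not_dvd_index
    rw [hbot, Subgroup.index_bot] at this
    exact this hpP
  obtain ⟨x, hx⟩ := h.exists_fixed_sylow S hS
  have hSn : ¬ (S : Subgroup P).Normal := by
    intro hn
    obtain ⟨g, hg⟩ := hfix x
    refine hg (hx g ?_)
    rw [Subgroup.normalizer_eq_top_iff.2 hn]
    trivial
  have hNC := h.normalizer_le_centralizer hp3 N hN hN1 S hS
  set K := (MonoidHom.transferSylow S hNC).ker with hKdef
  have hcompl : K.IsComplement' S := MonoidHom.ker_transferSylow_isComplement' S hNC
  have hKp : ¬ p ∣ Nat.card K := MonoidHom.not_dvd_card_ker_transferSylow S hNC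
  have hK1 : K ≠ ⊥ := by
    intro hbot
    rw [hbot, Subgroup.isComplement'_bot_left] at hcompl
    exact hSn (hcompl ▸ inferInstance)
  have hcop : (Nat.card K).Coprime p := ((Nat.Prime.coprime_iff_not_dvd hp).2 hKp).symm
  have hKpow : ∀ k ∈ K, k ^ Nat.card K = 1 := fun k hk => by
    exact congrArg Subtype.val (pow_card_eq_one' (x := (⟨k, hk⟩ : K)))
  have hKN : K ≤ N := fun k hk => mem_of_coprime_index N (hN ▸ hcop.pow_right m) (hKpow k hk)
  have h2 : ∀ k ∈ K, k ≠ 1 → Nat.card (fixedBy X k) = 2 := fun k hk hk1 =>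
    h.card_fixedBy k _ hk1 hcop (hKpow k hk)
  let E : SubMulAction P X := ⟨{x | ∃ k ∈ K, k ≠ 1 ∧ k • x = x}, by
    rintro g x ⟨k, hk, hk1, hkx⟩
    refine ⟨g * k * g⁻¹, Subgroup.Normal.conj_mem inferInstance _ hk g, by simpa using hk1, ?_⟩
    simp [mul_smul, hkx]⟩
  have hEfin : Finite E := by
    have : (E : Set X) ⊆ ⋃ k : {k : P // k ∈ K ∧ k ≠ 1}, fixedBy X (k : P) := by
      rintro x ⟨k, hk, hk1, hkx⟩
      exact Set.mem_iUnion.2 ⟨⟨k, hk, hk1⟩, hkx⟩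
    refine Set.finite_coe_iff.2 (Set.Finite.subset (Set.finite_iUnion fun k => ?_) this)
    have := h2 k k.2.1 k.2.2
    exact Set.finite_coe_iff.1 (Nat.finite_of_card_ne_zero (by omega))
  obtain ⟨hp', hScard, hKcard, hKsq⟩ := card_eq_of_fixedBy_card_eq_two (E := E) hp3 K hKp hK1 S.2 hS
    (by
      intro s hs hs1 y z hy hz
      obtain ⟨n, hn⟩ := S.2 ⟨s, hs⟩
      obtain ⟨w, -, hw⟩ := h.existsUnique_fixed s n hs1 (by simpa [Subtype.ext_iff] using hn)
      exact Subtype.ext ((hw _ (congrArg Subtype.val hy)).trans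
        (hw _ (congrArg Subtype.val hz)).symm))
    (by
      intro k hk hk1
      rw [← h2 k hk hk1]
      refine Nat.card_congr ⟨fun y => ⟨y.1, congrArg Subtype.val y.2⟩,
        fun y => ⟨⟨y.1, k, hk, hk1, y.2⟩, Subtype.ext y.2⟩, fun _ => rfl, fun _ => rfl⟩)
    (by
      rintro ⟨y, k, hk, hk1, hky⟩
      exact ⟨k, hk, hk1, Subtype.ext hky⟩)
  have hPcard : Nat.card P = 12 := by
    have := hcompl.card_mul_card
    rw [hKcard, hScard] at this
    exact this.symm
  have hNK : N = K := by
    refine (Subgroup.eq_of_le_of_card_ge hKN ?_).symm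
    have h1 := N.card_mul_index
    rw [hN, hp', hPcard] at h1
    have h3 : 3 ∣ 3 ^ m := dvd_pow_self 3 hm
    have h4 := Nat.le_of_dvd (by positivity) h3
    rw [hKcard]
    nlinarith
  refine ⟨hp', hPcard, ⟨S, hScard, hSn⟩, hNK ▸ hKcard, hNK ▸ hKsq⟩

end IsMoebiusLike

/-- A group of order `12` with a non-normal subgroup of order `3` is isomorphic to `A₄`. -/
theorem nonempty_mulEquiv_alternatingGroup {Q : Type*} [Group Q] (hQ : Nat.card Q = 12)
    (S : Subgroup Q) (hS : Nat.card S = 3) (hSn : ¬ S.Normal) :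
    Nonempty (Q ≃* alternatingGroup (Fin 4)) := by
  have : Finite Q := Nat.finite_of_card_ne_zero (by omega)
  have hidx : Nat.card (Q ⧸ S) = 4 := by
    have := S.card_mul_index
    rw [hS, hQ] at this
    change S.index = 4
    omega
  have hcore : S.normalCore = ⊥ := by
    have h1 := Subgroup.card_dvd_of_le S.normalCore_le
    rw [hS, Nat.dvd_prime Nat.prime_three] at h1
    rcases h1 with h1 | h1
    · exact Subgroup.card_eq_one.1 h1
    · refine absurd ?_ hSn
      rw [← Subgroup.eq_of_le_of_card_ge S.normalCore_le (by omega)]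
      infer_instance
  have e : (Q ⧸ S) ≃ Fin 4 := (Finite.equivFin _).trans (finCongr hidx)
  let f : Q →* Equiv.Perm (Fin 4) := e.permCongrHom.toMonoidHom.comp (toPermHom Q (Q ⧸ S))
  have hf : Function.Injective f := by
    refine e.permCongrHom.injective.comp ?_
    rw [← MonoidHom.ker_eq_bot_iff, ← Subgroup.normalCore_eq_ker, hcore]
  have hrange : f.range = alternatingGroup (Fin 4) := by
    apply Equiv.Perm.eq_alternatingGroup_of_index_eq_two
    have h1 := f.range.card_mul_index
    rw [← Nat.card_congr (MonoidHom.ofInjective hf).toEquiv, hQ, Nat.card_perm,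
      Nat.card_eq_fintype_card, Fintype.card_fin] at h1
    have : Nat.factorial 4 = 24 := rfl
    omega
  exact ⟨(MonoidHom.ofInjective hf).trans (MulEquiv.subgroupCongr hrange)⟩

/-- `PSL₂(𝔽₃)` is isomorphic to `A₄`. -/
theorem nonempty_PSL2F3_mulEquiv : Nonempty (PSL2F3 ≃* alternatingGroup (Fin 4)) := by
  have hSL : Nat.card (Matrix.SpecialLinearGroup (Fin 2) (ZMod 3)) = 24 := by
    rw [Nat.card_eq_fintype_card]
    decide +kernel
  have hZ : Nat.card (Subgroup.center (Matrix.SpecialLinearGroup (Fin 2) (ZMod 3))) = 2 := by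
    rw [Nat.card_congr (Matrix.SpecialLinearGroup.center_equiv_rootsOfUnity' 0).toEquiv]
    exact (IsPrimitiveRoot.neg_one 3 (by decide)).card_rootsOfUnity
  have hcard : Nat.card PSL2F3 = 12 := by
    have := Subgroup.card_eq_card_quotient_mul_card_subgroup
      (Subgroup.center (Matrix.SpecialLinearGroup (Fin 2) (ZMod 3)))
    rw [hSL, hZ] at this
    change 24 = Nat.card PSL2F3 * 2 at this
    omega
  let u : Matrix.SpecialLinearGroup (Fin 2) (ZMod 3) := ⟨!![1, 1; 0, 1], by decide⟩
  let w : Matrix.SpecialLinearGroup (Fin 2) (ZMod 3) := ⟨!![0, 1; -1, 0], by decide⟩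
  have hmem : ∀ A : Matrix.SpecialLinearGroup (Fin 2) (ZMod 3), (A : PSL2F3) = 1 →
      A.1 0 1 = 0 ∧ A.1 1 0 = 0 := by
    intro A h
    obtain ⟨r, -, hr⟩ := Matrix.SpecialLinearGroup.mem_center_iff.1
      ((QuotientGroup.eq_one_iff A).1 h)
    rw [← hr]
    simp
  have hu3 : (u : PSL2F3) ^ 3 = 1 := by
    rw [← QuotientGroup.mk_pow, show u ^ 3 = 1 by decide +kernel, QuotientGroup.mk_one]
  have hu1 : (u : PSL2F3) ≠ 1 := fun h => absurd (hmem u h).1 (by decide)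
  have horder : orderOf (u : PSL2F3) = 3 := orderOf_eq_prime hu3 hu1
  refine nonempty_mulEquiv_alternatingGroup hcard (Subgroup.zpowers (u : PSL2F3))
    (by rw [Nat.card_zpowers, horder]) fun hn => ?_
  have hconj := hn.conj_mem _ (Subgroup.mem_zpowers (u : PSL2F3)) (w : PSL2F3)
  have : Finite PSL2F3 := Nat.finite_of_card_ne_zero (by omega)
  rw [← mem_powers_iff_mem_zpowers, mem_powers_iff_mem_range_orderOf, horder,
    Finset.mem_image] at hconj
  obtain ⟨i, hi, h⟩ := hconj
  have h' := (hmem ((u ^ i)⁻¹ * (w * u * w⁻¹)) (by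
    rw [QuotientGroup.mk_mul, QuotientGroup.mk_inv, QuotientGroup.mk_pow, h]
    exact inv_mul_cancel _)).2
  have hlow : ∀ i ∈ Finset.range 3, ((u ^ i)⁻¹ * (w * u * w⁻¹)).1 1 0 ≠ 0 := by decide +kernel
  exact hlow i hi h'

section ProjectiveLine

open Matrix OnePoint

variable {k : Type} [Field k]

theorem smul_coe_eq_self_iff [DecidableEq k] (g : GL (Fin 2) k) (c : k) :
    g • (c : OnePoint k) = c ↔ g 1 0 * c ^ 2 + (g 1 1 - g 0 0) * c - g 0 1 = 0 := by
  simp [← GeneralLinearGroup.fixpointPolynomial_aeval_eq_zero_iff,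
    GeneralLinearGroup.fixpointPolynomial]

theorem center_smul [DecidableEq k] {z : GL (Fin 2) k} (hz : z ∈ Subgroup.center (GL (Fin 2) k))
    (x : OnePoint k) : z • x = x := by
  obtain ⟨a, ha⟩ := GeneralLinearGroup.mem_center_iff_val_mem_range_scalar.1 hz
  cases x with
  | infty => rw [smul_infty_eq_self_iff, ← ha]; simp
  | coe c => rw [smul_coe_eq_self_iff, ← ha]; simp

theorem card_fixedBy_of_discr_ne_zero [DecidableEq k] [IsAlgClosed k] [NeZero (2 : k)]
    {g : GL (Fin 2) k} (hg : g.val.discr ≠ 0) : Nat.card (fixedBy (OnePoint k) g) = 2 := by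
  rw [discr_fin_two, trace_fin_two, det_fin_two] at hg
  rw [Nat.card_coe_set_eq, Set.ncard_eq_two]
  by_cases hc : g 1 0 = 0
  · have hd : g 1 1 - g 0 0 ≠ 0 := by
      intro h
      apply hg
      rw [hc, sub_eq_zero.1 h]
      ring
    refine ⟨∞, ((g 0 1 / (g 1 1 - g 0 0) : k) : OnePoint k), by simp, ?_⟩
    ext x
    cases x with
    | infty => simp [smul_infty_eq_self_iff, hc]
    | coe c =>
      rw [mem_fixedBy, smul_coe_eq_self_iff, hc]
      simp only [Set.mem_insert_iff, Set.mem_singleton_iff, coe_ne_infty, coe_eq_coe, false_or]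
      rw [eq_div_iff hd]
      grind
  · obtain ⟨s, hs⟩ := IsAlgClosed.exists_pow_nat_eq (discrim (g 1 0) (g 1 1 - g 0 0) (-g 0 1))
      (n := 2) (by norm_num)
    have hs0 : s ≠ 0 := by
      rintro rfl
      rw [discrim] at hs
      apply hg
      linear_combination -hs
    have h2 : (2 : k) ≠ 0 := NeZero.ne _
    refine ⟨(((-(g 1 1 - g 0 0) + s) / (2 * g 1 0) : k) : OnePoint k),
      (((-(g 1 1 - g 0 0) - s) / (2 * g 1 0) : k) : OnePoint k), ?_, ?_⟩
    · rw [Ne, coe_eq_coe, div_left_inj' (mul_ne_zero h2 hc)]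
      intro h
      have : 2 * s = 0 := by linear_combination h
      simp [h2, hs0] at this
    · ext x
      cases x with
      | infty => simp [smul_infty_eq_self_iff, hc]
      | coe c =>
        rw [mem_fixedBy, smul_coe_eq_self_iff]
        simp only [Set.mem_insert_iff, Set.mem_singleton_iff, coe_eq_coe]
        rw [← quadratic_eq_zero_iff hc (by rw [← hs]; ring) c]
        constructor <;> intro h <;> linear_combination h

theorem discr_eq_zero_of_pow_mem_center [IsAlgClosed k] {p : ℕ} [Fact p.Prime] [CharP k p]
    {g : GL (Fin 2) k} {n : ℕ} (hg : g ^ p ^ n ∈ Subgroup.center (GL (Fin 2) k)) :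
    g.val.discr = 0 := by
  obtain ⟨a, ha⟩ := GeneralLinearGroup.mem_center_iff_val_mem_range_scalar.1 hg
  have hp : p.Prime := Fact.out
  obtain ⟨b, rfl⟩ := IsAlgClosed.exists_pow_nat_eq a (n := p ^ n) (pow_pos hp.pos n)
  have hcomm : Commute g.val (scalar (Fin 2) b) := (scalar_commute b (Commute.all b) _).symm
  have hnil : (g.val - scalar (Fin 2) b) ^ p ^ n = 0 := by
    rw [sub_pow_char_pow_of_commute p n hcomm, ← map_pow, ha, Units.val_pow_eq_pow_val,
      sub_self]
  have htr := (isNilpotent_trace_of_isNilpotent ⟨_, hnil⟩).eq_zero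
  have hdet : (g.val - scalar (Fin 2) b).det = 0 := by
    have := congrArg Matrix.det hnil
    rw [det_pow, det_zero] at this
    exact pow_eq_zero_iff (pow_pos hp.pos n).ne' |>.1 this
  rw [trace_fin_two] at htr
  rw [det_fin_two] at hdet
  rw [discr_fin_two, trace_fin_two, det_fin_two]
  simp at htr hdet
  linear_combination (g 0 0 + g 1 1 - 2 * b) * htr - 4 * hdet

theorem discr_ne_zero_of_pow_mem_center [NeZero (2 : k)] {p : ℕ} [Fact p.Prime] [CharP k p]
    {g : GL (Fin 2) k} {n : ℕ} (hn : n.Coprime p) (hg1 : g ∉ Subgroup.center (GL (Fin 2) k))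
    (hg : g ^ n ∈ Subgroup.center (GL (Fin 2) k)) : g.val.discr ≠ 0 := by
  intro h
  rw [GeneralLinearGroup.mem_center_iff_val_mem_range_scalar] at hg hg1
  have hpar : g.val.IsParabolic := ⟨hg1, h⟩
  have ha := GeneralLinearGroup.parabolicEigenvalue_ne_zero hpar
  have hN2 := hpar.sub_eigenvalue_sq_eq_zero
  set a := g.val.parabolicEigenvalue
  set N := g.val - scalar (Fin 2) a with hN
  have hgN : g.val = N + scalar (Fin 2) a := by rw [hN, sub_add_cancel]
  obtain ⟨b, hb⟩ := hg
  have hcomm : Commute (scalar (Fin 2) a) N := scalar_commute a (Commute.all a) _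
  have hs (c : k) : scalar (Fin 2) c * N = c • N := by
    rw [scalar_apply, ← smul_eq_diagonal_mul]
  have hpow : ∀ n : ℕ, a • (g.val ^ n) = scalar (Fin 2) (a ^ (n + 1)) + (n * a ^ n) • N := by
    intro n
    induction n with
    | zero => ext i j; simp [scalar_apply, Matrix.diagonal, Matrix.one_apply]
    | succ n ih =>
      have hNN : N * N = 0 := by rw [← sq, hN2]
      rw [pow_succ, ← Matrix.smul_mul, ih, hgN, add_mul, mul_add, mul_add, ← map_mul,
        Matrix.smul_mul, hNN, Matrix.smul_mul, ← hcomm.eq, hs, hs]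
      ext i j
      fin_cases i <;> fin_cases j <;> simp <;> ring
  have hn0 : (n : k) ≠ 0 := by
    rw [Ne, CharP.cast_eq_zero_iff k p]
    intro hdvd
    exact (Fact.out : p.Prime).one_lt.ne' (Nat.eq_one_of_dvd_coprimes hn hdvd dvd_rfl)
  have hna : (n * a ^ n : k) ≠ 0 := mul_ne_zero hn0 (pow_ne_zero _ ha)
  have hNs : N = scalar (Fin 2) ((n * a ^ n : k)⁻¹ * (a * b - a ^ (n + 1))) := by
    have h1 := hpow n
    rw [← Units.val_pow_eq_pow_val, ← hb] at h1
    have h2 : N = (n * a ^ n : k)⁻¹ • (a • scalar (Fin 2) b - scalar (Fin 2) (a ^ (n + 1))) := by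
      rw [h1, add_sub_cancel_left, smul_smul, inv_mul_cancel₀ hna, one_smul]
    rw [h2]
    ext i j
    fin_cases i <;> fin_cases j <;> simp
  exact hg1 ⟨_, by rw [hgN, hNs, ← map_add]⟩

theorem commute_of_discr_eq_zero [DecidableEq k] [NeZero (2 : k)] {g h : GL (Fin 2) k}
    (hg : g.val.discr = 0) (hh : h.val.discr = 0) {x : OnePoint k} (hgx : g • x = x) (hhx : h • x = x) :
    Commute g h := by
  have h2 : (2 : k) ≠ 0 := NeZero.ne _
  rw [discr_fin_two, trace_fin_two, det_fin_two] at hg hh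
  have key : ∀ i j, (g.val * h.val) i j = (h.val * g.val) i j := by
    cases x with
    | infty =>
      rw [smul_infty_eq_self_iff] at hgx hhx
      have h1 : g 0 0 = g 1 1 := by
        have : (g 0 0 - g 1 1) ^ 2 = 0 := by rw [hgx] at hg; linear_combination hg
        exact sub_eq_zero.1 (pow_eq_zero_iff two_ne_zero |>.1 this)
      have h2 : h 0 0 = h 1 1 := by
        have : (h 0 0 - h 1 1) ^ 2 = 0 := by rw [hhx] at hh; linear_combination hh
        exact sub_eq_zero.1 (pow_eq_zero_iff two_ne_zero |>.1 this)
      intro i j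
      fin_cases i <;> fin_cases j <;> simp [mul_apply, hgx, hhx, h1, h2] <;> ring
    | coe c =>
      rw [smul_coe_eq_self_iff] at hgx hhx
      have aux : ∀ g : GL (Fin 2) k, (g 0 0 + g 1 1) ^ 2 - 4 * (g 0 0 * g 1 1 - g 0 1 * g 1 0) = 0 →
          g 1 0 * c ^ 2 + (g 1 1 - g 0 0) * c - g 0 1 = 0 →
          g 0 0 = g 1 1 + 2 * c * g 1 0 ∧ g 0 1 = - g 1 0 * c ^ 2 := by
        intro g hg hgx
        have : (2 * c * g 1 0 + (g 1 1 - g 0 0)) ^ 2 = 0 := by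
          linear_combination hg + 4 * g 1 0 * hgx
        have := pow_eq_zero_iff two_ne_zero |>.1 this
        constructor
        · linear_combination -this
        · linear_combination -hgx + c * this
      obtain ⟨h1, h2⟩ := aux g hg hgx
      obtain ⟨h3, h4⟩ := aux h hh hhx
      intro i j
      fin_cases i <;> fin_cases j <;> simp [mul_apply, h1, h2, h3, h4] <;> ring
  exact Units.ext (Matrix.ext key)

/-- The action of `PGL₂(k)` on the projective line by Möbius transformations. -/
@[reducible]
noncomputable def pglAction [DecidableEq k] : MulAction (PGL2 k) (OnePoint k) :=
  MulAction.compHom (OnePoint k) (QuotientGroup.lift (Subgroup.center (GL (Fin 2) k))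
    (MulAction.toPermHom (GL (Fin 2) k) (OnePoint k)) fun _ hz => Equiv.ext (center_smul hz))

attribute [local instance] pglAction

theorem isMoebiusLike_subgroup [DecidableEq k] [IsAlgClosed k] {p : ℕ} [Fact p.Prime]
    [CharP k p] (hp : 3 ≤ p) (P : Subgroup (PGL2 k)) : IsMoebiusLike p P (OnePoint k) := by
  have : NeZero (2 : k) := ⟨by
    rw [← Nat.cast_two, Ne, CharP.cast_eq_zero_iff k p]
    exact fun h => absurd (Nat.le_of_dvd two_pos h) (by omega)⟩
  constructor
  · rintro ⟨g, hg⟩ n hg1 hgn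
    induction g using QuotientGroup.induction_on with | _ g
    replace hg1 : g ∉ Subgroup.center (GL (Fin 2) k) := fun h =>
      hg1 (Subtype.ext ((QuotientGroup.eq_one_iff g).2 h))
    replace hgn : g ^ p ^ n ∈ Subgroup.center (GL (Fin 2) k) :=
      (QuotientGroup.eq_one_iff _).1 (congrArg Subtype.val hgn)
    have hpar : g.IsParabolic :=
      ⟨fun h => hg1 (GeneralLinearGroup.mem_center_iff_val_mem_range_scalar.2 h),
        discr_eq_zero_of_pow_mem_center hgn⟩
    exact ⟨g.parabolicFixedPoint, hpar.smul_eq_self_iff.2 rfl,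
      fun y hy => hpar.smul_eq_self_iff.1 hy⟩
  · rintro ⟨g, hg⟩ n hg1 hn hgn
    induction g using QuotientGroup.induction_on with | _ g
    exact card_fixedBy_of_discr_ne_zero (discr_ne_zero_of_pow_mem_center hn
      (fun h => hg1 (Subtype.ext ((QuotientGroup.eq_one_iff g).2 h)))
      ((QuotientGroup.eq_one_iff _).1 (congrArg Subtype.val hgn)))
  · rintro ⟨g, hg⟩ ⟨h, hh⟩ m n x hgm hhn hgx hhx
    induction g using QuotientGroup.induction_on with | _ g
    induction h using QuotientGroup.induction_on with | _ h
    have hcomm : Commute g h := commute_of_discr_eq_zero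
      (discr_eq_zero_of_pow_mem_center
        ((QuotientGroup.eq_one_iff _).1 (congrArg Subtype.val hgm)))
      (discr_eq_zero_of_pow_mem_center
        ((QuotientGroup.eq_one_iff _).1 (congrArg Subtype.val hhn))) hgx hhx
    exact Subtype.ext (congrArg (QuotientGroup.mk (s := Subgroup.center (GL (Fin 2) k))) hcomm.eq)

theorem exists_smul_ne_of_matIrred [DecidableEq k] {G : Type} [Group G] {ρ : G →* GL (Fin 2) k}
    (hirr : MatIrred ρ) (x : OnePoint k) : ∃ g : G, ρ g • x ≠ x := by
  by_contra! hfix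
  have key : ∀ v : Fin 2 → k, v ≠ 0 → ¬ ∀ g, ∃ a : k, (ρ g).val.mulVec v = a • v := by
    intro v hv hstab
    rcases hirr (k ∙ v) (fun g x hx => by
      obtain ⟨b, rfl⟩ := Submodule.mem_span_singleton.1 hx
      obtain ⟨a, ha⟩ := hstab g
      rw [Matrix.mulVec_smul, ha]
      exact Submodule.smul_mem _ _ (Submodule.smul_mem _ _ (Submodule.mem_span_singleton_self v)))
      with h | h
    · exact hv (Submodule.span_singleton_eq_bot.1 h)
    · have h1 := finrank_span_singleton (K := k) hv
      rw [h, finrank_top] at h1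
      simp at h1
  cases x with
  | infty =>
    refine key ![1, 0] (by simp) fun g => ⟨(ρ g) 0 0, ?_⟩
    have := smul_infty_eq_self_iff.1 (hfix g)
    ext i
    fin_cases i <;> simp [this]
  | coe c =>
    refine key ![c, 1] (by simp) fun g => ⟨(ρ g) 1 0 * c + (ρ g) 1 1, ?_⟩
    have := (smul_coe_eq_self_iff _ _).1 (hfix g)
    ext i
    fin_cases i
    · simp
      linear_combination -this
    · simp

end ProjectiveLine

theorem isKleinFour_of_sq_eq_one {V : Type*} [Group V] (hV : Nat.card V = 4)
    (hsq : ∀ g : V, g ^ 2 = 1) : IsKleinFour V := by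
  refine ⟨hV, ((Nat.dvd_prime Nat.prime_two).1
    (Monoid.exponent_dvd_of_forall_pow_eq_one hsq)).resolve_left fun h => ?_⟩
  have := Monoid.exp_eq_one_iff.1 h
  rw [Nat.card_of_subsingleton (1 : V)] at hV
  omega

instance : IsKleinFour (Multiplicative (ZMod 2) × Multiplicative (ZMod 2)) :=
  isKleinFour_of_sq_eq_one (by rw [Nat.card_eq_fintype_card]; decide) (by decide)

/-- Let `ℓ ≥ 3` be a prime, `k` an algebraically closed field of
characteristic `ℓ`, `G` a finite group, `ρ : G → GL₂(k)` irreducible, and `H` a normal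
subgroup of `G` of `ℓ`-power index.  Then the projective image of `ρ|_H` equals the
projective image of `ρ`, except possibly if `ℓ = 3`, the projective image of `ρ` is
isomorphic to `PSL₂(𝔽₃)` and the projective image of `ρ|_H` is isomorphic to
`ℤ/2 × ℤ/2`. -/
theorem projective_image_of_restriction
    (ℓ : ℕ) (hℓ : ℓ.Prime) (hℓ3 : 3 ≤ ℓ)
    (k : Type) [Field k] [IsAlgClosed k] [CharP k ℓ]
    (G : Type) [Group G] [Finite G]
    (ρ : G →* Matrix.GeneralLinearGroup (Fin 2) k) (hirr : MatIrred ρ)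
    (H : Subgroup G) (hH : H.Normal) (m : ℕ) (hidx : H.index = ℓ ^ m) :
    projImage (ρ.comp H.subtype) = projImage ρ ∨
      (ℓ = 3 ∧ Nonempty (↥(projImage ρ) ≃* PSL2F3) ∧
        Nonempty (↥(projImage (ρ.comp H.subtype)) ≃*
          (Multiplicative (ZMod 2) × Multiplicative (ZMod 2)))) := by
  classical
  have : Fact ℓ.Prime := ⟨hℓ⟩
  let _ := pglAction (k := k)
  set φ := (QuotientGroup.mk' (Subgroup.center (Matrix.GeneralLinearGroup (Fin 2) k))).comp ρ
  have hQ : projImage (ρ.comp H.subtype) = H.map φ := by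
    change (φ.comp H.subtype).range = _
    rw [MonoidHom.range_comp, Subgroup.range_subtype]
  let N : Subgroup (projImage ρ) := H.map φ.rangeRestrict
  have hNmap : N.map (projImage ρ).subtype = projImage (ρ.comp H.subtype) := by
    rw [hQ]
    exact (Subgroup.map_map _ _ _).trans rfl
  have : N.Normal := hH.map _ φ.rangeRestrict_surjective
  have : Finite (projImage ρ) := Finite.of_surjective _ φ.rangeRestrict_surjective
  obtain ⟨j, -, hj⟩ := (Nat.dvd_prime_pow hℓ).1
    (hidx ▸ Subgroup.index_map_dvd H φ.rangeRestrict_surjective : N.index ∣ ℓ ^ m)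
  by_cases hN1 : N = ⊤
  · left
    rw [← hNmap, hN1, ← MonoidHom.range_eq_map, Subgroup.range_subtype]
  right
  obtain ⟨hℓ', hcard, ⟨S, hS, hSn⟩, hNcard, hNsq⟩ :=
    (isMoebiusLike_subgroup hℓ3 (projImage ρ)).structure_of_normal_index_pow hℓ3 (fun x => by
      obtain ⟨g, hg⟩ := exists_smul_ne_of_matIrred hirr x
      exact ⟨φ.rangeRestrict g, hg⟩) N hj hN1
  refine ⟨hℓ', ?_, ?_⟩
  · obtain ⟨e⟩ := nonempty_mulEquiv_alternatingGroup hcard S hS hSn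
    obtain ⟨e'⟩ := nonempty_PSL2F3_mulEquiv
    exact ⟨e.trans e'.symm⟩
  · have : IsKleinFour N :=
      isKleinFour_of_sq_eq_one hNcard fun g => Subtype.ext (hNsq g g.2)
    obtain ⟨e⟩ := IsKleinFour.nonempty_mulEquiv (G₁ := N)
      (G₂ := Multiplicative (ZMod 2) × Multiplicative (ZMod 2))
    have e' : N ≃* projImage (ρ.comp H.subtype) :=
      (N.equivMapOfInjective _ (projImage ρ).subtype_injective).trans
        (MulEquiv.subgroupCongr hNmap)
    exact ⟨e'.symm.trans e⟩
end

section
/- Let ℓ be an odd prime, n ≥ 1, and q = ℓⁿ with q ≠ 5. Let V be the 𝔽_q-vector space of trace-zero 2×2 matrices over 𝔽_q, regarded as a representation of SL₂(𝔽_q) by conjugation (g·A = g A g⁻¹). Then the first group cohomology H¹(SL₂(𝔽_q), V) vanishes. -/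
namespace SL2Conj

open Matrix

open scoped MatrixGroups

variable {F : Type*} [Field F]

/-- The upper unipotent element with off-diagonal entry `x`. -/
def upper (x : F) : SL(2, F) := ⟨!![1, x; 0, 1], by simp [det_fin_two]⟩

/-- The lower unipotent element with off-diagonal entry `x`. -/
def lower (x : F) : SL(2, F) := ⟨!![1, 0; x, 1], by simp [det_fin_two]⟩

/-- The diagonal torus of `SL₂`. -/
def torus : Fˣ →* SL(2, F) where
  toFun a := ⟨!![(a : F), 0; 0, (a : F)⁻¹], by simp [det_fin_two]⟩
  map_one' := by ext i j; fin_cases i <;> fin_cases j <;> simp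
  map_mul' a b := Subtype.ext <| by
    change _ = !![(a : F), 0; 0, (a : F)⁻¹] * !![(b : F), 0; 0, (b : F)⁻¹]
    simp [mul_comm]

theorem coe_upper (x : F) : (upper x : Matrix (Fin 2) (Fin 2) F) = !![1, x; 0, 1] := rfl

theorem coe_lower (x : F) : (lower x : Matrix (Fin 2) (Fin 2) F) = !![1, 0; x, 1] := rfl

theorem coe_torus (a : Fˣ) :
    (torus a : Matrix (Fin 2) (Fin 2) F) = !![(a : F), 0; 0, (a : F)⁻¹] := rfl

/-- The conjugation action of `SL₂` on `2 × 2` matrices. -/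
def conj (g : SL(2, F)) (A : Matrix (Fin 2) (Fin 2) F) : Matrix (Fin 2) (Fin 2) F :=
  (g : Matrix (Fin 2) (Fin 2) F) * A * ((g⁻¹ : SL(2, F)) : Matrix (Fin 2) (Fin 2) F)

theorem conj_add (g : SL(2, F)) (A B : Matrix (Fin 2) (Fin 2) F) :
    conj g (A + B) = conj g A + conj g B := by
  simp [conj, mul_add, add_mul]

theorem conj_sub (g : SL(2, F)) (A B : Matrix (Fin 2) (Fin 2) F) :
    conj g (A - B) = conj g A - conj g B := by
  simp [conj, mul_sub, sub_mul]

theorem conj_zero (g : SL(2, F)) : conj g 0 = 0 := by simp [conj]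

theorem conj_sum {ι : Type*} (s : Finset ι) (g : SL(2, F)) (f : ι → Matrix (Fin 2) (Fin 2) F) :
    conj g (∑ i ∈ s, f i) = ∑ i ∈ s, conj g (f i) := by
  simp [conj, Finset.mul_sum, Finset.sum_mul]

theorem conj_mul (g h : SL(2, F)) (A : Matrix (Fin 2) (Fin 2) F) :
    conj (g * h) A = conj g (conj h A) := by
  simp [conj, _root_.mul_inv_rev, Matrix.mul_assoc, -Matrix.SpecialLinearGroup.coe_inv]

theorem trace_conj (g : SL(2, F)) (A : Matrix (Fin 2) (Fin 2) F) :
    (conj g A).trace = A.trace := by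
  rw [conj, Matrix.trace_mul_comm, ← Matrix.mul_assoc, ← Matrix.SpecialLinearGroup.coe_mul]
  simp

theorem conj_eq (g : SL(2, F)) (A : Matrix (Fin 2) (Fin 2) F) :
    conj g A = (g : Matrix (Fin 2) (Fin 2) F) * A *
      !![g.1 1 1, -g.1 0 1; -g.1 1 0, g.1 0 0] := by
  rw [conj, Matrix.SpecialLinearGroup.coe_inv, adjugate_fin_two]

/-- One-cocycles of `SL₂` with values in trace-zero matrices. -/
structure IsCocycle (c : SL(2, F) → Matrix (Fin 2) (Fin 2) F) : Prop where
  trace_eq_zero : ∀ g, (c g).trace = 0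
  map_mul : ∀ g h, c (g * h) = c g + conj g (c h)

namespace IsCocycle

variable {c : SL(2, F) → Matrix (Fin 2) (Fin 2) F}

theorem map_one (hc : IsCocycle c) : c 1 = 0 := by
  simpa [conj] using hc.map_mul 1 1

theorem apply_one_one (hc : IsCocycle c) (g : SL(2, F)) : c g 1 1 = -c g 0 0 := by
  have := hc.trace_eq_zero g
  rw [trace_fin_two] at this
  linear_combination this

theorem sub_coboundary (hc : IsCocycle c) {A : Matrix (Fin 2) (Fin 2) F} (hA : A.trace = 0) :
    IsCocycle fun g => c g - (conj g A - A) where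
  trace_eq_zero g := by simp [trace_sub, hc.trace_eq_zero, trace_conj, hA]
  map_mul g h := by
    simp only [hc.map_mul, conj_sub, conj_mul]
    abel

/-- The subgroup on which a cocycle vanishes. -/
def kernel (hc : IsCocycle c) : Subgroup (SL(2, F)) where
  carrier := {g | c g = 0}
  one_mem' := hc.map_one
  mul_mem' {g h} hg hh := by
    simp only [Set.mem_ofPred_eq] at *
    rw [hc.map_mul, hg, hh, conj_zero, add_zero]
  inv_mem' {g} hg := by
    simp only [Set.mem_ofPred_eq] at *
    simpa [hc.map_one, hg, conj_zero] using (hc.map_mul g⁻¹ g).symm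

theorem mem_kernel (hc : IsCocycle c) {g : SL(2, F)} : g ∈ hc.kernel ↔ c g = 0 := Iff.rfl

theorem conj_eq_self_of_mul_eq (hc : IsCocycle c) {g m n : SL(2, F)} (hm : c m = 0) (hn : c n = 0)
    (h : g * m = n * g) : conj n (c g) = c g := by
  have := congrArg c h
  rw [hc.map_mul, hc.map_mul, hm, hn, conj_zero] at this
  simpa using this.symm

end IsCocycle

/-- Unipotent elements generate `SL₂`. -/
theorem subgroup_eq_top (H : Subgroup (SL(2, F))) (hu : ∀ x, upper x ∈ H) (hl : ∀ x, lower x ∈ H) :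
    H = ⊤ := by
  have key : ∀ g : SL(2, F), g.1 1 0 ≠ 0 → g ∈ H := by
    intro g hg
    have hdet := g.det_coe
    rw [det_fin_two] at hdet
    have : g = upper ((g.1 0 0 - 1) / g.1 1 0) * lower (g.1 1 0) *
        upper ((g.1 1 1 - 1) / g.1 1 0) := by
      ext i j
      rw [Matrix.SpecialLinearGroup.coe_mul, Matrix.SpecialLinearGroup.coe_mul, coe_upper,
        coe_lower, coe_upper]
      fin_cases i <;> fin_cases j <;> simp [mul_apply, Fin.sum_univ_two] <;> field_simp
      · ring
      · linear_combination -hdet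
      · ring
    rw [this]
    exact H.mul_mem (H.mul_mem (hu _) (hl _)) (hu _)
  rw [eq_top_iff]
  intro g _
  by_cases hg : g.1 1 0 = 0
  · have h00 : g.1 0 0 ≠ 0 := by
      intro h
      have hdet := g.det_coe
      rw [det_fin_two, h, hg] at hdet
      simp at hdet
    have := key (lower 1 * g) (by
      rw [Matrix.SpecialLinearGroup.coe_mul, coe_lower]
      simpa [mul_apply, Fin.sum_univ_two, hg] using h00)
    exact (H.mul_mem_cancel_left (hl 1)).1 this
  · exact key g hg

/-- Over a field of odd characteristic, additive functions commuting with multiplication by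
squares are linear. -/
theorem linear_of_map_sq_mul (h2 : (2 : F) ≠ 0) {f : F → F} (hadd : ∀ x y, f (x + y) = f x + f y)
    (hsq : ∀ a x, a ≠ 0 → f (a ^ 2 * x) = a ^ 2 * f x) (x : F) : f x = f 1 * x := by
  have h0 : f 0 = 0 := by simpa using hadd 0 0
  have hsq' : ∀ a, f (a ^ 2) = a ^ 2 * f 1 := by
    intro a
    rcases eq_or_ne a 0 with rfl | ha
    · simp [h0]
    · simpa using hsq a 1 ha
  have h := hadd x (((x - 1) / 2) ^ 2)
  have hx : x + ((x - 1) / 2) ^ 2 = ((x + 1) / 2) ^ 2 := by field_simp; ring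
  rw [hx, hsq', hsq'] at h
  linear_combination (norm := skip) -h
  field_simp
  ring

/-- The coordinates of a torus-equivariant cocycle on a unipotent subgroup. -/
theorem unipotent_coordinates (h2 : (2 : F) ≠ 0) (h4 : ∃ a : F, a ≠ 0 ∧ a ^ 4 ≠ 1)
    {α β γ : F → F}
    (hβ : ∀ x y, β (x + y) = β x + β y + x * γ y)
    (hα : ∀ x y, α (x + y) = α x + α y - 2 * x * β y - x ^ 2 * γ y)
    (tγ : ∀ a x, a ≠ 0 → a ^ 2 * γ (a ^ 2 * x) = γ x)
    (tβ : ∀ a x, a ≠ 0 → β (a ^ 2 * x) = β x)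
    (tα : ∀ a x, a ≠ 0 → α (a ^ 2 * x) = a ^ 2 * α x) (x : F) :
    γ x = 0 ∧ β x = 0 ∧ α x = α 1 * x := by
  obtain ⟨a, ha, ha4⟩ := h4
  have γlin : ∀ x, γ x = γ 1 * x := fun x => by
    have h₁ := hβ x 1
    rw [add_comm x 1, hβ 1 x] at h₁
    linear_combination h₁
  have γ1 : γ 1 = 0 := by
    have h := tγ a 1 ha
    rw [γlin] at h
    have : γ 1 * (a ^ 4 - 1) = 0 := by linear_combination h
    exact (mul_eq_zero.1 this).resolve_right (sub_ne_zero.2 ha4)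
  have γ0 : ∀ x, γ x = 0 := fun x => by rw [γlin, γ1, zero_mul]
  have βlin : ∀ x, β x = β 1 * x := fun x => by
    have h₁ := hα x 1
    rw [add_comm x 1, hα 1 x, γ0, γ0] at h₁
    apply mul_left_cancel₀ h2
    linear_combination -h₁
  have β1 : β 1 = 0 := by
    have h := tβ a 1 ha
    rw [βlin] at h
    have h' : β 1 * (a ^ 4 - 1) = 0 := by linear_combination (a ^ 2 + 1) * h
    exact (mul_eq_zero.1 h').resolve_right (sub_ne_zero.2 ha4)
  have β0 : ∀ x, β x = 0 := fun x => by rw [βlin, β1, zero_mul]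
  refine ⟨γ0 x, β0 x, linear_of_map_sq_mul h2 (fun x y => ?_) tα x⟩
  rw [hα, β0, γ0]
  ring

theorem upper_add (x y : F) : upper (x + y) = upper x * upper y := by
  ext i j
  rw [Matrix.SpecialLinearGroup.coe_mul]
  fin_cases i <;> fin_cases j <;> simp [coe_upper, add_comm]

theorem lower_add (x y : F) : lower (x + y) = lower x * lower y := by
  ext i j
  rw [Matrix.SpecialLinearGroup.coe_mul]
  fin_cases i <;> fin_cases j <;> simp [coe_lower]

theorem upper_mul_torus (a : Fˣ) (x : F) :
    upper ((a : F) ^ 2 * x) * torus a = torus a * upper x := by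
  ext i j
  rw [Matrix.SpecialLinearGroup.coe_mul, Matrix.SpecialLinearGroup.coe_mul]
  fin_cases i <;> fin_cases j <;> simp [coe_upper, coe_torus]
  field_simp

theorem torus_mul_lower (a : Fˣ) (x : F) :
    torus a * lower ((a : F) ^ 2 * x) = lower x * torus a := by
  ext i j
  rw [Matrix.SpecialLinearGroup.coe_mul, Matrix.SpecialLinearGroup.coe_mul]
  fin_cases i <;> fin_cases j <;> simp [coe_lower, coe_torus]
  field_simp

theorem conj_upper (x : F) (A : Matrix (Fin 2) (Fin 2) F) :
    conj (upper x) A = !![A 0 0 + x * A 1 0, A 0 1 + x * A 1 1 - x * (A 0 0 + x * A 1 0);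
      A 1 0, A 1 1 - x * A 1 0] := by
  rw [conj_eq]
  ext i j
  fin_cases i <;> fin_cases j <;>
    simp [coe_upper, vecMul, dotProduct, mul_apply, Fin.sum_univ_two] <;> ring

theorem conj_lower (x : F) (A : Matrix (Fin 2) (Fin 2) F) :
    conj (lower x) A = !![A 0 0 - x * A 0 1, A 0 1;
      A 1 0 + x * A 0 0 - x * (A 1 1 + x * A 0 1), A 1 1 + x * A 0 1] := by
  rw [conj_eq]
  ext i j
  fin_cases i <;> fin_cases j <;>
    simp [coe_lower, vecMul, dotProduct, mul_apply, Fin.sum_univ_two] <;> ring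

theorem conj_torus (a : Fˣ) (A : Matrix (Fin 2) (Fin 2) F) :
    conj (torus a) A = !![A 0 0, (a : F) ^ 2 * A 0 1; ((a : F) ^ 2)⁻¹ * A 1 0, A 1 1] := by
  rw [conj_eq]
  ext i j
  fin_cases i <;> fin_cases j <;>
    simp [coe_torus, vecMul, dotProduct, mul_apply, Fin.sum_univ_two] <;> field_simp

namespace IsCocycle

variable {c : SL(2, F) → Matrix (Fin 2) (Fin 2) F}

theorem apply_upper (hc : IsCocycle c) (h2 : (2 : F) ≠ 0) (h4 : ∃ a : F, a ≠ 0 ∧ a ^ 4 ≠ 1)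
    (ht : ∀ a, c (torus a) = 0) (x : F) :
    c (upper x) = !![0, c (upper 1) 0 1 * x; 0, 0] := by
  have hadd : ∀ x y, c (upper (x + y)) = c (upper x) + conj (upper x) (c (upper y)) :=
    fun x y => by rw [upper_add, hc.map_mul]
  have htor : ∀ (a : Fˣ) x, c (upper ((a : F) ^ 2 * x)) = conj (torus a) (c (upper x)) := by
    intro a x
    have := congrArg c (upper_mul_torus a x)
    simpa [hc.map_mul, ht, conj_zero] using this
  simp only [conj_upper, conj_torus] at hadd htor
  obtain ⟨h₁, h₂, h₃⟩ := unipotent_coordinates h2 h4 (α := fun x => c (upper x) 0 1)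
    (β := fun x => c (upper x) 0 0) (γ := fun x => c (upper x) 1 0)
    (fun x y => by simp [hadd x y]; ring)
    (fun x y => by simp [hadd x y, hc.apply_one_one (upper y)]; ring)
    (fun a x ha => by have := htor (Units.mk0 a ha) x; simp at this; simp [this, ha])
    (fun a x ha => by simpa using congrFun₂ (htor (Units.mk0 a ha) x) 0 0)
    (fun a x ha => by simpa using congrFun₂ (htor (Units.mk0 a ha) x) 0 1) x
  rw [eta_fin_two (c (upper x)), hc.apply_one_one, h₁, h₂, h₃, neg_zero]

theorem apply_lower (hc : IsCocycle c) (h2 : (2 : F) ≠ 0) (h4 : ∃ a : F, a ≠ 0 ∧ a ^ 4 ≠ 1)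
    (ht : ∀ a, c (torus a) = 0) (x : F) :
    c (lower x) = !![0, 0; c (lower 1) 1 0 * x, 0] := by
  have hadd : ∀ x y, c (lower (x + y)) = c (lower x) + conj (lower x) (c (lower y)) :=
    fun x y => by rw [lower_add, hc.map_mul]
  have htor : ∀ (a : Fˣ) x, c (lower x) = conj (torus a) (c (lower ((a : F) ^ 2 * x))) := by
    intro a x
    have := congrArg c (torus_mul_lower a x)
    simpa [hc.map_mul, ht, conj_zero] using this.symm
  simp only [conj_lower, conj_torus] at hadd htor
  obtain ⟨h₁, h₂, h₃⟩ := unipotent_coordinates h2 h4 (α := fun x => c (lower x) 1 0)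
    (β := fun x => -c (lower x) 0 0) (γ := fun x => c (lower x) 0 1)
    (fun x y => by simp [hadd x y]; ring)
    (fun x y => by simp [hadd x y, hc.apply_one_one (lower y)]; ring)
    (fun a x ha => by have := htor (Units.mk0 a ha) x; simp at this; rw [this]; simp)
    (fun a x ha => by have := htor (Units.mk0 a ha) x; simp at this; rw [this]; simp)
    (fun a x ha => by have := htor (Units.mk0 a ha) x; simp at this; rw [this]; simp [ha]) x
  simp only [neg_eq_zero] at h₁ h₂ h₃
  rw [eta_fin_two (c (lower x)), hc.apply_one_one, h₁, h₂, h₃, neg_zero]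

theorem eq_zero_of_torus_of_upper (hc : IsCocycle c) (h2 : (2 : F) ≠ 0)
    (h4 : ∃ a : F, a ≠ 0 ∧ a ^ 4 ≠ 1) (ht : ∀ a, c (torus a) = 0)
    (hu : ∀ x, c (upper x) = 0) (g : SL(2, F)) : c g = 0 := by
  have hl := hc.apply_lower h2 h4 ht
  set δ := c (lower 1) 1 0
  have hδ : δ = 0 := by
    obtain ⟨a, ha, ha4⟩ := h4
    have key : upper a * (lower (-a⁻¹) * upper a) =
        torus (Units.mk0 a ha) * (upper 1 * (lower (-1) * upper 1)) := by
      ext i j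
      simp only [Matrix.SpecialLinearGroup.coe_mul, coe_upper, coe_lower, coe_torus]
      fin_cases i <;> fin_cases j <;> simp [ha]
    have h := congrArg (fun g => c g 1 0) key
    simp only [hc.map_mul, hu, ht, conj_zero, conj_upper, conj_torus, hl] at h
    simp at h
    field_simp at h
    have h' : δ * (a ^ 4 - 1) = 0 := by
      linear_combination (a ^ 3 + a ^ 2 + a + 1) * h
    exact (mul_eq_zero.1 h').resolve_right (sub_ne_zero.2 ha4)
  have := subgroup_eq_top hc.kernel hu (fun x => by
    rw [mem_kernel, hl, hδ]
    ext i j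
    fin_cases i <;> fin_cases j <;> simp)
  exact hc.mem_kernel.1 (this ▸ Subgroup.mem_top g)

theorem exists_coboundary_on_torus [Fintype F] (hc : IsCocycle c) :
    ∃ A : Matrix (Fin 2) (Fin 2) F, A.trace = 0 ∧
      ∀ a, c (torus a) = conj (torus a) A - A := by
  classical
  refine ⟨∑ b : Fˣ, c (torus b), by simp [trace_sum, hc.trace_eq_zero], fun a => ?_⟩
  have hcard : ((Fintype.card Fˣ : ℕ) : F) = -1 := by
    rw [Fintype.card_units, Nat.cast_sub Fintype.card_pos]
    simp
  have h : ∀ b, conj (torus a) (c (torus b)) = c (torus (a * b)) - c (torus a) := by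
    intro b
    rw [_root_.map_mul, hc.map_mul, add_sub_cancel_left]
  have hsum := Equiv.sum_comp (Equiv.mulLeft a) fun b => c (torus b)
  simp only [Equiv.coe_mulLeft] at hsum
  rw [conj_sum, Finset.sum_congr rfl fun b _ => h b, Finset.sum_sub_distrib,
    hsum, Finset.sum_const, Finset.card_univ,
    ← Nat.cast_smul_eq_nsmul F, hcard]
  simp

theorem exists_coboundary_of_pow_four_ne_one [Fintype F] (hc : IsCocycle c) (h2 : (2 : F) ≠ 0)
    (h4 : ∃ a : F, a ≠ 0 ∧ a ^ 4 ≠ 1) :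
    ∃ A : Matrix (Fin 2) (Fin 2) F, A.trace = 0 ∧ ∀ g, c g = conj g A - A := by
  obtain ⟨A, hA, hAt⟩ := hc.exists_coboundary_on_torus
  have hd := hc.sub_coboundary hA
  set d := fun g => c g - (conj g A - A) with hd_def
  have hdt : ∀ a, d (torus a) = 0 := fun a => by rw [hd_def]; simp [hAt]
  have hdu := hd.apply_upper h2 h4 hdt
  set s := d (upper 1) 0 1
  let B : Matrix (Fin 2) (Fin 2) F := !![-s / 2, 0; 0, s / 2]
  have hB : B.trace = 0 := by simp [B, trace_fin_two]; ring
  have hzero := (hd.sub_coboundary hB).eq_zero_of_torus_of_upper h2 h4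
    (fun a => by
      rw [hdt, conj_torus]
      ext i j
      fin_cases i <;> fin_cases j <;> simp [B])
    (fun x => by
      rw [hdu, conj_upper]
      ext i j
      fin_cases i <;> fin_cases j <;> simp [B]
      field_simp
      ring)
  refine ⟨A + B, by rw [trace_add, hA, hB, add_zero], fun g => ?_⟩
  have := hzero g
  simp only [hd_def] at this
  rw [conj_add, ← sub_eq_zero, ← this]
  abel

end IsCocycle

/-- The Weyl element, one of the generators of the quaternion subgroup in characteristic `3`. -/
def weyl : SL(2, F) := ⟨!![0, -1; 1, 0], by simp [det_fin_two]⟩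

/-- The second generator of the quaternion subgroup in characteristic `3`. -/
def quaternionJ (h3 : (3 : F) = 0) : SL(2, F) :=
  ⟨!![1, 1; 1, -1], by simp only [det_fin_two_of]; linear_combination -h3⟩

theorem coe_weyl : ((weyl : SL(2, F)) : Matrix (Fin 2) (Fin 2) F) = !![0, -1; 1, 0] := rfl

theorem coe_quaternionJ (h3 : (3 : F) = 0) :
    (quaternionJ h3 : Matrix (Fin 2) (Fin 2) F) = !![1, 1; 1, -1] := rfl

theorem lower_mul_weyl (x : F) : lower x * weyl = weyl * upper (-x) := by
  ext i j
  rw [Matrix.SpecialLinearGroup.coe_mul, Matrix.SpecialLinearGroup.coe_mul]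
  fin_cases i <;> fin_cases j <;> simp [coe_lower, coe_weyl, coe_upper]

theorem weyl_sq : (weyl * weyl : SL(2, F)).1 = -1 := by
  rw [Matrix.SpecialLinearGroup.coe_mul]
  ext i j
  fin_cases i <;> fin_cases j <;> simp [coe_weyl]

theorem quaternionJ_sq (h3 : (3 : F) = 0) :
    quaternionJ h3 * quaternionJ h3 = weyl * weyl := by
  ext i j
  rw [weyl_sq, Matrix.SpecialLinearGroup.coe_mul]
  fin_cases i <;> fin_cases j <;> simp [coe_quaternionJ] <;> linear_combination h3

theorem weyl_mul_quaternionJ (h3 : (3 : F) = 0) :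
    weyl * quaternionJ h3 = weyl * weyl * (quaternionJ h3 * weyl) := by
  ext i j
  rw [Matrix.SpecialLinearGroup.coe_mul (weyl * weyl), weyl_sq,
    Matrix.SpecialLinearGroup.coe_mul, Matrix.SpecialLinearGroup.coe_mul]
  fin_cases i <;> fin_cases j <;> simp [coe_quaternionJ, coe_weyl]

theorem upper_one_mul_weyl (h3 : (3 : F) = 0) :
    upper 1 * weyl = quaternionJ h3 * upper 1 := by
  ext i j
  rw [Matrix.SpecialLinearGroup.coe_mul, Matrix.SpecialLinearGroup.coe_mul]
  fin_cases i <;> fin_cases j <;> simp [coe_quaternionJ, coe_weyl, coe_upper]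
  linear_combination -h3

theorem upper_one_mul_quaternionJ (h3 : (3 : F) = 0) :
    upper 1 * quaternionJ h3 = weyl * quaternionJ h3 * upper 1 := by
  ext i j
  simp only [Matrix.SpecialLinearGroup.coe_mul]
  fin_cases i <;> fin_cases j <;> simp [coe_quaternionJ, coe_weyl, coe_upper]
  · linear_combination h3
  · linear_combination -h3

theorem conj_weyl_sq (A : Matrix (Fin 2) (Fin 2) F) : conj (weyl * weyl) A = A := by
  rw [conj_eq, weyl_sq]
  ext i j
  fin_cases i <;> fin_cases j <;> simp [mul_apply, Fin.sum_univ_two]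

theorem mul_eq_mul_of_conj_eq_self {g : SL(2, F)} {A : Matrix (Fin 2) (Fin 2) F}
    (h : conj g A = A) : g.1 * A = A * g.1 := by
  rw [conj] at h
  conv_rhs => rw [← h]
  rw [Matrix.mul_assoc _ _ g.1, ← Matrix.SpecialLinearGroup.coe_mul]
  simp

theorem eq_zero_of_quaternion_fixed (h3 : (3 : F) = 0)
    {A : Matrix (Fin 2) (Fin 2) F} (hA : A 1 1 = -A 0 0) (hJ : conj (quaternionJ h3) A = A)
    (hK : conj (weyl * quaternionJ h3) A = A) : A = 0 := by
  have hJ' := mul_eq_mul_of_conj_eq_self hJ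
  have hK' := mul_eq_mul_of_conj_eq_self hK
  rw [Matrix.SpecialLinearGroup.coe_mul] at hK'
  have h₁ := congrFun₂ hJ' 0 0
  have h₂ := congrFun₂ hJ' 0 1
  have h₃ := congrFun₂ hK' 0 1
  simp [coe_quaternionJ, coe_weyl, mul_apply, Fin.sum_univ_two, hA] at h₁ h₂ h₃
  have h00 : A 0 0 = 0 := by
    linear_combination -(A 0 0) * h3 - h₂ - h₃
  have h01 : A 0 1 = 0 := by
    linear_combination -(A 0 1) * h3 + h₂ - h₃
  rw [eta_fin_two A, hA, h₁, h00, h01]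
  ext i j
  fin_cases i <;> fin_cases j <;> simp

namespace IsCocycle

variable {c : SL(2, F) → Matrix (Fin 2) (Fin 2) F}

theorem eq_zero_of_quaternion (hc : IsCocycle c) (h3 : (3 : F) = 0)
    (hF : ∀ x : F, x = 0 ∨ x = 1 ∨ x = -1) (hI : c weyl = 0) (hJ : c (quaternionJ h3) = 0)
    (g : SL(2, F)) : c g = 0 := by
  have hK : c (weyl * quaternionJ h3) = 0 := hc.kernel.mul_mem hI hJ
  have hu1 : upper 1 ∈ hc.kernel :=
    eq_zero_of_quaternion_fixed h3 (hc.apply_one_one _)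
      (hc.conj_eq_self_of_mul_eq hI hJ (upper_one_mul_weyl h3))
      (hc.conj_eq_self_of_mul_eq hJ hK (upper_one_mul_quaternionJ h3))
  have hu0 : (upper 0 : SL(2, F)) = 1 := by
    ext i j
    fin_cases i <;> fin_cases j <;> simp [coe_upper]
  have hu : ∀ x, upper x ∈ hc.kernel := by
    intro x
    rcases hF x with rfl | rfl | rfl
    · rw [hu0]
      exact one_mem _
    · exact hu1
    · refine (hc.kernel.mul_mem_cancel_right hu1).1 ?_
      rw [← upper_add, neg_add_cancel, hu0]
      exact one_mem _
  have hl : ∀ x, lower x ∈ hc.kernel := by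
    intro x
    refine (hc.kernel.mul_mem_cancel_right (hc.mem_kernel.2 hI)).1 ?_
    rw [lower_mul_weyl]
    exact hc.kernel.mul_mem hI (hu _)
  exact hc.mem_kernel.1 (subgroup_eq_top hc.kernel hu hl ▸ Subgroup.mem_top g)

theorem apply_weyl_sq (hc : IsCocycle c) (h2 : (2 : F) ≠ 0) : c (weyl * weyl) = 0 := by
  have h := hc.map_mul (weyl * weyl) (weyl * weyl)
  have hone : (weyl * weyl * (weyl * weyl) : SL(2, F)) = 1 := by
    apply Subtype.ext
    rw [Matrix.SpecialLinearGroup.coe_mul, weyl_sq]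
    simp
  rw [hone, hc.map_one, conj_weyl_sq, ← two_smul F] at h
  exact (smul_eq_zero.1 h.symm).resolve_left h2

theorem conj_eq_neg_of_sq (hc : IsCocycle c) (h2 : (2 : F) ≠ 0) {g : SL(2, F)}
    (hg : g * g = weyl * weyl) : conj g (c g) = -c g := by
  rw [eq_neg_iff_add_eq_zero, add_comm, ← hc.map_mul, hg, hc.apply_weyl_sq h2]

theorem exists_coboundary_of_three_eq_zero (hc : IsCocycle c) (h2 : (2 : F) ≠ 0)
    (h3 : (3 : F) = 0) (hF : ∀ x : F, x = 0 ∨ x = 1 ∨ x = -1) :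
    ∃ A : Matrix (Fin 2) (Fin 2) F, A.trace = 0 ∧ ∀ g, c g = conj g A - A := by
  have three : ∀ A : Matrix (Fin 2) (Fin 2) F, A - (-A - A) = 0 := by
    intro A
    ext i j
    simp only [Matrix.sub_apply, Matrix.neg_apply, Matrix.zero_apply]
    linear_combination A i j * h3
  set A := c weyl with hA
  have hAt : A.trace = 0 := hc.trace_eq_zero _
  have hd := hc.sub_coboundary hAt
  set d := fun g => c g - (conj g A - A) with hd_def
  have hdI : d weyl = 0 := by
    simp only [hd_def]
    rw [hA, hc.conj_eq_neg_of_sq h2 rfl, three]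
  set B := d (quaternionJ h3) with hB
  have hBt : B.trace = 0 := hd.trace_eq_zero _
  have hBI : conj weyl B = B := by
    have h := congrArg d (weyl_mul_quaternionJ h3)
    rw [hd.map_mul, hd.map_mul (weyl * weyl), hd.map_mul (quaternionJ h3), hd.apply_weyl_sq h2,
      conj_weyl_sq, hdI, conj_zero] at h
    simpa using h
  have hzero := (hd.sub_coboundary hBt).eq_zero_of_quaternion h3 hF
    (by rw [hdI, hBI]; simp)
    (by rw [hB, hd.conj_eq_neg_of_sq h2 (quaternionJ_sq h3), three])
  refine ⟨A + B, by rw [trace_add, hAt, hBt, add_zero], fun g => ?_⟩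
  have := hzero g
  simp only [hd_def] at this
  rw [conj_add, ← sub_eq_zero, ← this]
  abel

/-- Over a finite field of odd cardinality other than `5`, every cocycle is a coboundary. -/
theorem exists_coboundary [Fintype F] (hc : IsCocycle c) (h2 : (2 : F) ≠ 0)
    (h5 : Fintype.card F ≠ 5) :
    ∃ A : Matrix (Fin 2) (Fin 2) F, A.trace = 0 ∧ ∀ g, c g = conj g A - A := by
  by_cases h4 : ∃ a : F, a ≠ 0 ∧ a ^ 4 ≠ 1
  · exact hc.exists_coboundary_of_pow_four_ne_one h2 h4
  push Not at h4
  have hdvd : Fintype.card F - 1 ∣ 4 :=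
    (FiniteField.forall_pow_eq_one_iff F 4).1 fun a => Units.ext <| by simpa using h4 a a.ne_zero
  have hcast := FiniteField.cast_card_eq_zero F
  have hcard : Fintype.card F = 3 := by
    have hlt := Fintype.one_lt_card (α := F)
    have hle := Nat.le_of_dvd (by norm_num) hdvd
    generalize Fintype.card F = q at *
    have : q ≤ 5 := by omega
    interval_cases q
    · exact absurd (by exact_mod_cast hcast) h2
    · rfl
    · omega
    · omega
  rw [hcard] at hcast
  refine hc.exists_coboundary_of_three_eq_zero h2 (by exact_mod_cast hcast) fun x => ?_
  have hx := FiniteField.pow_card x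
  rw [hcard] at hx
  have : x * ((x - 1) * (x + 1)) = 0 := by linear_combination hx
  simpa [sub_eq_zero, add_eq_zero_iff_eq_neg] using this

end IsCocycle

end SL2Conj

open CategoryTheory

/-- Let `ℓ` be an odd prime, `q = ℓ^n ≠ 5`, and `F` the field with `q`
elements.  Let `V` be the `F`-vector space of trace-zero `2 × 2` matrices over `F`,
regarded as a representation of `SL₂(F)` by conjugation.  Then `H¹(SL₂(F), V) = 0`.

(The conjugation representation is pinned down by the hypothesis `hρ`.) -/
theorem h1_sl2_conjugation_eq_zero
    (ℓ n : ℕ) (hℓ : ℓ.Prime) (hodd : ℓ ≠ 2) (hn : 1 ≤ n) (hq : ℓ ^ n ≠ 5)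
    (F : Type) [Field F] [Fintype F] (hF : Fintype.card F = ℓ ^ n)
    (ρ : Representation F (Matrix.SpecialLinearGroup (Fin 2) F)
      (LinearMap.ker (Matrix.traceLinearMap (Fin 2) F F)))
    (hρ : ∀ (g : Matrix.SpecialLinearGroup (Fin 2) F)
      (A : LinearMap.ker (Matrix.traceLinearMap (Fin 2) F F)),
      ((ρ g A : Matrix (Fin 2) (Fin 2) F)) =
        (g : Matrix (Fin 2) (Fin 2) F) * (A : Matrix (Fin 2) (Fin 2) F) *
          ((g⁻¹ : Matrix.SpecialLinearGroup (Fin 2) F) : Matrix (Fin 2) (Fin 2) F)) :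
    Limits.IsZero (groupCohomology (Rep.of ρ) 1) := by
  have h2 : (2 : F) ≠ 0 := by
    intro h
    have hℓ0 : (ℓ : F) = 0 := by
      have := FiniteField.cast_card_eq_zero F
      rw [hF, Nat.cast_pow] at this
      exact eq_zero_of_pow_eq_zero this
    obtain ⟨k, hk⟩ := hℓ.odd_of_ne_two hodd
    rw [hk] at hℓ0
    push_cast at hℓ0
    rw [h] at hℓ0
    simp at hℓ0
  have hzero : ∀ x : groupCohomology (Rep.of ρ) 1, x = 0 := by
    intro x
    induction x using groupCohomology.H1_induction_on with
    | h f =>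
      rw [groupCohomology.H1π_eq_zero_iff]
      have hmul := (groupCohomology.mem_cocycles₁_iff f.1).1 f.2
      have hc : SL2Conj.IsCocycle fun g => (f.1 g).1 :=
        { trace_eq_zero := fun g => (f.1 g).2
          map_mul := fun g h => by
            rw [hmul g h, SL2Conj.conj, ← hρ g (f.1 h), add_comm]
            rfl }
      obtain ⟨A, hA, hfA⟩ := hc.exists_coboundary h2 (hF ▸ hq)
      refine ⟨⟨A, hA⟩, funext fun g => Subtype.ext ?_⟩
      refine Eq.trans ?_ (hfA g).symm
      rw [SL2Conj.conj, ← hρ g ⟨A, hA⟩]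
      rfl
  have : Subsingleton (groupCohomology (Rep.of ρ) 1) :=
    ⟨fun x y => (hzero x).trans (hzero y).symm⟩
  exact ModuleCat.isZero_of_subsingleton _
end

section
/- Let ℓ be an odd prime, k an algebraically closed field of characteristic ℓ, G a finite group, ρ : G → GL₂(k) a homomorphism whose associated representation on k² is irreducible, and μ : G → kˣ a homomorphism of even (finite) order. Let M be the k-vector space of trace-zero 2×2 matrices over k with G-action g·A = μ(g)·ρ(g) A ρ(g)⁻¹ (the twist ad⁰ρ ⊗ μ), and let K be the intersection of {g ∈ G : g acts trivially on M} with ker μ; K is normal in G and acts trivially on M, so M is a G/K-module. Assume we are not in the following exceptional case: ℓ = 5, the projective image of ρ is isomorphic as a group to PGL₂(𝔽₅), and μ is trivial on {g ∈ G : ρ(g) is a scalar matrix} (so that μ factors through the projective image, necessarily through its unique character of order 2). Then H¹(G/K, M) = 0. -/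
open CategoryTheory

/-- Cocycles for the twisted adjoint action, vanishing on the scalar elements of `ker μ`. -/
structure IsTwistedCocycle {k G : Type} [Field k] [Group G]
    (R : G →* Matrix (Fin 2) (Fin 2) k) (μ : G →* kˣ) (c : G → Matrix (Fin 2) (Fin 2) k) :
    Prop where
  trace_eq_zero : ∀ g, (c g).trace = 0
  map_mul : ∀ g h, c (g * h) = c g + (μ g : k) • (R g * c h * R g⁻¹)
  eq_zero_of_scalar : ∀ g, μ g = 1 → (∃ a : k, R g = a • 1) → c g = 0

/-- The first-order variation of the trace along a cocycle. -/
def traceVar {k G : Type} [Field k] [Group G]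
    (R : G →* Matrix (Fin 2) (Fin 2) k) (c : G → Matrix (Fin 2) (Fin 2) k) (g : G) : k :=
  (c g * R g).trace

/-- `u ∈ ker μ` acts as the unipotent matrix `1 + n`. -/
structure IsUnip {k G : Type} [Field k] [Group G]
    (R : G →* Matrix (Fin 2) (Fin 2) k) (μ : G →* kˣ) (u : G) (n : Matrix (Fin 2) (Fin 2) k) :
    Prop where
  char_eq_one : μ u = 1
  map_eq : R u = 1 + n
  sq_eq_zero : n * n = 0

section Matrices

variable {k : Type} [Field k]

theorem trace_eq_zero_of_mul_self {n : Matrix (Fin 2) (Fin 2) k} (hn : n * n = 0) :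
    n.trace = 0 := by
  have : IsNilpotent n := ⟨2, by rw [pow_two, hn]⟩
  exact (Matrix.isNilpotent_trace_of_isNilpotent this).eq_zero

theorem det_eq_zero_of_mul_self {n : Matrix (Fin 2) (Fin 2) k} (hn : n * n = 0) :
    n.det = 0 := by
  have := congrArg Matrix.det hn
  simpa using this

/-- A square-zero `2 × 2` matrix written in coordinates. -/
theorem exists_coords_of_mul_self {n : Matrix (Fin 2) (Fin 2) k} (hn : n * n = 0) :
    ∃ a b c : k, n = !![a, b; c, -a] ∧ a * a + b * c = 0 := by
  have h1 := trace_eq_zero_of_mul_self hn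
  have h2 := det_eq_zero_of_mul_self hn
  rw [Matrix.trace_fin_two] at h1
  rw [Matrix.det_fin_two] at h2
  have h3 : n 1 1 = -n 0 0 := by linear_combination h1
  refine ⟨n 0 0, n 0 1, n 1 0, ?_, ?_⟩
  · rw [← h3]; exact Matrix.eta_fin_two n
  · rw [h3] at h2; linear_combination -h2

theorem exists_coords_of_trace_eq_zero {n : Matrix (Fin 2) (Fin 2) k} (hn : n.trace = 0) :
    ∃ a b c : k, n = !![a, b; c, -a] := by
  rw [Matrix.trace_fin_two] at hn
  have h3 : n 1 1 = -n 0 0 := by linear_combination hn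
  exact ⟨n 0 0, n 0 1, n 1 0, by rw [← h3]; exact Matrix.eta_fin_two n⟩

/-- Powers of a `2 × 2` matrix are affine in the matrix. -/
theorem exists_pow_eq_smul_add (X : Matrix (Fin 2) (Fin 2) k) (m : ℕ) :
    ∃ a b : k, X ^ m = a • X + b • 1 := by
  induction m with
  | zero => exact ⟨0, 1, by simp⟩
  | succ m ih =>
    obtain ⟨a, b, h⟩ := ih
    refine ⟨a * X.trace + b, -(a * X.det), ?_⟩
    rw [pow_succ, h, Matrix.eta_fin_two X]
    ext i j
    fin_cases i <;> fin_cases j <;>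
      simp [Matrix.trace_fin_two, Matrix.det_fin_two, Matrix.mul_apply, Fin.sum_univ_two] <;> ring

theorem disc_eq_zero_of_isNilpotent {X : Matrix (Fin 2) (Fin 2) k} (h : IsNilpotent X) :
    X.trace ^ 2 = 4 * X.det := by
  have h1 := (Matrix.isNilpotent_trace_of_isNilpotent h).eq_zero
  have h2 : X.det = 0 := by
    obtain ⟨n, hn⟩ := h
    have := congrArg Matrix.det hn
    rw [Matrix.det_pow, Matrix.det_zero] at this
    exact eq_zero_of_pow_eq_zero this
  rw [h1, h2]; ring

theorem disc_smul_add (X : Matrix (Fin 2) (Fin 2) k) (a b : k) :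
    (a • X + b • 1).trace ^ 2 - 4 * (a • X + b • 1).det = a ^ 2 * (X.trace ^ 2 - 4 * X.det) := by
  simp [Matrix.trace_fin_two, Matrix.det_fin_two]
  ring

/-- If `X` has distinct eigenvalues and finite order then a prime-to-`ℓ` power is scalar. -/
theorem exists_pow_scalar {ℓ : ℕ} [Fact ℓ.Prime] [CharP k ℓ] {X : Matrix (Fin 2) (Fin 2) k}
    (hX : X.trace ^ 2 ≠ 4 * X.det) {N : ℕ} (hN : N ≠ 0) (h1 : X ^ N = 1) :
    ∃ m : ℕ, ¬ ℓ ∣ m ∧ ∃ b : k, X ^ m = b • 1 := by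
  obtain ⟨r, m, hm, rfl⟩ := Nat.exists_eq_pow_mul_and_not_dvd hN ℓ (Fact.out : ℓ.Prime).ne_one
  refine ⟨m, hm, ?_⟩
  obtain ⟨a, b, hab⟩ := exists_pow_eq_smul_add X m
  have hnil : IsNilpotent (X ^ m - 1) := by
    refine ⟨ℓ ^ r, ?_⟩
    rw [sub_pow_char_pow_of_commute _ _ (Commute.one_right _), ← pow_mul, mul_comm m, h1]
    simp
  have hd := disc_eq_zero_of_isNilpotent hnil
  have e : X ^ m - 1 = a • X + (b - 1) • 1 := by rw [hab, sub_smul, one_smul, add_sub_assoc]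
  rw [e] at hd
  have h2 := disc_smul_add X a (b - 1)
  rw [hd, sub_self] at h2
  have ha : a = 0 := by
    rcases mul_eq_zero.mp h2.symm with h | h
    · exact pow_eq_zero_iff (two_ne_zero) |>.mp h
    · exact absurd (sub_eq_zero.mp h) hX
  exact ⟨b, by rw [hab, ha]; simp⟩

end Matrices

namespace IsTwistedCocycle

variable {k G : Type} [Field k] [Group G] {R : G →* Matrix (Fin 2) (Fin 2) k} {μ : G →* kˣ}
  {c : G → Matrix (Fin 2) (Fin 2) k}

theorem map_mul_of_char_eq_one (hc : IsTwistedCocycle R μ c) {g : G} (hg : μ g = 1) (h : G) :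
    c (g * h) = c g + R g * c h * R g⁻¹ := by
  rw [hc.map_mul, hg]; simp

theorem map_one (hc : IsTwistedCocycle R μ c) : c 1 = 0 :=
  hc.eq_zero_of_scalar 1 (_root_.map_one μ) ⟨1, by simp⟩

theorem map_inv (hc : IsTwistedCocycle R μ c) {g : G} (hg : μ g = 1) :
    c g⁻¹ = -(R g⁻¹ * c g * R g) := by
  have h := hc.map_mul_of_char_eq_one (g := g⁻¹) (by simp [hg]) g
  rw [inv_mul_cancel, hc.map_one, inv_inv] at h
  exact eq_neg_of_add_eq_zero_left h.symm

theorem traceVar_pow (hc : IsTwistedCocycle R μ c) {g : G} (hg : μ g = 1) (m : ℕ) :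
    (c (g ^ m) * R g).trace = m * traceVar R c g := by
  induction m with
  | zero => simp [hc.map_one]
  | succ m ih =>
    rw [pow_succ', hc.map_mul_of_char_eq_one hg, add_mul, Matrix.trace_add, mul_assoc _ (R g⁻¹),
      ← _root_.map_mul, inv_mul_cancel, _root_.map_one, mul_one, ← traceVar,
      Matrix.trace_mul_comm, ih, Nat.cast_succ]
    ring

theorem traceVar_eq_zero_of_disc_ne [Finite G] {ℓ : ℕ} [Fact ℓ.Prime] [CharP k ℓ]
    (hc : IsTwistedCocycle R μ c) {g : G} (hg : μ g = 1)
    (hd : (R g).trace ^ 2 ≠ 4 * (R g).det) : traceVar R c g = 0 := by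
  obtain ⟨m, hm, b, hb⟩ := exists_pow_scalar (ℓ := ℓ) hd (N := Nat.card G) Nat.card_pos.ne'
    (by rw [← map_pow, pow_card_eq_one', _root_.map_one])
  have h := hc.traceVar_pow hg m
  rw [hc.eq_zero_of_scalar (g ^ m) (by simp [hg]) ⟨b, by rw [map_pow, hb]⟩, zero_mul,
    Matrix.trace_zero] at h
  have hm' : (m : k) ≠ 0 := by rwa [Ne, CharP.cast_eq_zero_iff k ℓ]
  exact (mul_eq_zero.mp h.symm).resolve_left hm'

theorem traceVar_conj (hc : IsTwistedCocycle R μ c) {g : G} (hg : μ g = 1) (t : G) :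
    traceVar R c (t * g * t⁻¹) = μ t * traceVar R c g := by
  have h1 : μ (t * g * t⁻¹) = 1 := by simp [hg]
  have h2 := hc.map_mul_of_char_eq_one h1 t
  rw [inv_mul_cancel_right, hc.map_mul] at h2
  have e1 : R t⁻¹ * R t = 1 := by rw [← _root_.map_mul]; simp
  have e2 : R (t * g * t⁻¹)⁻¹ * R (t * g * t⁻¹) = 1 := by
    rw [← _root_.map_mul, inv_mul_cancel, _root_.map_one]
  have h3 := congrArg (fun X => (X * R (t * g * t⁻¹)).trace) h2
  simp only [add_mul, Matrix.trace_add] at h3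
  rw [mul_assoc _ _ (R (t * g * t⁻¹)), e2, mul_one, Matrix.trace_mul_comm (R (t * g * t⁻¹)),
    add_comm, add_left_inj, smul_mul_assoc, Matrix.trace_smul, _root_.map_mul, _root_.map_mul,
    show R t * c g * R t⁻¹ * (R t * R g * R t⁻¹) = R t * c g * (R t⁻¹ * R t) * R g * R t⁻¹ by
      noncomm_ring, e1, mul_one, Matrix.trace_mul_comm, ← mul_assoc, ← mul_assoc, e1, one_mul] at h3
  rw [traceVar, traceVar, _root_.map_mul, _root_.map_mul, ← h3, smul_eq_mul]

/-- Scalar elements act trivially through `μ` once some trace variation is nonzero. -/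
theorem char_eq_one_of_scalar (hc : IsTwistedCocycle R μ c) {u : G} (hu : μ u = 1)
    (hτ : traceVar R c u ≠ 0) {t : G} (ht : ∃ a : k, R t = a • 1) : μ t = 1 := by
  obtain ⟨a, ha⟩ := ht
  have hR : R (t * u * t⁻¹) = R u := by
    have e1 : R t * R t⁻¹ = 1 := by rw [← _root_.map_mul]; simp
    rw [_root_.map_mul, _root_.map_mul, ha, smul_one_mul, ← mul_smul_one, mul_assoc, ← ha, e1,
      mul_one]
  have hz : c (u⁻¹ * (t * u * t⁻¹)) = 0 := by
    refine hc.eq_zero_of_scalar _ (by simp [hu]) ⟨1, ?_⟩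
    rw [_root_.map_mul, hR, ← _root_.map_mul]; simp
  have hcc : c (t * u * t⁻¹) = c u := by
    have := hc.map_mul_of_char_eq_one hu (u⁻¹ * (t * u * t⁻¹))
    rwa [mul_inv_cancel_left, hz, mul_zero, zero_mul, add_zero] at this
  have h := hc.traceVar_conj hu t
  rw [traceVar, hR, hcc, ← traceVar] at h
  have : (μ t : k) = 1 := by
    apply mul_right_cancel₀ hτ
    rw [← h, one_mul]
  exact Units.ext this

end IsTwistedCocycle

namespace IsUnip

variable {k G : Type} [Field k] [Group G] {R : G →* Matrix (Fin 2) (Fin 2) k} {μ : G →* kˣ}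
  {c : G → Matrix (Fin 2) (Fin 2) k} {u v : G} {n n' : Matrix (Fin 2) (Fin 2) k}

theorem map_inv (hu : IsUnip R μ u n) : R u⁻¹ = 1 - n := by
  have h : R u⁻¹ * R u = 1 := by rw [← map_mul]; simp
  calc R u⁻¹ = R u⁻¹ * (1 - n * n) := by rw [hu.sq_eq_zero]; simp
    _ = R u⁻¹ * R u * (1 - n) := by rw [hu.map_eq]; noncomm_ring
    _ = 1 - n := by rw [h, one_mul]

theorem inv (hu : IsUnip R μ u n) : IsUnip R μ u⁻¹ (-n) :=
  ⟨by simp [hu.char_eq_one], by rw [hu.map_inv, sub_eq_add_neg], by simp [hu.sq_eq_zero]⟩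

theorem mul (hu : IsUnip R μ u n) (hv : IsUnip R μ v n') (h : n * n' = 0) (h' : n' * n = 0) :
    IsUnip R μ (u * v) (n + n') := by
  refine ⟨by simp [hu.char_eq_one, hv.char_eq_one], ?_, ?_⟩
  · rw [map_mul, hu.map_eq, hv.map_eq]
    calc _ = 1 + (n + n') + n * n' := by noncomm_ring
      _ = _ := by rw [h, add_zero]
  · simp [mul_add, add_mul, hu.sq_eq_zero, hv.sq_eq_zero, h, h']

theorem conj (hu : IsUnip R μ u n) (t : G) : IsUnip R μ (t * u * t⁻¹) (R t * n * R t⁻¹) := by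
  have e1 : R t * R t⁻¹ = 1 := by rw [← map_mul]; simp
  have e2 : R t⁻¹ * R t = 1 := by rw [← map_mul]; simp
  refine ⟨by simp [hu.char_eq_one], ?_, ?_⟩
  · rw [map_mul, map_mul, hu.map_eq, mul_add, add_mul, mul_one, e1]
  · calc _ = R t * n * (R t⁻¹ * R t) * n * R t⁻¹ := by noncomm_ring
      _ = R t * (n * n) * R t⁻¹ := by rw [e2]; noncomm_ring
      _ = 0 := by rw [hu.sq_eq_zero]; simp

theorem pow (hu : IsUnip R μ u n) (m : ℕ) : IsUnip R μ (u ^ m) ((m : k) • n) := by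
  induction m with
  | zero => exact ⟨by simp, by simp, by simp⟩
  | succ m ih =>
    have := ih.mul hu (by simp [hu.sq_eq_zero]) (by simp [hu.sq_eq_zero])
    rw [← pow_succ] at this
    convert this using 1
    rw [Nat.cast_succ, add_smul, one_smul]

/-- The first-order form of `tr(gh) + tr(gh⁻¹) = tr(g) tr(h)`. -/
theorem traceVar_mul_add (hu : IsUnip R μ u n) (hv : IsUnip R μ v n')
    (hc : IsTwistedCocycle R μ c) :
    traceVar R c (u * v) + traceVar R c (u * v⁻¹) = 2 * (traceVar R c u + traceVar R c v) := by
  unfold traceVar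
  have e (X Y : Matrix (Fin 2) (Fin 2) k) : X * R u⁻¹ * (R u * Y) = X * Y := by
    rw [mul_assoc, ← mul_assoc (R u⁻¹), ← map_mul, inv_mul_cancel, map_one, one_mul]
  rw [hc.map_mul_of_char_eq_one hu.char_eq_one, hc.map_mul_of_char_eq_one hu.char_eq_one,
    hc.map_inv hv.char_eq_one, map_mul, map_mul, add_mul, add_mul, e, e, hv.map_inv, hu.map_eq,
    hv.map_eq]
  obtain ⟨a, b, d, hn, h⟩ := exists_coords_of_mul_self hu.sq_eq_zero
  obtain ⟨a', b', d', hn', h'⟩ := exists_coords_of_mul_self hv.sq_eq_zero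
  obtain ⟨x, y, z, hx⟩ := exists_coords_of_trace_eq_zero (hc.trace_eq_zero u)
  obtain ⟨x', y', z', hx'⟩ := exists_coords_of_trace_eq_zero (hc.trace_eq_zero v)
  rw [hn, hn', hx, hx']
  simp [Matrix.trace_fin_two, Matrix.one_fin_two]
  grind

theorem traceVar_sq (hu : IsUnip R μ u n) (hc : IsTwistedCocycle R μ c) :
    traceVar R c (u ^ 2) = 4 * traceVar R c u := by
  have h := hu.traceVar_mul_add hu hc
  rw [mul_inv_cancel, ← pow_two] at h
  have h1 : traceVar R c 1 = 0 := by simp [traceVar, hc.map_one]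
  linear_combination h - h1

theorem traceVar_cube (hu : IsUnip R μ u n) (hc : IsTwistedCocycle R μ c) :
    traceVar R c (u ^ 3) = 9 * traceVar R c u := by
  have h := (hu.pow 2).traceVar_mul_add hu hc
  rw [← pow_succ, pow_two, mul_inv_cancel_right, ← pow_two, hu.traceVar_sq hc] at h
  linear_combination h

theorem trace_mul (hu : IsUnip R μ u n) (hv : IsUnip R μ v n') :
    (R (u * v)).trace = 2 + (n * n').trace := by
  rw [map_mul, hu.map_eq, hv.map_eq, mul_add, add_mul, add_mul]
  simp [trace_eq_zero_of_mul_self hu.sq_eq_zero, trace_eq_zero_of_mul_self hv.sq_eq_zero]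

theorem det_eq_one (hu : IsUnip R μ u n) : (R u).det = 1 := by
  obtain ⟨a, b, d, hn, h⟩ := exists_coords_of_mul_self hu.sq_eq_zero
  rw [hu.map_eq, hn]
  simp [Matrix.det_fin_two]
  linear_combination -h

theorem traceVar_add_eq_zero_or [Finite G] {ℓ : ℕ} [Fact ℓ.Prime] [CharP k ℓ]
    (h2 : (2 : k) ≠ 0) (hu : IsUnip R μ u n) (hv : IsUnip R μ v n')
    (hc : IsTwistedCocycle R μ c) :
    traceVar R c u + traceVar R c v = 0 ∨ (n * n').trace = 0 ∨ (n * n').trace ^ 2 = 16 := by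
  by_contra! hcon
  obtain ⟨h0, hδ, h16⟩ := hcon
  have vanish {v n'} (hv : IsUnip R μ v n') (hδ : (n * n').trace ≠ 0)
      (h16 : (n * n').trace ^ 2 ≠ 16) : traceVar R c (u * v) = 0 := by
    refine hc.traceVar_eq_zero_of_disc_ne (ℓ := ℓ)
      (by rw [map_mul, hu.char_eq_one, hv.char_eq_one, one_mul]) fun hd => ?_
    rw [hu.trace_mul hv, map_mul, Matrix.det_mul, hu.det_eq_one, hv.det_eq_one] at hd
    have h3 : (n * n').trace + 4 = 0 := by
      apply (mul_eq_zero.mp _).resolve_left hδ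
      linear_combination hd
    exact h16 (by linear_combination ((n * n').trace - 4) * h3)
  have h := hu.traceVar_mul_add hv hc
  rw [vanish hv hδ h16, vanish hv.inv (by simpa using hδ) (by simpa using h16), add_zero] at h
  exact (mul_ne_zero h2 h0) h.symm

/-- A nonzero trace variation at a unipotent forces characteristic `5`. -/
theorem eq_five [Finite G] {ℓ : ℕ} [Fact ℓ.Prime] [CharP k ℓ] (hℓ2 : ℓ ≠ 2) (hℓ3 : ℓ ≠ 3)
    (hu : IsUnip R μ u n) (hv : IsUnip R μ v n') (hc : IsTwistedCocycle R μ c)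
    (hτ : traceVar R c u ≠ 0) (hδ : (n * n').trace ≠ 0) :
    ℓ = 5 ∧ (n * n').trace ^ 4 = 1 := by
  have prime_ne {p : ℕ} (hp : p.Prime) (h : ℓ ≠ p) : (p : k) ≠ 0 := by
    rw [Ne, CharP.cast_eq_zero_iff k ℓ, Nat.prime_dvd_prime_iff_eq Fact.out hp]
    exact h
  have h2 : (2 : k) ≠ 0 := by exact_mod_cast prime_ne Nat.prime_two hℓ2
  have h3 : (3 : k) ≠ 0 := by exact_mod_cast prime_ne Nat.prime_three hℓ3
  have c11 := hu.traceVar_add_eq_zero_or (ℓ := ℓ) h2 hv hc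
  have c12 := hu.traceVar_add_eq_zero_or (ℓ := ℓ) h2 (hv.pow 2) hc
  have c21 := (hu.pow 2).traceVar_add_eq_zero_or (ℓ := ℓ) h2 hv hc
  have c13 := hu.traceVar_add_eq_zero_or (ℓ := ℓ) h2 (hv.pow 3) hc
  rw [hu.traceVar_sq hc] at c21
  rw [hv.traceVar_sq hc] at c12
  rw [hv.traceVar_cube hc] at c13
  simp only [Nat.cast_ofNat, mul_smul_comm, smul_mul_assoc, Matrix.trace_smul, smul_eq_mul]
    at c12 c21 c13
  generalize (n * n').trace = δ at *
  generalize traceVar R c u = α at *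
  generalize traceVar R c v = β at *
  have five : (5 : k) = 0 ∧ δ ^ 4 = 1 := by
    have h4 : (2 : k) * 2 ≠ 0 := mul_ne_zero h2 h2
    grind
  refine ⟨?_, five.2⟩
  by_contra h5
  exact prime_ne Nat.prime_five h5 (by exact_mod_cast five.1)

theorem traceVar_eq_zero_of_char_three [CharP k 3] (hu : IsUnip R μ u n)
    (hc : IsTwistedCocycle R μ c) : traceVar R c u = 0 := by
  have h3 : (3 : k) = 0 := by exact_mod_cast CharP.cast_eq_zero k 3
  have h0 : c (u ^ 3) = 0 := by
    refine hc.eq_zero_of_scalar _ (by simp [hu.char_eq_one]) ⟨1, ?_⟩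
    rw [(hu.pow 3).map_eq]
    simp [h3]
  rw [pow_succ', pow_two, hc.map_mul_of_char_eq_one hu.char_eq_one,
    hc.map_mul_of_char_eq_one hu.char_eq_one, hu.map_inv, hu.map_eq] at h0
  rw [traceVar, hu.map_eq]
  obtain ⟨a, b, d, rfl, h⟩ := exists_coords_of_mul_self hu.sq_eq_zero
  obtain ⟨x, y, z, hx⟩ := exists_coords_of_trace_eq_zero (hc.trace_eq_zero u)
  rw [hx] at h0 ⊢
  have e00 := congrFun (congrFun h0 0) 0
  have e01 := congrFun (congrFun h0 0) 1
  have e10 := congrFun (congrFun h0 1) 0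
  simp [Matrix.one_fin_two] at e00 e01 e10
  simp [Matrix.trace_fin_two, Matrix.one_fin_two]
  grind

end IsUnip

section Unipotents

variable {k G : Type} [Field k] [Group G] {R : G →* Matrix (Fin 2) (Fin 2) k} {μ : G →* kˣ}
  {u v : G} {n n' : Matrix (Fin 2) (Fin 2) k}

theorem sub_half_trace_mul_self {X : Matrix (Fin 2) (Fin 2) k} (h2 : (2 : k) ≠ 0)
    (hd : X.trace ^ 2 = 4 * X.det) :
    (X - (X.trace / 2) • 1) * (X - (X.trace / 2) • 1) = 0 := by
  rw [Matrix.trace_fin_two, Matrix.det_fin_two] at hd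
  have h4 : (4 : k) ≠ 0 := by
    rw [show (4 : k) = 2 * 2 by norm_num]; exact mul_ne_zero h2 h2
  ext i j
  fin_cases i <;> fin_cases j <;>
    simp [Matrix.mul_apply, Fin.sum_univ_two, Matrix.trace_fin_two] <;> field_simp <;> grind

/-- An element of `ker μ` acting non-semisimply has a power acting as a nontrivial unipotent. -/
theorem exists_isUnip_of_disc_eq [Finite G] {ℓ : ℕ} [Fact ℓ.Prime] [CharP k ℓ]
    (h2 : (2 : k) ≠ 0) {g : G} (hg : μ g = 1) (hd : (R g).trace ^ 2 = 4 * (R g).det)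
    (hns : ¬ ∃ a : k, R g = a • 1) :
    ∃ u n, IsUnip R μ u n ∧ n ≠ 0 ∧ ∀ c, IsTwistedCocycle R μ c →
      traceVar R c g ≠ 0 → traceVar R c u ≠ 0 := by
  have hdet : (R g).det ≠ 0 := by
    intro h
    have : R g * R g⁻¹ = 1 := by rw [← map_mul]; simp
    simpa [h] using congrArg Matrix.det this
  set a := (R g).trace / 2 with ha
  have ha0 : a ≠ 0 := by
    intro h
    have ht : (R g).trace = 0 := by simpa [ha, h2] using h
    rw [ht, show (4 : k) = 2 * 2 by norm_num] at hd
    exact mul_ne_zero (mul_ne_zero h2 h2) hdet (by rw [← hd]; simp)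
  set n := a⁻¹ • R g - 1 with hn
  have hRg : R g = a • (1 + n) := by
    rw [hn, add_sub_cancel, smul_smul, mul_inv_cancel₀ ha0, one_smul]
  have hnn : n * n = 0 := by
    have h := sub_half_trace_mul_self h2 hd
    have e : n = a⁻¹ • (R g - a • 1) := by
      rw [smul_sub, smul_smul, inv_mul_cancel₀ ha0, one_smul]
    rw [e, smul_mul_assoc, mul_smul_comm, h, smul_zero, smul_zero]
  have hn0 : n ≠ 0 := fun h => hns ⟨a, by rw [hRg, h, add_zero]⟩
  have hpow (m : ℕ) : R (g ^ m) = a ^ m • (1 + (m : k) • n) := by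
    induction m with
    | zero => simp
    | succ m ih =>
      rw [pow_succ, map_mul, ih, hRg, smul_mul_smul_comm, ← pow_succ, mul_add, mul_one, add_mul,
        one_mul, smul_mul_assoc, hnn, smul_zero, add_zero, Nat.cast_succ, add_smul, one_smul,
        add_assoc]
  have htr : n.trace = 0 := trace_eq_zero_of_mul_self hnn
  have hcard : a ^ Nat.card G = 1 := by
    have h := hpow (Nat.card G)
    rw [pow_card_eq_one', map_one] at h
    have h' := congrArg Matrix.trace h
    simp [htr] at h'
    exact mul_right_cancel₀ h2 (by rw [← h', one_mul])
  obtain ⟨r, m, hm, hG⟩ :=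
    Nat.exists_eq_pow_mul_and_not_dvd (Nat.card_pos (α := G)).ne' ℓ (Fact.out : ℓ.Prime).ne_one
  have ham : a ^ m = 1 := by
    have h : (a ^ m - 1) ^ ℓ ^ r = 0 := by
      rw [sub_pow_char_pow, ← pow_mul, mul_comm m, ← hG, hcard]; simp
    exact sub_eq_zero.mp (eq_zero_of_pow_eq_zero h)
  have hcop : m.Coprime ℓ := ((Nat.Prime.coprime_iff_not_dvd Fact.out).mpr hm).symm
  obtain ⟨s, hs0, hs1⟩ := Nat.chineseRemainder hcop 0 1
  have has : a ^ s = 1 := by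
    obtain ⟨j, rfl⟩ := (Nat.modEq_zero_iff_dvd).mp hs0
    rw [pow_mul, ham, one_pow]
  have hsk : (s : k) = 1 := by
    have := (CharP.natCast_eq_natCast k ℓ).mpr hs1
    simpa using this
  have hu : IsUnip R μ (g ^ s) n :=
    ⟨by simp [hg], by rw [hpow, has, hsk, one_smul, one_smul], hnn⟩
  refine ⟨g ^ s, n, hu, hn0, fun c hc hτ => ?_⟩
  have hs : s ≠ 0 := by rintro rfl; simp at hsk
  obtain ⟨j, rfl⟩ := Nat.exists_eq_succ_of_ne_zero hs
  have hj : (j : k) = 0 := by simpa using hsk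
  have hcj : c (g ^ j) = 0 :=
    hc.eq_zero_of_scalar _ (by simp [hg]) ⟨a ^ j, by rw [hpow, hj, zero_smul, add_zero]⟩
  rw [traceVar, hu.map_eq, pow_succ', hc.map_mul_of_char_eq_one hg, hcj, mul_zero, zero_mul,
    add_zero]
  rw [traceVar, hRg, mul_smul_comm, Matrix.trace_smul] at hτ
  exact right_ne_zero_of_mul hτ

theorem mul_eq_zero_of_trace_mul_eq_zero (hn : n * n = 0) (hn' : n' * n' = 0)
    (h : (n * n').trace = 0) : n * n' = 0 := by
  obtain ⟨a, b, d, rfl, e⟩ := exists_coords_of_mul_self hn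
  obtain ⟨a', b', d', rfl, e'⟩ := exists_coords_of_mul_self hn'
  simp [Matrix.trace_fin_two] at h
  have h1 : a * a' + b * d' = 0 := by
    apply pow_eq_zero_iff (two_ne_zero) |>.mp; grind
  have h2 : a * b' - b * a' = 0 := by
    apply pow_eq_zero_iff (two_ne_zero) |>.mp; grind
  have h3 : d * a' - a * d' = 0 := by
    apply pow_eq_zero_iff (two_ne_zero) |>.mp; grind
  ext i j
  fin_cases i <;> fin_cases j <;> simp <;> grind

/-- A basis in which two opposite nilpotents are elementary matrices. -/
theorem exists_basis_of_trace_mul_ne_zero (hn : n * n = 0) (hn' : n' * n' = 0)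
    (h : (n * n').trace ≠ 0) :
    ∃ P : Matrix.GeneralLinearGroup (Fin 2) k,
      n * (P : Matrix (Fin 2) (Fin 2) k) = (P : Matrix (Fin 2) (Fin 2) k) * !![0, 1; 0, 0] ∧
      n' * (P : Matrix (Fin 2) (Fin 2) k) =
        (P : Matrix (Fin 2) (Fin 2) k) * !![0, 0; (n * n').trace, 0] := by
  obtain ⟨a, b, d, rfl, e⟩ := exists_coords_of_mul_self hn
  obtain ⟨a', b', d', rfl, e'⟩ := exists_coords_of_mul_self hn'
  simp [Matrix.trace_fin_two] at h ⊢
  by_cases hd : d' = 0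
  · have ha : a' = 0 := by
      rw [hd] at e'; simpa using e'
    subst hd ha
    have hP : (!![a * b', b'; d * b', 0] : Matrix (Fin 2) (Fin 2) k).det ≠ 0 := by
      rw [Matrix.det_fin_two_of]; intro h0
      simp at h h0
      grind
    refine ⟨Matrix.GeneralLinearGroup.mkOfDetNeZero _ hP, ?_, ?_⟩ <;>
    · ext i j
      fin_cases i <;> fin_cases j <;> simp [Matrix.GeneralLinearGroup.mkOfDetNeZero] <;> grind
  · have hP : (!![a * a' + b * d', a'; d * a' - a * d', d'] :
        Matrix (Fin 2) (Fin 2) k).det ≠ 0 := by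
      rw [Matrix.det_fin_two_of]; intro h0
      apply mul_ne_zero hd h
      linear_combination h0 + d * e'
    refine ⟨Matrix.GeneralLinearGroup.mkOfDetNeZero _ hP, ?_, ?_⟩ <;>
    · ext i j
      fin_cases i <;> fin_cases j <;> simp [Matrix.GeneralLinearGroup.mkOfDetNeZero] <;> grind

/-- In an irreducible representation a nilpotent has an opposite conjugate. -/
theorem exists_trace_mul_conj_ne_zero {ρ : G →* Matrix.GeneralLinearGroup (Fin 2) k}
    (hirr : MatIrred ρ) (hR : ∀ g, R g = ρ g) (hn : n * n = 0) (hn0 : n ≠ 0) :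
    ∃ t : G, (n * (R t * n * R t⁻¹)).trace ≠ 0 := by
  by_contra! hcon
  have key (t : G) : n * R t * n = 0 := by
    have e : R t⁻¹ * R t = 1 := by rw [← map_mul]; simp
    have hsq : (R t * n * R t⁻¹) * (R t * n * R t⁻¹) = 0 := by
      calc _ = R t * n * (R t⁻¹ * R t) * n * R t⁻¹ := by noncomm_ring
        _ = R t * (n * n) * R t⁻¹ := by rw [e]; noncomm_ring
        _ = 0 := by rw [hn]; simp
    have h := mul_eq_zero_of_trace_mul_eq_zero hn hsq (hcon t)
    calc n * R t * n = n * (R t * n * R t⁻¹) * R t := by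
          rw [mul_assoc n (R t * n * R t⁻¹), mul_assoc (R t * n), e, mul_one, mul_assoc]
      _ = 0 := by rw [h, zero_mul]
  let W : Submodule k (Fin 2 → k) := ⨅ t : G, LinearMap.ker (n * R t).mulVecLin
  have hW (x : Fin 2 → k) : x ∈ W ↔ ∀ t, (n * R t).mulVec x = 0 := by
    simp only [W, Submodule.mem_iInf, LinearMap.mem_ker, Matrix.mulVecLin_apply]
  rcases hirr W (fun g x hx => by
    rw [hW] at hx ⊢
    intro t
    rw [← hR, Matrix.mulVec_mulVec, mul_assoc, ← map_mul]
    exact hx _) with h | h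
  · apply hn0
    rw [← Matrix.mulVec_injective.eq_iff]
    funext x
    have : n.mulVec x ∈ W := by
      rw [hW]; intro t
      rw [Matrix.mulVec_mulVec, key, Matrix.zero_mulVec]
    rw [h, Submodule.mem_bot] at this
    rw [this, Matrix.zero_mulVec]
  · apply hn0
    rw [← Matrix.mulVec_injective.eq_iff]
    funext x
    have : x ∈ W := by rw [h]; trivial
    have := (hW x).mp this 1
    rwa [map_one, mul_one, ← Matrix.zero_mulVec x] at this

end Unipotents

section Coboundary

variable {k G : Type} [Field k] [Group G] {R : G →* Matrix (Fin 2) (Fin 2) k} {μ : G →* kˣ}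
  {c : G → Matrix (Fin 2) (Fin 2) k} {u v : G}

theorem IsTwistedCocycle.sub_coboundary (hc : IsTwistedCocycle R μ c)
    {A : Matrix (Fin 2) (Fin 2) k} (hA : A.trace = 0) :
    IsTwistedCocycle R μ (fun g => c g - ((μ g : k) • (R g * A * R g⁻¹) - A)) where
  trace_eq_zero g := by
    have e : R g⁻¹ * R g = 1 := by rw [← _root_.map_mul]; simp
    rw [Matrix.trace_sub, Matrix.trace_sub, Matrix.trace_smul, Matrix.trace_mul_comm, ← mul_assoc,
      e, one_mul, hA, hc.trace_eq_zero]
    simp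
  map_mul g h := by
    rw [hc.map_mul, _root_.map_mul, _root_.map_mul, mul_inv_rev, _root_.map_mul]
    simp only [mul_sub, sub_mul, smul_sub, mul_smul_comm, smul_mul_assoc, smul_smul, Units.val_mul,
      mul_assoc]
    abel
  eq_zero_of_scalar g hg hs := by
    obtain ⟨a, ha⟩ := hs
    have e : R g * R g⁻¹ = 1 := by rw [← _root_.map_mul]; simp
    have : R g * A * R g⁻¹ = A := by
      rw [ha, smul_one_mul, ← mul_smul_one, mul_assoc, ← ha, e, mul_one]
    rw [hc.eq_zero_of_scalar g hg ⟨a, ha⟩, this, hg]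
    simp

theorem traceVar_sub_coboundary {g : G} (hg : μ g = 1) (A : Matrix (Fin 2) (Fin 2) k) :
    traceVar R (fun g => c g - ((μ g : k) • (R g * A * R g⁻¹) - A)) g = traceVar R c g := by
  have e : R g⁻¹ * R g = 1 := by rw [← map_mul]; simp
  rw [traceVar, traceVar, hg, Units.val_one, one_smul, sub_mul, sub_mul, mul_assoc _ _ (R g), e,
    mul_one, Matrix.trace_sub, Matrix.trace_sub, Matrix.trace_mul_comm (R g), sub_self, sub_zero]

theorem eq_zero_of_traceVar_eq_zero {δ : k} (h2 : (2 : k) ≠ 0) (hδ : δ ≠ 0)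
    (hc : IsTwistedCocycle R μ c) (hu : IsUnip R μ u !![0, 1; 0, 0])
    (hv : IsUnip R μ v !![0, 0; δ, 0]) (hτ : ∀ g, μ g = 1 → traceVar R c g = 0)
    (hcu : c u = 0) (hcv : c v = 0) (g : G) : c g = 0 := by
  have hN (g : G) (hg : μ g = 1) : c g = 0 := by
    have key (w : G) (hw : μ w = 1) (hcw : c w = 0) : (c g * R g * R w).trace = 0 := by
      have h := hτ (g * w) (by rw [map_mul, hg, hw, one_mul])
      rwa [traceVar, hc.map_mul, hcw, mul_zero, zero_mul, smul_zero, add_zero, map_mul,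
        ← mul_assoc] at h
    have k1 := key 1 (map_one μ) hc.map_one
    have ku := key u hu.char_eq_one hcu
    have kv := key v hv.char_eq_one hcv
    have kuv := key (u * v) (by rw [map_mul, hu.char_eq_one, hv.char_eq_one, one_mul])
      (by rw [hc.map_mul, hcu, hcv]; simp)
    rw [map_mul, hu.map_eq, hv.map_eq] at kuv
    rw [hu.map_eq] at ku
    rw [hv.map_eq] at kv
    rw [map_one] at k1
    have hY : c g * R g = 0 := by
      generalize c g * R g = Y at *
      rw [Matrix.eta_fin_two Y] at *
      simp [Matrix.trace_fin_two, Matrix.one_fin_two] at k1 ku kv kuv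
      have h10 : Y 1 0 = 0 := by linear_combination ku - k1
      have h01 : Y 0 1 = 0 := by
        apply (mul_eq_zero.mp _).resolve_right hδ
        linear_combination kv - k1
      have h00 : Y 0 0 = 0 := by
        apply (mul_eq_zero.mp _).resolve_right hδ
        linear_combination kuv - k1 - h10 - δ * h01
      have h11 : Y 1 1 = 0 := by linear_combination k1 - h00
      rw [h00, h01, h10, h11]
      ext i j; fin_cases i <;> fin_cases j <;> rfl
    calc c g = c g * R g * R g⁻¹ := by rw [mul_assoc, ← map_mul]; simp
      _ = 0 := by rw [hY, zero_mul]
  have comm {w : G} (hw : μ w = 1) : R w * c g = c g * R w := by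
    have h1 := hc.map_mul_of_char_eq_one hw g
    have h3 := hc.map_mul g (g⁻¹ * w * g)
    rw [hN (g⁻¹ * w * g) (by simp [hw]), mul_zero, zero_mul, smul_zero, add_zero,
      show g * (g⁻¹ * w * g) = w * g by group, h1, hN w hw, zero_add] at h3
    rw [← h3, mul_assoc _ _ (R w), ← map_mul, inv_mul_cancel, map_one, mul_one, h3]
  have cu := comm hu.char_eq_one
  have cv := comm hv.char_eq_one
  obtain ⟨x, y, z, hx⟩ := exists_coords_of_trace_eq_zero (hc.trace_eq_zero g)
  rw [hu.map_eq, hx] at cu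
  rw [hv.map_eq, hx] at cv
  have u00 := congrFun (congrFun cu 0) 0
  have u01 := congrFun (congrFun cu 0) 1
  have v00 := congrFun (congrFun cv 0) 0
  simp [Matrix.one_fin_two] at u00 u01 v00
  have hx0 : x = 0 := by
    apply (mul_eq_zero.mp _).resolve_left h2
    linear_combination -u01
  rw [hx, u00, hx0, v00.resolve_right hδ]
  ext i j; fin_cases i <;> fin_cases j <;> simp

/-- Over opposite elementary unipotents, a cocycle with constant trace is a coboundary. -/
theorem exists_coboundary_of_elementary {δ : k} (h2 : (2 : k) ≠ 0) (hδ : δ ≠ 0)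
    (hc : IsTwistedCocycle R μ c) (hu : IsUnip R μ u !![0, 1; 0, 0])
    (hv : IsUnip R μ v !![0, 0; δ, 0]) (hτ : ∀ g, μ g = 1 → traceVar R c g = 0) :
    ∃ A : Matrix (Fin 2) (Fin 2) k, A.trace = 0 ∧
      ∀ g, c g = (μ g : k) • (R g * A * R g⁻¹) - A := by
  obtain ⟨p, q, r, hcu⟩ := exists_coords_of_trace_eq_zero (hc.trace_eq_zero u)
  obtain ⟨p', q', r', hcv⟩ := exists_coords_of_trace_eq_zero (hc.trace_eq_zero v)
  have tu := hτ u hu.char_eq_one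
  have tv := hτ v hv.char_eq_one
  have tuv := hτ (u * v) (by rw [map_mul, hu.char_eq_one, hv.char_eq_one, one_mul])
  rw [traceVar, hcu, hu.map_eq] at tu
  rw [traceVar, hcv, hv.map_eq] at tv
  rw [traceVar, hc.map_mul_of_char_eq_one hu.char_eq_one, hcu, hcv, map_mul, hu.map_eq, hv.map_eq,
    hu.map_inv] at tuv
  simp [Matrix.trace_fin_two, Matrix.one_fin_two, hδ] at tu tv tuv
  subst tu tv
  have hA : (!![-(q + p) / 2, -p' / δ; p, (q + p) / 2] : Matrix (Fin 2) (Fin 2) k).trace = 0 := by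
    rw [Matrix.trace_fin_two]; simp; ring
  refine ⟨_, hA, fun g => sub_eq_zero.mp ?_⟩
  refine eq_zero_of_traceVar_eq_zero h2 hδ (hc.sub_coboundary hA) hu hv
    (fun g hg => by rw [traceVar_sub_coboundary hg, hτ g hg]) ?_ ?_ g
  · simp only [hu.char_eq_one, hu.map_inv, hu.map_eq, hcu]
    ext i j
    fin_cases i <;> fin_cases j <;> simp [Matrix.one_fin_two] <;> field_simp <;> grind
  · simp only [hv.char_eq_one, hv.map_inv, hv.map_eq, hcv]
    ext i j
    fin_cases i <;> fin_cases j <;> simp [Matrix.one_fin_two] <;> field_simp <;> grind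

/-- Conjugation of a matrix representation by a change of basis. -/
def conjRep (R : G →* Matrix (Fin 2) (Fin 2) k) (P : Matrix.GeneralLinearGroup (Fin 2) k) :
    G →* Matrix (Fin 2) (Fin 2) k where
  toFun g := (P⁻¹ : Matrix.GeneralLinearGroup (Fin 2) k).val * R g * P.val
  map_one' := by simp
  map_mul' g h := by
    rw [map_mul, mul_assoc _ P.val, ← mul_assoc P.val, ← mul_assoc P.val, Units.mul_inv, one_mul]
    simp only [mul_assoc]

theorem IsTwistedCocycle.conjRep (hc : IsTwistedCocycle R μ c)
    (P : Matrix.GeneralLinearGroup (Fin 2) k) :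
    IsTwistedCocycle (conjRep R P) μ
      (fun g => (P⁻¹ : Matrix.GeneralLinearGroup (Fin 2) k).val * c g * P.val) where
  trace_eq_zero g := by
    rw [Matrix.trace_mul_comm, ← mul_assoc, Units.mul_inv, one_mul, hc.trace_eq_zero]
  map_mul g h := by
    have e (X : Matrix (Fin 2) (Fin 2) k) :
        P.val * ((P⁻¹ : Matrix.GeneralLinearGroup (Fin 2) k).val * X) = X := by
      rw [← mul_assoc, Units.mul_inv, one_mul]
    rw [hc.map_mul]
    simp only [_root_.conjRep, MonoidHom.coe_mk, OneHom.coe_mk, mul_add, add_mul, mul_smul_comm,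
      smul_mul_assoc, mul_assoc, e]
  eq_zero_of_scalar g hg hs := by
    obtain ⟨a, ha⟩ := hs
    rw [hc.eq_zero_of_scalar g hg ⟨a, ?_⟩]
    · simp
    · calc R g = P.val * (_root_.conjRep R P g) * (P⁻¹ : Matrix.GeneralLinearGroup (Fin 2) k).val := by
            simp only [_root_.conjRep, MonoidHom.coe_mk, OneHom.coe_mk]
            rw [← mul_assoc, ← mul_assoc, Units.mul_inv, one_mul, mul_assoc, Units.mul_inv, mul_one]
        _ = a • 1 := by rw [ha, mul_smul_one, smul_mul_assoc, Units.mul_inv]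

theorem traceVar_conjRep (P : Matrix.GeneralLinearGroup (Fin 2) k) (g : G) :
    traceVar (conjRep R P)
      (fun g => (P⁻¹ : Matrix.GeneralLinearGroup (Fin 2) k).val * c g * P.val) g =
      traceVar R c g := by
  have e (X : Matrix (Fin 2) (Fin 2) k) :
      P.val * ((P⁻¹ : Matrix.GeneralLinearGroup (Fin 2) k).val * X) = X := by
    rw [← mul_assoc, Units.mul_inv, one_mul]
  simp only [traceVar, conjRep, MonoidHom.coe_mk, OneHom.coe_mk, mul_assoc, e]
  rw [Matrix.trace_mul_comm]
  simp only [mul_assoc, Units.mul_inv, mul_one]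

theorem IsUnip.conjRep {n m : Matrix (Fin 2) (Fin 2) k} (hu : IsUnip R μ u n)
    (P : Matrix.GeneralLinearGroup (Fin 2) k) (h : n * P.val = P.val * m) :
    IsUnip (conjRep R P) μ u m := by
  have hm : m = (P⁻¹ : Matrix.GeneralLinearGroup (Fin 2) k).val * (n * P.val) := by
    rw [h, ← mul_assoc, Units.inv_mul, one_mul]
  refine ⟨hu.char_eq_one, ?_, ?_⟩
  · simp only [_root_.conjRep, MonoidHom.coe_mk, OneHom.coe_mk]
    rw [hu.map_eq, mul_add, add_mul, mul_one, Units.inv_mul, mul_assoc, ← hm]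
  · rw [hm]
    calc _ = (P⁻¹ : Matrix.GeneralLinearGroup (Fin 2) k).val * (n * (P.val *
          (P⁻¹ : Matrix.GeneralLinearGroup (Fin 2) k).val) * n) * P.val := by
          simp only [mul_assoc]
      _ = 0 := by rw [Units.mul_inv, mul_one, hu.sq_eq_zero]; simp

theorem exists_coboundary_of_traceVar_eq_zero {n n' : Matrix (Fin 2) (Fin 2) k}
    (h2 : (2 : k) ≠ 0) (hc : IsTwistedCocycle R μ c) (hu : IsUnip R μ u n)
    (hv : IsUnip R μ v n') (hδ : (n * n').trace ≠ 0)
    (hτ : ∀ g, μ g = 1 → traceVar R c g = 0) :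
    ∃ A : Matrix (Fin 2) (Fin 2) k, A.trace = 0 ∧
      ∀ g, c g = (μ g : k) • (R g * A * R g⁻¹) - A := by
  obtain ⟨P, hP, hP'⟩ := exists_basis_of_trace_mul_ne_zero hu.sq_eq_zero hv.sq_eq_zero hδ
  obtain ⟨A, hA, h⟩ := exists_coboundary_of_elementary h2 hδ (hc.conjRep P) (hu.conjRep P hP)
    (hv.conjRep P hP') (fun g hg => by rw [traceVar_conjRep, hτ g hg])
  refine ⟨P.val * A * (P⁻¹ : Matrix.GeneralLinearGroup (Fin 2) k).val, ?_, fun g => ?_⟩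
  · rw [Matrix.trace_mul_comm, ← mul_assoc, Units.inv_mul, one_mul, hA]
  · have e (X : Matrix (Fin 2) (Fin 2) k) :
        P.val * ((P⁻¹ : Matrix.GeneralLinearGroup (Fin 2) k).val * X) = X := by
      rw [← mul_assoc, Units.mul_inv, one_mul]
    have hg := congrArg
      (fun X => P.val * X * (P⁻¹ : Matrix.GeneralLinearGroup (Fin 2) k).val) (h g)
    simp only [conjRep, MonoidHom.coe_mk, OneHom.coe_mk, mul_sub, sub_mul, mul_smul_comm,
      smul_mul_assoc, mul_assoc, e, Units.mul_inv, mul_one] at hg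
    simpa only [mul_assoc] using hg

end Coboundary

/-- A `2 × 2` matrix conjugating the elementary nilpotents into matrices over a subfield is a
scalar multiple of a matrix over that subfield. -/
theorem exists_smul_of_conj_mem {k : Type} [Field k] (F : Subfield k)
    {X Y : Matrix (Fin 2) (Fin 2) k} (hXY : X * Y = 1)
    (h12 : ∀ i j, (X * !![0, 1; 0, 0] * Y : Matrix (Fin 2) (Fin 2) k) i j ∈ F)
    (h21 : ∀ i j, (X * !![0, 0; 1, 0] * Y : Matrix (Fin 2) (Fin 2) k) i j ∈ F) :
    ∃ x : k, x ≠ 0 ∧ ∀ i j, X i j / x ∈ F := by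
  have hdet : X.det * Y.det = 1 := by rw [← Matrix.det_mul, hXY, Matrix.det_one]
  have hY : Y = Y.det • X.adjugate := by
    have h := congrArg (fun Z => X.adjugate * Z) hXY
    simp only [← mul_assoc, Matrix.adjugate_mul, smul_one_mul, mul_one] at h
    rw [← h, smul_smul, mul_comm, hdet, one_smul]
  have h11 : ∀ i j, (X * !![1, 0; 0, 0] * Y : Matrix (Fin 2) (Fin 2) k) i j ∈ F := by
    intro i j
    have e : X * !![1, 0; 0, 0] * Y = X * !![0, 1; 0, 0] * Y * (X * !![0, 0; 1, 0] * Y) := by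
      have hYX : Y * X = 1 := mul_eq_one_comm.mp hXY
      calc _ = X * (!![0, 1; 0, 0] * (1 * !![0, 0; 1, 0])) * Y := by
            rw [one_mul, Matrix.mul_fin_two]; simp
        _ = _ := by rw [← hYX]; simp only [mul_assoc]
    rw [e, Matrix.mul_apply]
    exact F.sum_mem fun l _ => F.mul_mem (h12 i l) (h21 l j)
  set d := Y.det
  have hd : d ≠ 0 := right_ne_zero_of_mul_eq_one hdet
  rw [hY] at h12 h21 h11
  rw [Matrix.eta_fin_two X] at h12 h21 h11
  simp only [Matrix.adjugate_fin_two_of] at h12 h21 h11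
  have ha2 := h12 0 1
  have hac := h12 1 1
  have hb2 := F.neg_mem (h21 0 1)
  have hbd := h21 0 0
  have had := h11 0 0
  have hab := F.neg_mem (h11 0 1)
  have hbc := F.neg_mem (h11 1 1)
  simp at ha2 hac hb2 hbd had hab hbc
  have quot {x y : k} (hx : x ≠ 0) (h2 : x * (d * x) ∈ F) (h : y * (d * x) ∈ F) : y / x ∈ F := by
    have : y / x = (y * (d * x)) / (x * (d * x)) := by field_simp
    rw [this]; exact F.div_mem h h2
  have swap {x y : k} (h : x * (d * y) ∈ F) : y * (d * x) ∈ F := by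
    convert h using 1; ring
  by_cases ha : X 0 0 = 0
  · have hb : X 0 1 ≠ 0 := by
      intro hb
      rw [Matrix.det_fin_two, ha, hb] at hdet
      simp at hdet
    refine ⟨_, hb, fun i j => quot hb hb2 ?_⟩
    fin_cases i <;> fin_cases j
    exacts [hab, hb2, hbc, swap hbd]
  · refine ⟨_, ha, fun i j => quot ha ha2 ?_⟩
    fin_cases i <;> fin_cases j
    exacts [ha2, swap hab, hac, swap had]

theorem exists_sq_mul_of_zmod_five : ∀ p q : ZMod 5, p ≠ 0 → q ≠ 0 →
    (∃ e, e ≠ 0 ∧ p = e ^ 2) ∨ (∃ e, e ≠ 0 ∧ q = e ^ 2) ∨ ∃ e, e ≠ 0 ∧ q = e ^ 2 * p := by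
  decide

section PrimeSubfield

variable {k G : Type} [Field k] [Group G] [Fact (Nat.Prime 5)] (φ : ZMod 5 →+* k)
  {R : G →* Matrix (Fin 2) (Fin 2) k} {μ : G →* kˣ} {c : G → Matrix (Fin 2) (Fin 2) k} {u v : G}
  {δ : k}

theorem exists_map_of_specialLinearGroup (hu : IsUnip R μ u !![0, 1; 0, 0])
    (hv : IsUnip R μ v !![0, 0; δ, 0]) (hδ : δ ≠ 0) (hδF : δ ∈ φ.fieldRange)
    (B : Matrix.SpecialLinearGroup (Fin 2) (ZMod 5)) :
    ∃ g, μ g = 1 ∧ R g = B.val.map φ := by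
  have hφ (a : ZMod 5) : ((a.val : ℕ) : k) = φ a := by
    rw [← map_natCast φ, ZMod.natCast_zmod_val]
  refine Matrix.SL2.transvection_induction (fun B => ∃ g, μ g = 1 ∧ R g = B.val.map φ) ?_ ?_ B
  · intro i j hij a
    fin_cases i <;> fin_cases j
    · exact absurd rfl hij
    · refine ⟨u ^ a.val, (hu.pow _).char_eq_one, ?_⟩
      rw [(hu.pow _).map_eq, hφ]
      ext i j
      fin_cases i <;> fin_cases j <;>
        simp [Matrix.SpecialLinearGroup.transvection_coe]
    · obtain ⟨d, rfl⟩ := hδF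
      have hd : d ≠ 0 := fun h => hδ (by rw [h, map_zero])
      refine ⟨v ^ (a / d).val, (hv.pow _).char_eq_one, ?_⟩
      rw [(hv.pow _).map_eq, hφ]
      ext i j
      fin_cases i <;> fin_cases j <;>
        simp [Matrix.SpecialLinearGroup.transvection_coe, hδ]
    · exact absurd rfl hij
  · rintro A B ⟨g, hg, hA⟩ ⟨h, hh, hB⟩
    refine ⟨g * h, by rw [map_mul, hg, hh, one_mul], ?_⟩
    rw [map_mul, hA, hB, Matrix.SpecialLinearGroup.coe_mul, Matrix.map_mul]

theorem exists_map_smul_of_det_eq_sq (hu : IsUnip R μ u !![0, 1; 0, 0])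
    (hv : IsUnip R μ v !![0, 0; δ, 0]) (hδ : δ ≠ 0) (hδF : δ ∈ φ.fieldRange)
    {B : Matrix (Fin 2) (Fin 2) (ZMod 5)} {e : ZMod 5} (he : e ≠ 0) (hB : B.det = e ^ 2) :
    ∃ g, μ g = 1 ∧ B.map φ = φ e • R g := by
  obtain ⟨g, hg, h⟩ := exists_map_of_specialLinearGroup φ hu hv hδ hδF ⟨e⁻¹ • B, by
    rw [Matrix.det_smul, hB, Fintype.card_fin]; field_simp⟩
  refine ⟨g, hg, ?_⟩
  have hφ : φ e ≠ 0 := by rwa [Ne, map_eq_zero]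
  rw [h]
  ext i j
  simp [hφ]

variable [CharP k 5]

theorem mem_fieldRange_of_pow_four {x : k} (hx : x ^ 4 = 1) :
    x ∈ φ.fieldRange := by
  have h5 : (5 : k) = 0 := by exact_mod_cast CharP.cast_eq_zero k 5
  have h : (x - 1) * (x - 2) * (x - 3) * (x - 4) = 0 := by
    linear_combination hx + (-2 * x ^ 3 + 7 * x ^ 2 - 10 * x + 5) * h5
  have nat (m : ℕ) (h : x - m = 0) : x ∈ φ.fieldRange :=
    ⟨m, by rw [map_natCast, sub_eq_zero.mp h]⟩
  simp only [mul_eq_zero, or_assoc] at h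
  rcases h with h | h | h | h
  · exact nat 1 (by exact_mod_cast h)
  · exact nat 2 (by exact_mod_cast h)
  · exact nat 3 (by exact_mod_cast h)
  · exact nat 4 (by exact_mod_cast h)

variable [Finite G]

theorem trace_mul_mem_fieldRange {w w' : G} {s s' : Matrix (Fin 2) (Fin 2) k}
    (hc : IsTwistedCocycle R μ c) (hw : IsUnip R μ w s) (hw' : IsUnip R μ w' s')
    (hτ : traceVar R c w ≠ 0) : (s * s').trace ∈ φ.fieldRange := by
  by_cases h : (s * s').trace = 0
  · rw [h]; exact zero_mem _
  · exact mem_fieldRange_of_pow_four φ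
      (hw.eq_five (ℓ := 5) (by norm_num) (by norm_num) hw' hc hτ h).2

theorem unip_mem_fieldRange (hc : IsTwistedCocycle R μ c) (hu : IsUnip R μ u !![0, 1; 0, 0])
    (hv : IsUnip R μ v !![0, 0; δ, 0]) (hδ : δ ≠ 0)
    (hδF : δ ∈ φ.fieldRange) {w : G} {s : Matrix (Fin 2) (Fin 2) k}
    (hw : IsUnip R μ w s) (hτ : traceVar R c w ≠ 0) (i j : Fin 2) :
    s i j ∈ φ.fieldRange := by
  set F := φ.fieldRange
  have h1 : (s * _).trace ∈ F := trace_mul_mem_fieldRange φ hc hw hu hτ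
  have h2 : (s * _).trace ∈ F := trace_mul_mem_fieldRange φ hc hw hv hτ
  have h3 : (s * _).trace ∈ F := trace_mul_mem_fieldRange φ hc hw (hu.conj v) hτ
  rw [hv.map_eq, hv.map_inv] at h3
  obtain ⟨x, y, z, rfl, -⟩ := exists_coords_of_mul_self hw.sq_eq_zero
  simp [Matrix.trace_fin_two, Matrix.one_fin_two] at h1 h2 h3
  have hy : y ∈ F := by
    have := F.div_mem h2 hδF
    rwa [mul_div_cancel_right₀ _ hδ] at this
  have h20 : (2 : k) ≠ 0 := by
    have : ¬ 5 ∣ 2 := by norm_num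
    rw [← CharP.cast_eq_zero_iff k 5] at this
    exact_mod_cast this
  have h2F : (2 : k) ∈ F := ofNat_mem F 2
  have hx : x ∈ F := by
    have e : x = (z - δ * δ * y - (-(x * δ) + -(y * (δ * δ)) + (z + -(x * δ)))) / (2 * δ) := by
      field_simp; ring
    rw [e]
    refine F.div_mem (F.sub_mem (F.sub_mem h1 (F.mul_mem (F.mul_mem hδF hδF) hy)) ?_)
      (F.mul_mem h2F hδF)
    convert h3 using 1
  fin_cases i <;> fin_cases j
  exacts [hx, hy, h1, F.neg_mem hx]

theorem exists_smul_map (hc : IsTwistedCocycle R μ c) (hu : IsUnip R μ u !![0, 1; 0, 0])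
    (hv : IsUnip R μ v !![0, 0; δ, 0]) (hδ : δ ≠ 0) (hδF : δ ∈ φ.fieldRange)
    (hτu : traceVar R c u ≠ 0) (hτv : traceVar R c v ≠ 0) (g : G) :
    ∃ (x : k) (A : Matrix (Fin 2) (Fin 2) (ZMod 5)),
      x ≠ 0 ∧ A.det ≠ 0 ∧ R g = x • A.map φ := by
  have hg : R g * R g⁻¹ = 1 := by rw [← map_mul]; simp
  have conj {w : G} {s : Matrix (Fin 2) (Fin 2) k} (hw : IsUnip R μ w s)
      (hτ : traceVar R c w ≠ 0) (i j : Fin 2) : (R g * s * R g⁻¹) i j ∈ φ.fieldRange := by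
    refine unip_mem_fieldRange φ hc hu hv hδ hδF (hw.conj g) ?_ i j
    rw [hc.traceVar_conj hw.char_eq_one]
    exact mul_ne_zero (Units.ne_zero _) hτ
  obtain ⟨x, hx, h⟩ := exists_smul_of_conj_mem φ.fieldRange hg (conj hu hτu) fun i j => by
    have := φ.fieldRange.mul_mem (φ.fieldRange.inv_mem hδF) (conj hv hτv i j)
    have e : (!![0, 0; δ, 0] : Matrix (Fin 2) (Fin 2) k) = δ • !![0, 0; 1, 0] := by simp
    rwa [e, mul_smul_comm, smul_mul_assoc, Matrix.smul_apply, smul_eq_mul,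
      inv_mul_cancel_left₀ hδ] at this
  choose A hA using h
  have hRA : R g = x • (Matrix.of A).map φ := by
    ext i j
    simp [hA, mul_div_cancel₀ _ hx]
  refine ⟨x, Matrix.of A, hx, fun hdet => ?_, hRA⟩
  have := congrArg Matrix.det hg
  rw [Matrix.det_mul, hRA, Matrix.det_smul, ← RingHom.mapMatrix_apply, ← RingHom.map_det, hdet]
    at this
  simp at this

theorem exists_eq_smul_map (hc : IsTwistedCocycle R μ c) (hu : IsUnip R μ u !![0, 1; 0, 0])
    (hv : IsUnip R μ v !![0, 0; δ, 0]) (hδ : δ ≠ 0) (hδF : δ ∈ φ.fieldRange)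
    (hτu : traceVar R c u ≠ 0) (hτv : traceVar R c v ≠ 0) (hμ : μ ≠ 1)
    {B : Matrix (Fin 2) (Fin 2) (ZMod 5)} (hB : B.det ≠ 0) :
    ∃ (g : G) (x : k), B.map φ = x • R g := by
  obtain ⟨t, ht⟩ : ∃ t, μ t ≠ 1 := by
    by_contra! h
    exact hμ (MonoidHom.ext h)
  obtain ⟨x, A, hx, hA, hRt⟩ := exists_smul_map φ hc hu hv hδ hδF hτu hτv t
  rcases exists_sq_mul_of_zmod_five _ _ hA hB with ⟨e, he, h⟩ | ⟨e, he, h⟩ | ⟨e, he, h⟩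
  · obtain ⟨g, hg, h⟩ := exists_map_smul_of_det_eq_sq φ hu hv hδ hδF he h
    refine absurd ?_ ht
    have : μ (t * g⁻¹) = 1 := by
      refine hc.char_eq_one_of_scalar hu.char_eq_one hτu ⟨x * φ e, ?_⟩
      rw [map_mul, hRt, h, smul_smul, smul_mul_assoc, ← map_mul, mul_inv_cancel, map_one]
    rwa [map_mul, map_inv, hg, inv_one, mul_one] at this
  · obtain ⟨g, -, h⟩ := exists_map_smul_of_det_eq_sq φ hu hv hδ hδF he h
    exact ⟨g, _, h⟩
  · obtain ⟨g, -, h⟩ := exists_map_smul_of_det_eq_sq φ hu hv hδ hδF (B := A⁻¹ * B) he (by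
      rw [Matrix.det_mul, h, Matrix.det_nonsing_inv, Ring.inverse_eq_inv']; field_simp)
    refine ⟨t * g, x⁻¹ * φ e, ?_⟩
    rw [map_mul, hRt, mul_comm x⁻¹, mul_smul, smul_mul_assoc, inv_smul_smul₀ hx, ← mul_smul_comm,
      ← h, ← Matrix.map_mul, Matrix.mul_nonsing_inv_cancel_left _ _ (isUnit_iff_ne_zero.mpr hA)]

end PrimeSubfield

section ProjectiveImage

open Matrix.GeneralLinearGroup

theorem mk_eq_mk_iff_exists_smul {F : Type} [Field F] {a b : Matrix.GeneralLinearGroup (Fin 2) F} :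
    (QuotientGroup.mk a : PGL2 F) = QuotientGroup.mk b ↔ ∃ x : F, b.val = x • a.val := by
  rw [QuotientGroup.eq, mem_center_iff_val_mem_range_scalar]
  refine exists_congr fun x => ?_
  have e : Matrix.scalar (Fin 2) x = x • 1 := by
    rw [Matrix.scalar_apply, Matrix.smul_one_eq_diagonal]
  rw [e]
  constructor
  · intro h
    rw [← mul_inv_cancel_left a b, Units.val_mul, ← h, mul_smul_one]
  · intro h
    rw [Units.val_mul, h, mul_smul_comm, Units.inv_mul]

theorem nonempty_projImage_equiv {k F G : Type} [Field k] [Field F] [Group G]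
    (ρ : G →* Matrix.GeneralLinearGroup (Fin 2) k) (P : Matrix.GeneralLinearGroup (Fin 2) k)
    (φ : F →+* k)
    (h1 : ∀ g, ∃ (x : k) (A : Matrix (Fin 2) (Fin 2) F),
      x ≠ 0 ∧ A.det ≠ 0 ∧ (P⁻¹ * ρ g * P).val = x • A.map φ)
    (h2 : ∀ B : Matrix (Fin 2) (Fin 2) F, B.det ≠ 0 →
      ∃ (g : G) (x : k), B.map φ = x • (P⁻¹ * ρ g * P).val) :
    Nonempty (projImage ρ ≃* PGL2 F) := by
  let θ : Matrix.GeneralLinearGroup (Fin 2) F →* PGL2 k :=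
    ((QuotientGroup.mk' (Subgroup.center (Matrix.GeneralLinearGroup (Fin 2) k))).comp
      (MulAut.conj P).toMonoidHom).comp (Matrix.GeneralLinearGroup.map φ)
  have hθ (A) : θ A = QuotientGroup.mk (P * Matrix.GeneralLinearGroup.map φ A * P⁻¹) := rfl
  have hval (A : Matrix.GeneralLinearGroup (Fin 2) F) :
      (Matrix.GeneralLinearGroup.map φ A).val = A.val.map φ := rfl
  have hconj {g : G} {A : Matrix.GeneralLinearGroup (Fin 2) F} {x : k}
      (h : A.val.map φ = x • (P⁻¹ * ρ g * P).val) : θ A = QuotientGroup.mk (ρ g) := by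
    rw [hθ, eq_comm, mk_eq_mk_iff_exists_smul]
    refine ⟨x, ?_⟩
    rw [Units.val_mul, Units.val_mul, hval, h, mul_smul_comm, smul_mul_assoc, ← Units.val_mul,
      ← Units.val_mul]
    congr 2
    group
  have hrange : θ.range = projImage ρ := by
    ext y
    constructor
    · rintro ⟨A, rfl⟩
      obtain ⟨g, x, h⟩ := h2 A.val
        (isUnit_iff_ne_zero.mp ((Matrix.isUnit_iff_isUnit_det _).mp A.isUnit))
      exact ⟨g, (hconj h).symm⟩
    · rintro ⟨g, rfl⟩
      obtain ⟨x, A, hx, hA, h⟩ := h1 g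
      refine ⟨Matrix.GeneralLinearGroup.mkOfDetNeZero A hA, hconj (x := x⁻¹) ?_⟩
      rw [h, inv_smul_smul₀ hx]
      rfl
  have hker : θ.ker = Subgroup.center (Matrix.GeneralLinearGroup (Fin 2) F) := by
    ext A
    rw [MonoidHom.mem_ker, hθ, ← QuotientGroup.mk_one, eq_comm, mk_eq_mk_iff_exists_smul,
      mem_center_iff_val_mem_range_scalar]
    constructor
    · rintro ⟨x, hx⟩
      have hA : A.val.map φ = x • 1 := by
        calc A.val.map φ = (P⁻¹ * (P * Matrix.GeneralLinearGroup.map φ A * P⁻¹) * P).val := by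
              rw [← hval]; congr 1; group
          _ = x • 1 := by
              rw [Units.val_mul, Units.val_mul, hx, mul_smul_comm, smul_mul_assoc, Units.val_one,
                mul_one, Units.inv_mul]
      have e (i j) := congrFun (congrFun hA i) j
      refine ⟨A.val 0 0, ?_⟩
      have h00 := e 0 0
      have h01 := e 0 1
      have h10 := e 1 0
      have h11 := e 1 1
      simp at h00 h01 h10 h11
      ext i j
      fin_cases i <;> fin_cases j
      · simp
      · simp [h01]
      · simp [h10]
      · simpa using φ.injective (h00.trans h11.symm)
    · rintro ⟨a, ha⟩
      refine ⟨φ a, ?_⟩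
      have : A.val.map φ = φ a • 1 := by
        rw [← ha]
        ext i j
        fin_cases i <;> fin_cases j <;> simp
      rw [Units.val_mul, Units.val_mul, hval, this]
      simp
  exact ⟨((QuotientGroup.quotientMulEquivOfEq hker.symm).trans
    ((QuotientGroup.quotientKerEquivRange θ).trans (MulEquiv.subgroupCongr hrange))).symm⟩

end ProjectiveImage

section Vanishing

variable {k G : Type} [Field k] [Group G] [Finite G]
  {ρ : G →* Matrix.GeneralLinearGroup (Fin 2) k} {R : G →* Matrix (Fin 2) (Fin 2) k} {μ : G →* kˣ}
  {c : G → Matrix (Fin 2) (Fin 2) k} {u : G} {n : Matrix (Fin 2) (Fin 2) k}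

/-- A unipotent in `ker μ` along which the trace varies forces the exceptional case. -/
theorem exceptional_of_traceVar_ne_zero {ℓ : ℕ} [hℓ : Fact ℓ.Prime] [CharP k ℓ] (hℓ2 : ℓ ≠ 2)
    (hirr : MatIrred ρ) (hR : ∀ g, R g = ρ g) (hμ : μ ≠ 1) (hc : IsTwistedCocycle R μ c)
    (hu : IsUnip R μ u n) (hn0 : n ≠ 0) (hτ : traceVar R c u ≠ 0) :
    ℓ = 5 ∧ Nonempty (projImage ρ ≃* PGL2 (ZMod 5)) ∧
      ∀ g, (∃ a : k, R g = a • 1) → μ g = 1 := by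
  have hℓ3 : ℓ ≠ 3 := by
    rintro rfl
    exact hτ (hu.traceVar_eq_zero_of_char_three hc)
  obtain ⟨t, hδ⟩ := exists_trace_mul_conj_ne_zero hirr hR hu.sq_eq_zero hn0
  have hv := hu.conj t
  have hτv : traceVar R c (t * u * t⁻¹) ≠ 0 := by
    rw [hc.traceVar_conj hu.char_eq_one]
    exact mul_ne_zero (Units.ne_zero _) hτ
  obtain ⟨rfl, hδ4⟩ := hu.eq_five hℓ2 hℓ3 hv hc hτ hδ
  refine ⟨rfl, ?_, fun g hg => hc.char_eq_one_of_scalar hu.char_eq_one hτ hg⟩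
  have hδF := mem_fieldRange_of_pow_four (ZMod.castHom (dvd_refl 5) k) hδ4
  obtain ⟨P, hP, hP'⟩ := exists_basis_of_trace_mul_ne_zero hu.sq_eq_zero hv.sq_eq_zero hδ
  have hval (g : G) : conjRep R P g = (P⁻¹ * ρ g * P).val := by
    rw [Units.val_mul, Units.val_mul, ← hR]; rfl
  have hτu' := (traceVar_conjRep P u).trans_ne hτ
  have hτv' := (traceVar_conjRep P (t * u * t⁻¹)).trans_ne hτv
  refine nonempty_projImage_equiv ρ P (ZMod.castHom (dvd_refl 5) k) (fun g => ?_) fun B hB => ?_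
  · rw [← hval]
    exact exists_smul_map _ (hc.conjRep P) (hu.conjRep P hP) (hv.conjRep P hP') hδ hδF hτu' hτv' g
  · simp only [← hval]
    exact exists_eq_smul_map _ (hc.conjRep P) (hu.conjRep P hP) (hv.conjRep P hP') hδ hδF hτu' hτv'
      hμ hB

/-- Outside the exceptional case, twisted cocycles are coboundaries as soon as `ker μ` has a
nonscalar element with a repeated eigenvalue. -/
theorem exists_coboundary_of_disc_eq {ℓ : ℕ} [hℓ : Fact ℓ.Prime] [CharP k ℓ] [IsAlgClosed k]
    (hℓ2 : ℓ ≠ 2) (hirr : MatIrred ρ) (hR : ∀ g, R g = ρ g) (hμ : μ ≠ 1)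
    (hexc : ¬ (ℓ = 5 ∧ Nonempty (projImage ρ ≃* PGL2 (ZMod 5)) ∧
      ∀ g, (∃ a : k, R g = a • 1) → μ g = 1))
    (hc : IsTwistedCocycle R μ c) {g : G} (hg : μ g = 1)
    (hd : (R g).trace ^ 2 = 4 * (R g).det) (hns : ¬ ∃ a : k, R g = a • 1) :
    ∃ A : Matrix (Fin 2) (Fin 2) k, A.trace = 0 ∧
      ∀ g, c g = (μ g : k) • (R g * A * R g⁻¹) - A := by
  have h2 : (2 : k) ≠ 0 := by
    have : ((2 : ℕ) : k) ≠ 0 := by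
      rw [Ne, CharP.cast_eq_zero_iff k ℓ, Nat.prime_dvd_prime_iff_eq Fact.out Nat.prime_two]
      exact hℓ2
    exact_mod_cast this
  obtain ⟨u, n, hu, hn0, -⟩ := exists_isUnip_of_disc_eq h2 hg hd hns
  obtain ⟨t, hδ⟩ := exists_trace_mul_conj_ne_zero hirr hR hu.sq_eq_zero hn0
  refine exists_coboundary_of_traceVar_eq_zero h2 hc hu (hu.conj t) hδ fun h hh => ?_
  by_contra hτ
  have hd' : (R h).trace ^ 2 = 4 * (R h).det := by
    by_contra hd'
    exact hτ (hc.traceVar_eq_zero_of_disc_ne (ℓ := ℓ) hh hd')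
  have hns' : ¬ ∃ a : k, R h = a • 1 := fun hs => hτ (by
    rw [traceVar, hc.eq_zero_of_scalar h hh hs, zero_mul, Matrix.trace_zero])
  obtain ⟨w, m, hw, hm0, hcw⟩ := exists_isUnip_of_disc_eq h2 hh hd' hns'
  exact hexc (exceptional_of_traceVar_ne_zero hℓ2 hirr hR hμ hc hw hm0 (hcw c hc hτ))

end Vanishing

theorem exists_coboundary_of_card_ne_zero {k Γ V : Type} [Field k] [Group Γ] [Finite Γ]
    [AddCommGroup V] [Module k V] (σ : Representation k Γ V) (hΓ : (Nat.card Γ : k) ≠ 0)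
    {f : Γ → V} (hf : ∀ g h, f (g * h) = σ g (f h) + f g) :
    ∃ a, ∀ g, σ g a - a = f g := by
  have := Fintype.ofFinite Γ
  rw [Nat.card_eq_fintype_card] at hΓ
  refine ⟨-(Fintype.card Γ : k)⁻¹ • ∑ h, f h, fun g => ?_⟩
  have hS : ∑ h, f h = σ g (∑ h, f h) + (Fintype.card Γ : k) • f g := by
    calc ∑ h, f h = ∑ h, f (g * h) := (Equiv.sum_comp (Equiv.mulLeft g) f).symm
      _ = _ := by
        simp only [hf, Finset.sum_add_distrib, map_sum, Finset.sum_const, Finset.card_univ,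
          Nat.cast_smul_eq_nsmul]
  rw [map_smul, ← smul_sub, neg_smul, ← smul_neg, neg_sub, sub_eq_of_eq_add' hS,
    inv_smul_smul₀ hΓ]

theorem exists_smul_one_of_commute {k : Type} [Field k] {X : Matrix (Fin 2) (Fin 2) k}
    (h : ∀ A : Matrix (Fin 2) (Fin 2) k, A.trace = 0 → X * A = A * X) :
    ∃ a : k, X = a • 1 := by
  have h1 := h !![0, 1; 0, 0] (by simp [Matrix.trace_fin_two])
  have h2 := h !![0, 0; 1, 0] (by simp [Matrix.trace_fin_two])
  rw [Matrix.eta_fin_two X] at h1 h2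
  have e00 := congrFun (congrFun h1 0) 0
  have e01 := congrFun (congrFun h1 0) 1
  have e11 := congrFun (congrFun h2 0) 0
  simp at e00 e01 e11
  refine ⟨X 0 0, ?_⟩
  ext i j
  fin_cases i <;> fin_cases j <;> simp [← e01, e11, ← e00]

theorem disc_eq_of_pow_eq_smul_one {k : Type} [Field k] [IsAlgClosed k] {ℓ : ℕ} [Fact ℓ.Prime]
    [CharP k ℓ] {X : Matrix (Fin 2) (Fin 2) k} {b : k} (h : X ^ ℓ = b • 1) :
    X.trace ^ 2 = 4 * X.det := by
  obtain ⟨a, rfl⟩ := IsAlgClosed.exists_pow_nat_eq b (Fact.out : ℓ.Prime).pos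
  have hnil : IsNilpotent ((1 : k) • X + (-a) • 1) := by
    refine ⟨ℓ, ?_⟩
    rw [one_smul, neg_smul, ← sub_eq_add_neg,
      sub_pow_char_of_commute ℓ ((Commute.one_right X).smul_right a), h, smul_pow, one_pow, sub_self]
  have := disc_smul_add X 1 (-a)
  rw [disc_eq_zero_of_isNilpotent hnil] at this
  linear_combination -this


/-- Let `ℓ` be an odd prime, `k` algebraically closed of characteristic
`ℓ`, `G` a finite group, `ρ : G → GL₂(k)` irreducible and `μ : G → kˣ` of even order.  Let
`M = ad⁰ρ ⊗ μ` be the trace-zero matrices with the twisted conjugation action `σ`, and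
`K = ker μ ∩ {g : g acts trivially on M}` (formally `K = ker (μ.prod σ)`), so that `M` is a
`G/K`-module.  Outside the exceptional case (`ℓ = 5`, projective image `PGL₂(𝔽₅)`, `μ`
factoring through the projective image), `H¹(G/K, M) = 0`. -/
theorem h1_twisted_adjoint_eq_zero
    (ℓ : ℕ) (hℓ : ℓ.Prime) (hodd : ℓ ≠ 2)
    (k : Type) [Field k] [IsAlgClosed k] [CharP k ℓ]
    (G : Type) [Group G] [Finite G]
    (ρ : G →* Matrix.GeneralLinearGroup (Fin 2) k) (hirr : MatIrred ρ)
    (μ : G →* kˣ) (heven : Even (orderOf μ))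
    -- the twisted adjoint representation `ad⁰ρ ⊗ μ`
    (σ : Representation k G (LinearMap.ker (Matrix.traceLinearMap (Fin 2) k k)))
    (hσ : ∀ (g : G) (A : LinearMap.ker (Matrix.traceLinearMap (Fin 2) k k)),
      ((σ g A : Matrix (Fin 2) (Fin 2) k)) =
        (μ g : k) • ((ρ g : Matrix (Fin 2) (Fin 2) k) * (A : Matrix (Fin 2) (Fin 2) k) *
          ((ρ g)⁻¹ : Matrix (Fin 2) (Fin 2) k)))
    -- we are not in the exceptional case
    (hexc : ¬ (ℓ = 5 ∧
      Nonempty (↥(projImage ρ) ≃* PGL2 (ZMod 5)) ∧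
      ∀ g : G, (∃ a : k, (ρ g : Matrix (Fin 2) (Fin 2) k) =
        a • (1 : Matrix (Fin 2) (Fin 2) k)) → μ g = 1)) :
    ∀ σbar : Representation k (G ⧸ (μ.prod σ).ker)
        (LinearMap.ker (Matrix.traceLinearMap (Fin 2) k k)),
      (∀ g : G, σbar (QuotientGroup.mk g) = σ g) →
      Limits.IsZero (groupCohomology (Rep.of σbar) 1) := by
  intro σbar hσbar
  have : Fact ℓ.Prime := ⟨hℓ⟩
  have hμ : μ ≠ 1 := by
    rintro rfl
    rw [orderOf_one] at heven
    exact Nat.not_even_one heven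
  let R : G →* Matrix (Fin 2) (Fin 2) k := (Units.coeHom _).comp ρ
  have hR (g : G) : R g = ρ g := rfl
  have hRinv (g : G) : R g⁻¹ = ((ρ g)⁻¹ : Matrix (Fin 2) (Fin 2) k) := by
    rw [hR, map_inv, Matrix.coe_units_inv]
  have hconj (g : G) (A : LinearMap.ker (Matrix.traceLinearMap (Fin 2) k k)) :
      (σ g A : Matrix (Fin 2) (Fin 2) k) = (μ g : k) • (R g * A * R g⁻¹) := by
    rw [hσ, hRinv, hR]
  have hcancel (g : G) : R g⁻¹ * R g = 1 := by rw [← map_mul]; simp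
  have hcancel' (g : G) : R g * R g⁻¹ = 1 := by rw [← map_mul]; simp
  have hscalar {g : G} (hg : μ g = 1) : σ g = 1 ↔ ∃ a : k, R g = a • 1 := by
    constructor
    · intro h
      refine exists_smul_one_of_commute fun A hA => ?_
      have e := hconj g ⟨A, hA⟩
      rw [h, hg, Units.val_one, one_smul] at e
      calc R g * A = R g * A * R g⁻¹ * R g := by rw [mul_assoc _ _ (R g), hcancel, mul_one]
        _ = A * R g := by rw [← e]; rfl
    · rintro ⟨a, ha⟩
      ext1 A
      apply Subtype.ext
      rw [hconj, hg, Units.val_one, one_smul, ha, smul_one_mul, ← mul_smul_one, mul_assoc, ← ha,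
        hcancel', mul_one]
      rfl
  have hmem {g : G} : g ∈ (μ.prod σ).ker ↔ μ g = 1 ∧ σ g = 1 := by
    rw [MonoidHom.mem_ker, MonoidHom.prod_apply, Prod.mk_eq_one]
  have key (f : G ⧸ (μ.prod σ).ker → LinearMap.ker (Matrix.traceLinearMap (Fin 2) k k))
      (hf : ∀ g h, f (g * h) = σbar g (f h) + f g) : ∃ a, ∀ g, σbar g a - a = f g := by
    by_cases hcard : ℓ ∣ Nat.card (G ⧸ (μ.prod σ).ker)
    · obtain ⟨x, hx⟩ := exists_prime_orderOf_dvd_card' ℓ hcard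
      obtain ⟨g, rfl⟩ := QuotientGroup.mk_surjective x
      have hgK : ¬ (μ g = 1 ∧ σ g = 1) := by
        rw [← hmem, ← QuotientGroup.eq_one_iff, ← orderOf_eq_one_iff, hx]
        exact hℓ.ne_one
      have hgℓ : μ (g ^ ℓ) = 1 ∧ σ (g ^ ℓ) = 1 := by
        rw [← hmem, ← QuotientGroup.eq_one_iff, QuotientGroup.mk_pow, ← hx, pow_orderOf_eq_one]
      have hg : μ g = 1 := by
        have h := hgℓ.1
        rw [map_pow, Units.ext_iff, Units.val_pow_eq_pow_val, Units.val_one] at h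
        exact Units.ext (frobenius_inj k ℓ (by simpa [frobenius_def] using h))
      obtain ⟨b, hb⟩ := (hscalar hgℓ.1).mp hgℓ.2
      rw [map_pow] at hb
      have hf1 : f 1 = 0 := by
        have h := hf 1 1
        rw [mul_one, map_one] at h
        simpa using h
      have hc : IsTwistedCocycle R μ (fun g => (f (QuotientGroup.mk g)).val) := by
        refine ⟨fun g => (f (QuotientGroup.mk g)).2, fun g h => ?_, fun g hg hs => ?_⟩
        · rw [QuotientGroup.mk_mul, hf, hσbar, Submodule.coe_add, hconj, add_comm]
        · rw [(QuotientGroup.eq_one_iff g).mpr (hmem.mpr ⟨hg, (hscalar hg).mpr hs⟩), hf1]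
          rfl
      obtain ⟨A, hA, h⟩ := exists_coboundary_of_disc_eq hodd hirr hR hμ hexc hc hg
        (disc_eq_of_pow_eq_smul_one hb) fun hs => hgK ⟨hg, (hscalar hg).mpr hs⟩
      refine ⟨⟨A, hA⟩, fun y => ?_⟩
      obtain ⟨t, rfl⟩ := QuotientGroup.mk_surjective y
      apply Subtype.ext
      rw [hσbar, Submodule.coe_sub, hconj, h]
    · exact exists_coboundary_of_card_ne_zero σbar
        (by rwa [Ne, CharP.cast_eq_zero_iff k ℓ]) hf
  have hsub (x : groupCohomology.H1 (Rep.of σbar)) : x = 0 := by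
    induction x using groupCohomology.H1_induction_on with
    | _ f =>
      rw [groupCohomology.H1π_eq_zero_iff]
      obtain ⟨a, ha⟩ := key f ((groupCohomology.mem_cocycles₁_iff _).mp f.2)
      refine ⟨a, funext fun g => ?_⟩
      rw [groupCohomology.d₀₁_hom_apply]
      exact ha g
  have : Subsingleton (groupCohomology.H1 (Rep.of σbar)) := ⟨fun x y => by rw [hsub x, hsub y]⟩
  exact ModuleCat.isZero_of_subsingleton (groupCohomology.H1 (Rep.of σbar))
end

section
/- Let Λ be a complete noetherian local domain with maximal ideal m_Λ and fraction field K, and let I ⊆ m_Λ be an ideal. Let R̃ be a complete noetherian local ring equipped with a local ring homomorphism Λ → R̃, let M̃ be an R̃-module, and let T̃ denote the image of R̃ in End_Λ(M̃); write R = R̃/I·R̃ and M = M̃/I·M̃ (an R-module). Assume: (1) M̃ is a finite free Λ-module; (2) M is a free R-module of some rank α ≥ 1 and the action of R on M is faithful; (3) T̃ is reduced and M̃ ⊗_Λ K is a free T̃ ⊗_Λ K-module of rank α. Then the canonical surjection R̃ → T̃ is an isomorphism, T̃ (hence R̃) is a finite free Λ-module, and M̃ is a free R̃-module of rank α. -/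
open IsLocalRing

/-- If `M / J M` is free of rank `α` over `R / J` with `J` inside the Jacobson radical and `M`
is finite, then lifting a basis gives a surjection `R ^ α → M`. -/
theorem exists_surjective_of_quotient_equiv {R M : Type*} [CommRing R] [AddCommGroup M]
    [Module R M] [Module.Finite R M] {J : Ideal R} (hJ : J ≤ Ideal.jacobson ⊥) {α : ℕ}
    (e : (M ⧸ (J • (⊤ : Submodule R M))) ≃ₗ[R ⧸ J] (Fin α → R ⧸ J)) :
    ∃ f : (Fin α → R) →ₗ[R] M, Function.Surjective f := by
  let q : (Fin α → R) →ₗ[R] (Fin α → R ⧸ J) := (J.mkQ).compLeft (Fin α)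
  have hq : Function.Surjective q := (Submodule.mkQ_surjective J).comp_left
  let e' : (M ⧸ (J • (⊤ : Submodule R M))) ≃ₗ[R] (Fin α → R ⧸ J) := e.restrictScalars R
  obtain ⟨f, hf⟩ := Module.projective_lifting_property (J • (⊤ : Submodule R M)).mkQ
    (e'.symm.toLinearMap ∘ₗ q) (Submodule.mkQ_surjective _)
  refine ⟨f, LinearMap.range_eq_top.mp (top_le_iff.mp ?_)⟩
  refine Submodule.le_of_le_smul_of_le_jacobson_bot Module.Finite.fg_top hJ fun m _ ↦ ?_
  obtain ⟨v, hv⟩ := (e'.symm.surjective.comp hq) ((J • (⊤ : Submodule R M)).mkQ m)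
  have hfv : (J • (⊤ : Submodule R M)).mkQ (f v) = (J • (⊤ : Submodule R M)).mkQ m :=
    (LinearMap.congr_fun hf v).trans hv
  have hmem : m - f v ∈ J • (⊤ : Submodule R M) :=
    (Submodule.Quotient.eq _).mp hfv.symm
  exact Submodule.mem_sup.mpr ⟨f v, ⟨v, rfl⟩, m - f v, hmem, by abel⟩

/-- A surjection `T ^ α → M` is injective as soon as `M` becomes free of rank `α` after
inverting a set of non-zero-divisors of `T`. -/
theorem injective_of_surjective_of_localizedModule_equiv {T M : Type*} [CommRing T]
    [AddCommGroup M] [Module T M] {S : Submonoid T} (hS : S ≤ nonZeroDivisors T) {α : ℕ}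
    (e : LocalizedModule S M ≃ₗ[Localization S] (Fin α → Localization S))
    (f : (Fin α → T) →ₗ[T] M) (hf : Function.Surjective f) : Function.Injective f := by
  let ι : (Fin α → T) →ₗ[T] (Fin α → Localization S) :=
    LinearMap.pi fun i ↦ Algebra.linearMap T (Localization S) ∘ₗ LinearMap.proj i
  let φ : (Fin α → Localization S) →ₗ[T] LocalizedModule S M :=
    IsLocalizedModule.map S ι (LocalizedModule.mkLinearMap S M) f
  have hφ : Function.Surjective φ := IsLocalizedModule.map_surjective S ι _ f hf
  let ψ : (Fin α → Localization S) →ₗ[Localization S] (Fin α → Localization S) :=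
    e.toLinearMap ∘ₗ φ.extendScalarsOfIsLocalization S (Localization S)
  have hψ : Function.Injective ψ :=
    OrzechProperty.injective_of_surjective_endomorphism ψ (e.surjective.comp hφ)
  have hι : Function.Injective ι :=
    (IsLocalization.injective (Localization S) hS).comp_left
  refine (injective_iff_map_eq_zero f).mpr fun v hv ↦ hι (hψ ?_)
  have hφv : φ (ι v) = 0 := by
    rw [IsLocalizedModule.map_apply, hv, map_zero]
  change e (φ (ι v)) = ψ (ι 0)
  rw [hφv, map_zero, map_zero, map_zero]

/-- A surjection of `Λ`-algebras onto a projective `Λ`-module, whose kernel lies in the extension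
of an ideal `I` that generates a subideal of the Jacobson radical, is injective. -/
theorem injective_of_ker_le_map {Λ R T : Type*} [CommRing Λ] [CommRing R] [CommRing T]
    [Algebra Λ R] [Algebra Λ T] [IsNoetherianRing R] [Module.Projective Λ T] {I : Ideal Λ}
    (hI : I.map (algebraMap Λ R) ≤ Ideal.jacobson ⊥) (θ : R →ₐ[Λ] T)
    (hθ : Function.Surjective θ) (hker : RingHom.ker θ ≤ I.map (algebraMap Λ R)) :
    Function.Injective θ := by
  obtain ⟨s, hs⟩ := Module.projective_lifting_property θ.toLinearMap LinearMap.id hθ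
  have hs' (t : T) : θ (s t) = t := LinearMap.congr_fun hs t
  let p : R →ₗ[Λ] R := LinearMap.id - s ∘ₗ θ.toLinearMap
  have hp (r : R) : p r ∈ RingHom.ker θ := by
    simp [p, RingHom.mem_ker, hs']
  have hpI (r : R) (hr : r ∈ I.map (algebraMap Λ R)) :
      p r ∈ I.map (algebraMap Λ R) • RingHom.ker θ := by
    have hr' : r ∈ I • (⊤ : Submodule Λ R) := by
      rw [Ideal.smul_top_eq_map]
      exact hr
    induction hr' using Submodule.smul_induction_on' with
    | smul a ha x _ =>
      rw [map_smul, ← algebraMap_smul R a (p x)]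
      exact Submodule.smul_mem_smul (Ideal.mem_map_of_mem (algebraMap Λ R) ha) (hp x)
    | add x hx y hy ihx ihy =>
      rw [Ideal.smul_top_eq_map] at hx hy
      rw [map_add]
      exact add_mem (ihx hx) (ihy hy)
  have hbot : RingHom.ker θ = ⊥ := by
    refine Submodule.eq_bot_of_le_smul_of_le_jacobson_bot _ _ (IsNoetherian.noetherian _)
      (fun x hx ↦ ?_) hI
    have hpx : p x = x := by
      have : θ x = 0 := hx
      simp [p, this]
    exact hpx ▸ hpI x (hker hx)
  exact (RingHom.injective_iff_ker_eq_bot _).mpr hbot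

/-- exact control.  Let `Λ` be a complete noetherian local domain with
fraction field `K` and `I ⊆ m_Λ` an ideal, `R̃` a complete noetherian local `Λ`-algebra
and `M̃` an `R̃`-module.  Let `T̃` be the image of `R̃` in `End_Λ(M̃)` — formalized as a
commutative `Λ`-algebra `T` with a surjection `θ : R̃ → T` acting compatibly and
faithfully on `M̃`.  Write `R = R̃/I·R̃` and `M = M̃/I·M̃`.  Assume (1) `M̃` is finite free
over `Λ`; (2) `M` is a free `R`-module of rank `α ≥ 1` with faithful `R`-action;
(3) `T̃` is reduced and `M̃ ⊗_Λ K` is free of rank `α` over `T̃ ⊗_Λ K`.  Then `R̃ → T̃`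
is an isomorphism, `T̃` (hence `R̃`) is finite free over `Λ` and `M̃` is a free
`R̃`-module of rank `α`. -/
theorem exact_control
    (Λ : Type) [CommRing Λ] [IsDomain Λ] [IsLocalRing Λ] [IsNoetherianRing Λ]
    [IsAdicComplete (maximalIdeal Λ) Λ]
    (I : Ideal Λ) (hI : I ≤ maximalIdeal Λ)
    (Rt : Type) [CommRing Rt] [IsLocalRing Rt] [IsNoetherianRing Rt]
    [IsAdicComplete (maximalIdeal Rt) Rt] [Algebra Λ Rt] [IsLocalHom (algebraMap Λ Rt)]
    (Mt : Type) [AddCommGroup Mt] [Module Rt Mt] [Module Λ Mt] [IsScalarTower Λ Rt Mt]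
    -- `T` is the image of `R̃` in `End_Λ(M̃)`
    (T : Type) [CommRing T] [Algebra Λ T] (θ : Rt →ₐ[Λ] T) (hθ : Function.Surjective θ)
    [Module T Mt] [IsScalarTower Λ T Mt]
    (hcompat : ∀ (r : Rt) (m : Mt), θ r • m = r • m)
    [FaithfulSMul T Mt]
    -- (1) `M̃` is a finite free `Λ`-module
    [Module.Finite Λ Mt] [Module.Free Λ Mt]
    -- (2) `M = M̃/I·M̃` is a free `R = R̃/I·R̃`-module of rank `α ≥ 1`, with faithful action
    (α : ℕ) (hα : 1 ≤ α)
    (hMfree : Nonempty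
      ((Mt ⧸ ((Ideal.map (algebraMap Λ Rt) I) • (⊤ : Submodule Rt Mt)))
        ≃ₗ[Rt ⧸ Ideal.map (algebraMap Λ Rt) I]
        (Fin α → (Rt ⧸ Ideal.map (algebraMap Λ Rt) I))))
    (hMfaith : FaithfulSMul (Rt ⧸ Ideal.map (algebraMap Λ Rt) I)
      (Mt ⧸ ((Ideal.map (algebraMap Λ Rt) I) • (⊤ : Submodule Rt Mt))))
    -- (3) `T̃` is reduced and `M̃ ⊗_Λ K` is free of rank `α` over `T̃ ⊗_Λ K`
    (hred : IsReduced T)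
    (hKfree : Nonempty
      ((LocalizedModule (Submonoid.map (algebraMap Λ T) (nonZeroDivisors Λ)) Mt)
        ≃ₗ[Localization (Submonoid.map (algebraMap Λ T) (nonZeroDivisors Λ))]
        (Fin α → Localization (Submonoid.map (algebraMap Λ T) (nonZeroDivisors Λ))))) :
    Function.Bijective θ ∧
      (Module.Finite Λ T ∧ Module.Free Λ T) ∧
      (Module.Finite Λ Rt ∧ Module.Free Λ Rt) ∧
      Nonempty (Mt ≃ₗ[Rt] (Fin α → Rt)) := by
  have hJ : I.map (algebraMap Λ Rt) ≤ maximalIdeal Rt :=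
    (Ideal.map_mono hI).trans (((local_hom_TFAE (algebraMap Λ Rt)).out 0 2).mp ‹IsLocalHom (algebraMap Λ Rt)›)
  have hJjac : I.map (algebraMap Λ Rt) ≤ Ideal.jacobson ⊥ :=
    hJ.trans (maximalIdeal_le_jacobson ⊥)
  have : Module.Finite Rt Mt := Module.Finite.of_restrictScalars_finite Λ Rt Mt
  obtain ⟨eM⟩ := hMfree
  obtain ⟨eK⟩ := hKfree
  obtain ⟨f, hf⟩ := exists_surjective_of_quotient_equiv hJjac eM
  let g : (Fin α → T) →ₗ[T] Mt := Fintype.linearCombination T fun i ↦ f (Pi.single i 1)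
  have hgf (v : Fin α → Rt) : g (fun i ↦ θ (v i)) = f v := by
    conv_rhs => rw [pi_eq_sum_univ' v, map_sum]
    simp only [g, Fintype.linearCombination_apply, hcompat, ← map_smul]
  have hg : Function.Surjective g := fun m ↦ by
    obtain ⟨v, rfl⟩ := hf m
    exact ⟨fun i ↦ θ (v i), hgf v⟩
  have hS : Submonoid.map (algebraMap Λ T) (nonZeroDivisors Λ) ≤ nonZeroDivisors T := by
    rintro _ ⟨a, ha, rfl⟩
    refine mem_nonZeroDivisors_iff_right.mpr fun t ht ↦ ?_
    refine FaithfulSMul.eq_of_smul_eq_smul (α := Mt) fun m ↦ ?_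
    have h : a • (t • m) = 0 := by
      rw [← smul_assoc, Algebra.smul_def, mul_comm, ht, zero_smul]
    rw [zero_smul]
    exact (smul_eq_zero.mp h).resolve_left (nonZeroDivisors.ne_zero ha)
  let eT : (Fin α → T) ≃ₗ[T] Mt := LinearEquiv.ofBijective g
    ⟨injective_of_surjective_of_localizedModule_equiv hS eK g hg, hg⟩
  let eΛ : (Fin α → T) ≃ₗ[Λ] Mt := eT.restrictScalars Λ
  let i₀ : Fin α := ⟨0, hα⟩
  let pr : Mt →ₗ[Λ] T := LinearMap.proj i₀ ∘ₗ eΛ.symm.toLinearMap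
  let inc : T →ₗ[Λ] Mt := eΛ.toLinearMap ∘ₗ LinearMap.single Λ (fun _ ↦ T) i₀
  have hpr : pr ∘ₗ inc = LinearMap.id := by
    ext t
    simp [pr, inc]
  have hprs : Function.Surjective pr := fun t ↦ ⟨inc t, LinearMap.congr_fun hpr t⟩
  have hTfin : Module.Finite Λ T := Module.Finite.of_surjective pr hprs
  have hTproj : Module.Projective Λ T := Module.Projective.of_split inc pr hpr
  have hTfree : Module.Free Λ T := Module.free_of_flat_of_isLocalRing
  have hker : RingHom.ker θ ≤ I.map (algebraMap Λ Rt) := fun x hx ↦ by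
    refine Ideal.Quotient.eq_zero_iff_mem.mp
      (hMfaith.eq_of_smul_eq_smul fun m ↦ ?_)
    obtain ⟨m, rfl⟩ := Submodule.Quotient.mk_surjective _ m
    have hx0 : θ x = 0 := hx
    have hxm : x • m = 0 := by rw [← hcompat, hx0, zero_smul]
    rw [zero_smul]
    change Submodule.Quotient.mk (x • m) = 0
    rw [hxm, Submodule.Quotient.mk_zero]
  have hinj : Function.Injective θ := injective_of_ker_le_map hJjac θ hθ hker
  let eθ : Rt ≃ₐ[Λ] T := AlgEquiv.ofBijective θ ⟨hinj, hθ⟩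
  refine ⟨⟨hinj, hθ⟩, ⟨hTfin, hTfree⟩,
    ⟨Module.Finite.equiv eθ.symm.toLinearEquiv, Module.Free.of_equiv eθ.symm.toLinearEquiv⟩,
    ⟨(LinearEquiv.ofBijective f ⟨?_, hf⟩).symm⟩⟩
  refine (injective_iff_map_eq_zero f).mpr fun v hv ↦ ?_
  have hθv : (fun i ↦ θ (v i)) = 0 := eT.map_eq_zero_iff.mp ((hgf v).trans hv)
  funext i
  exact (map_eq_zero_iff θ hinj).mp (congr_fun hθv i)
end
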